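/- Let F be a field other than the two-element field and let σ : F → F be a nontrivial field involution such that −1 = σ(a)·a + σ(b)·b for some a, b ∈ F. Then the stabilization map U(n,F,σ) → U(n+1,F,σ) induces an isomorphism H_d(U(n,F,σ); ℤ) → H_d(U(n+1,F,σ); ℤ) whenever 2d ≤ n − 4, and a surjection whenever 2d ≤ n − 3. Moreover, if −1 = σ(a)·a for some a ∈ F, then the map is an isomorphism whenever 2d ≤ n − 2 and a surjection whenever 2d ≤ n − 1. -/

import Mathlib

/-! # Group homology via the inhomogeneous bar complex (trivial coefficients) -/

namespace GroupHomologyBar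

variable (G : Type) [Group G] (A : Type) [AddCommGroup A]

/-- Inhomogeneous `n`-chains of `G` with coefficients in `A`. -/
abbrev chains (n : ℕ) : Type := (Fin n → G) →₀ A

/-- The differential of the inhomogeneous bar complex with trivial `G`-action on the
coefficients, sending `[g₁|…|g_{n+1}] ⊗ a` to
`[g₂|…|g_{n+1}] ⊗ a + ∑ⱼ (-1)^{j+1} [g₁|…|gⱼg_{j+1}|…|g_{n+1}] ⊗ a`
(the last summand of the sum being `(-1)^{n+1} [g₁|…|g_n] ⊗ a`). -/
noncomputable def d (n : ℕ) : chains G A (n + 1) →ₗ[ℤ] chains G A n :=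
  Finsupp.lsum ℤ fun g =>
    (Finsupp.lsingle (Fin.tail g) : A →ₗ[ℤ] chains G A n)
      + ∑ j : Fin (n + 1),
          ((-1 : ℤ) ^ ((j : ℕ) + 1)) • Finsupp.lsingle (Fin.contractNth j (· * ·) g)

/-- The `n`-cycles. -/
noncomputable def cycles : (n : ℕ) → Submodule ℤ (chains G A n)
  | 0 => ⊤
  | (n + 1) => LinearMap.ker (d G A n)

/-- The `n`-boundaries, viewed as a submodule of the `n`-cycles. -/
noncomputable def boundaries (n : ℕ) : Submodule ℤ (cycles G A n) :=
  Submodule.comap (cycles G A n).subtype (LinearMap.range (d G A n))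

/-- The group homology `H_n(G; A)` of `G` with trivial coefficients in `A`. -/
abbrev Homology (n : ℕ) : Type := cycles G A n ⧸ boundaries G A n

variable {G}
variable {G' : Type} [Group G']

/-- The map on chains induced by a group homomorphism. -/
noncomputable def chainsMap (φ : G →* G') (n : ℕ) : chains G A n →ₗ[ℤ] chains G' A n :=
  Finsupp.lmapDomain A ℤ fun v => φ ∘ v

lemma chainsMap_single (φ : G →* G') {n : ℕ} (v : Fin n → G) (a : A) :
    chainsMap A φ n (Finsupp.single v a) = Finsupp.single (φ ∘ v) a := by
  simp [chainsMap, Finsupp.mapDomain_single]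

lemma d_single {n : ℕ} (g : Fin (n + 1) → G) (a : A) :
    d G A n (Finsupp.single g a)
      = Finsupp.single (Fin.tail g) a
        + ∑ j : Fin (n + 1),
            ((-1 : ℤ) ^ ((j : ℕ) + 1)) • Finsupp.single (Fin.contractNth j (· * ·) g) a := by
  simp [d, Finsupp.lsum_single]

lemma d_chainsMap (φ : G →* G') (n : ℕ) :
    (d G' A n).comp (chainsMap A φ (n + 1)) = (chainsMap A φ n).comp (d G A n) := by
  apply Finsupp.lhom_ext
  intro g a
  have hc : ∀ j : Fin (n + 1),
      φ ∘ Fin.contractNth j (· * ·) g = Fin.contractNth j (· * ·) (φ ∘ g) := by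
    intro j
    funext k
    simp only [Function.comp_apply, Fin.contractNth]
    split_ifs <;> simp
  simp only [LinearMap.comp_apply, chainsMap_single, d_single, map_add, map_sum, map_smul,
    chainsMap_single, Fin.comp_tail, hc]

lemma chainsMap_mem_cycles (φ : G →* G') (n : ℕ) :
    ∀ x ∈ cycles G A n, chainsMap A φ n x ∈ cycles G' A n := by
  intro x hx
  cases n with
  | zero => trivial
  | succ n =>
    simp only [cycles, LinearMap.mem_ker] at hx ⊢
    have := congrArg (fun L : chains G A (n + 1) →ₗ[ℤ] chains G' A n => L x) (d_chainsMap A φ n)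
    simp only [LinearMap.comp_apply] at this
    rw [this, hx, map_zero]

/-- The map on cycles induced by a group homomorphism. -/
noncomputable def cyclesMap (φ : G →* G') (n : ℕ) : cycles G A n →ₗ[ℤ] cycles G' A n :=
  (chainsMap A φ n).restrict (chainsMap_mem_cycles A φ n)

/-- The map `H_n(G; A) → H_n(G'; A)` on group homology induced by a group
homomorphism `φ : G →* G'`. -/
noncomputable def inducedMap (φ : G →* G') (n : ℕ) :
    Homology G A n →ₗ[ℤ] Homology G' A n :=
  Submodule.mapQ _ _ (cyclesMap A φ n) (by
    rintro ⟨x, hx⟩ hmem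
    simp only [boundaries, Submodule.mem_comap, Submodule.subtype_apply,
      LinearMap.mem_range] at hmem ⊢
    obtain ⟨y, hy⟩ := hmem
    refine ⟨chainsMap A φ (n + 1) y, ?_⟩
    have := congrArg (fun L : chains G A (n + 1) →ₗ[ℤ] chains G' A n => L y) (d_chainsMap A φ n)
    simp only [LinearMap.comp_apply] at this
    rw [this, hy]
    rfl)

end GroupHomologyBar

section Isometries

variable (F : Type) [Field F] {W : Type} [AddCommGroup W] [Module F W]

/-- The group of linear automorphisms of a vector space `V` preserving a
function `Q : V → F` (e.g. a quadratic form). -/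
def quadIsoms {V : Type} [AddCommGroup V] [Module F V] (Q : V → F) :
    Subgroup (V ≃ₗ[F] V) where
  carrier := {g | ∀ v, Q (g v) = Q v}
  one_mem' := fun _ => rfl
  mul_mem' := fun {a b} ha hb v => by
    rw [show (a * b) v = a (b v) from rfl, ha, hb]
  inv_mem' := fun {a} ha v => by
    rw [show (a⁻¹ : V ≃ₗ[F] V) v = a.symm v from rfl, ← ha (a.symm v), a.apply_symm_apply]

/-- The group of linear automorphisms of a vector space `V` preserving a
pairing `ω : V → V → F` (e.g. a bilinear or sesquilinear form). -/
def bilinIsoms {V : Type} [AddCommGroup V] [Module F V] (ω : V → V → F) :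
    Subgroup (V ≃ₗ[F] V) where
  carrier := {g | ∀ v w, ω (g v) (g w) = ω v w}
  one_mem' := fun _ _ => rfl
  mul_mem' := fun {a b} ha hb v w => by
    rw [show (a * b) v = a (b v) from rfl, show (a * b) w = a (b w) from rfl, ha, hb]
  inv_mem' := fun {a} ha v w => by
    rw [show (a⁻¹ : V ≃ₗ[F] V) v = a.symm v from rfl,
      show (a⁻¹ : V ≃ₗ[F] V) w = a.symm w from rfl,
      ← ha (a.symm v) (a.symm w), a.apply_symm_apply, a.apply_symm_apply]

/-- The "orthogonal sum" form `x ↦ ∑ i, q (x i)` on `W^n`. -/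
def sumForm (q : W → F) (n : ℕ) (x : Fin n → W) : F := ∑ i, q (x i)

/-- The "orthogonal sum" pairing `(x, y) ↦ ∑ i, β (x i) (y i)` on `W^n`. -/
def pairForm (β : W → W → F) (n : ℕ) (x y : Fin n → W) : F := ∑ i, β (x i) (y i)

/-- The linear equivalence `W^{n+1} ≃ W^n × W` splitting off the last coordinate. -/
def lastSplit (n : ℕ) : (Fin (n + 1) → W) ≃ₗ[F] (Fin n → W) × W where
  toLinearMap := (LinearMap.funLeft F W Fin.castSucc).prod (LinearMap.proj (Fin.last n))
  invFun p := Fin.snoc p.1 p.2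
  left_inv x := Fin.snoc_init_self x
  right_inv p := by
    refine Prod.ext (funext fun i => ?_) ?_
    · exact @Fin.snoc_castSucc n (fun _ => W) p.2 p.1 i
    · exact @Fin.snoc_last n (fun _ => W) p.2 p.1

lemma lastSplit_symm_apply (n : ℕ) (p : Fin n → W) (w : W) :
    (lastSplit F n).symm (p, w) = Fin.snoc p w := rfl

/-- Extension of an automorphism of `W^n` to `W^{n+1}` by the identity on the
added last coordinate. -/
def stabAut (n : ℕ) (g : (Fin n → W) ≃ₗ[F] (Fin n → W)) :
    (Fin (n + 1) → W) ≃ₗ[F] (Fin (n + 1) → W) :=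
  (lastSplit F n).trans ((g.prodCongr (LinearEquiv.refl F W)).trans (lastSplit F n).symm)

lemma stabAut_symm_apply (n : ℕ) (g : (Fin n → W) ≃ₗ[F] (Fin n → W))
    (p : Fin n → W) (w : W) :
    stabAut F n g ((lastSplit F n).symm (p, w)) = (lastSplit F n).symm (g p, w) := by
  simp [stabAut, LinearEquiv.trans_apply, LinearEquiv.apply_symm_apply, LinearEquiv.prodCongr_apply]

lemma sumForm_snoc (q : W → F) (n : ℕ) (p : Fin n → W) (w : W) :
    sumForm F q (n + 1) ((lastSplit F n).symm (p, w)) = sumForm F q n p + q w := by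
  simp [sumForm, lastSplit_symm_apply, Fin.sum_univ_castSucc, Fin.snoc_castSucc, Fin.snoc_last]

lemma pairForm_snoc (β : W → W → F) (n : ℕ) (p p' : Fin n → W) (w w' : W) :
    pairForm F β (n + 1) ((lastSplit F n).symm (p, w)) ((lastSplit F n).symm (p', w'))
      = pairForm F β n p p' + β w w' := by
  simp [pairForm, lastSplit_symm_apply, Fin.sum_univ_castSucc, Fin.snoc_castSucc, Fin.snoc_last]

/-- The stabilization homomorphism on the isometry group of the form `sumForm q n`,
extending an isometry by the identity on the added summand. -/
def quadStab (q : W → F) (n : ℕ) :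
    quadIsoms F (sumForm F q n) →* quadIsoms F (sumForm F q (n + 1)) where
  toFun g := ⟨stabAut F n g.1, by
    intro v
    obtain ⟨⟨p, w⟩, rfl⟩ : ∃ x, (lastSplit F n).symm x = v :=
      ⟨lastSplit F n v, (lastSplit F n).symm_apply_apply v⟩
    rw [stabAut_symm_apply, sumForm_snoc, sumForm_snoc, g.2 p]⟩
  map_one' := by
    refine Subtype.ext (LinearEquiv.ext fun v => ?_)
    show stabAut F n 1 v = v
    obtain ⟨⟨p, w⟩, rfl⟩ : ∃ x, (lastSplit F n).symm x = v :=
      ⟨lastSplit F n v, (lastSplit F n).symm_apply_apply v⟩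
    rw [stabAut_symm_apply]
    rfl
  map_mul' g h := by
    refine Subtype.ext (LinearEquiv.ext fun v => ?_)
    show stabAut F n (g.1 * h.1) v = stabAut F n g.1 (stabAut F n h.1 v)
    obtain ⟨⟨p, w⟩, rfl⟩ : ∃ x, (lastSplit F n).symm x = v :=
      ⟨lastSplit F n v, (lastSplit F n).symm_apply_apply v⟩
    rw [stabAut_symm_apply, stabAut_symm_apply, stabAut_symm_apply]
    rfl

/-- The stabilization homomorphism on the isometry group of the pairing `pairForm β n`,
extending an isometry by the identity on the added summand. -/
def bilinStab (β : W → W → F) (n : ℕ) :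
    bilinIsoms F (pairForm F β n) →* bilinIsoms F (pairForm F β (n + 1)) where
  toFun g := ⟨stabAut F n g.1, by
    intro v v'
    obtain ⟨⟨p, w⟩, rfl⟩ : ∃ x, (lastSplit F n).symm x = v :=
      ⟨lastSplit F n v, (lastSplit F n).symm_apply_apply v⟩
    obtain ⟨⟨p', w'⟩, rfl⟩ : ∃ x, (lastSplit F n).symm x = v' :=
      ⟨lastSplit F n v', (lastSplit F n).symm_apply_apply v'⟩
    rw [stabAut_symm_apply, stabAut_symm_apply, pairForm_snoc, pairForm_snoc, g.2 p p']⟩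
  map_one' := by
    refine Subtype.ext (LinearEquiv.ext fun v => ?_)
    show stabAut F n 1 v = v
    obtain ⟨⟨p, w⟩, rfl⟩ : ∃ x, (lastSplit F n).symm x = v :=
      ⟨lastSplit F n v, (lastSplit F n).symm_apply_apply v⟩
    rw [stabAut_symm_apply]
    rfl
  map_mul' g h := by
    refine Subtype.ext (LinearEquiv.ext fun v => ?_)
    show stabAut F n (g.1 * h.1) v = stabAut F n g.1 (stabAut F n h.1 v)
    obtain ⟨⟨p, w⟩, rfl⟩ : ∃ x, (lastSplit F n).symm x = v :=
      ⟨lastSplit F n v, (lastSplit F n).symm_apply_apply v⟩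
    rw [stabAut_symm_apply, stabAut_symm_apply, stabAut_symm_apply]
    rfl

end Isometries

namespace UStab

section Chains

variable {G X : Type} [Group G] [MulAction G X]

/-- Chains on lists of group elements with a label. -/
abbrev BC (G X : Type) : Type := (List G × X) →₀ ℤ

/-- extension of membership from basis elements to supported chains -/
lemma map_supp {A B : Type} {s : Set A} {N : Submodule ℤ (B →₀ ℤ)}
    (f : (A →₀ ℤ) →ₗ[ℤ] (B →₀ ℤ)) (h : ∀ p ∈ s, f (Finsupp.single p 1) ∈ N)
    {x : A →₀ ℤ} (hx : x ∈ Finsupp.supported ℤ ℤ s) : f x ∈ N := by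
  rw [Finsupp.supported_eq_span_single] at hx
  induction hx using Submodule.span_induction with
  | mem x hx => obtain ⟨p, hp, rfl⟩ := hx; exact h p hp
  | zero => simp
  | add x y _ _ hx hy => rw [map_add]; exact N.add_mem hx hy
  | smul a x _ hx => rw [map_smul]; exact N.smul_mem _ hx

/-- equality of linear maps on supported chains from basis elements -/
lemma eq_supp {A B : Type} {s : Set A}
    (f g : (A →₀ ℤ) →ₗ[ℤ] (B →₀ ℤ))
    (h : ∀ p ∈ s, f (Finsupp.single p 1) = g (Finsupp.single p 1))
    {x : A →₀ ℤ} (hx : x ∈ Finsupp.supported ℤ ℤ s) : f x = g x := by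
  have : (f - g) x ∈ (⊥ : Submodule ℤ (B →₀ ℤ)) := by
    refine map_supp (f - g) (fun p hp => ?_) hx
    simp [h p hp]
  simpa [sub_eq_zero] using this

lemma single_mem {A : Type} {s : Set A} {a : A} (h : a ∈ s) :
    (Finsupp.single a (1 : ℤ)) ∈ Finsupp.supported ℤ ℤ s :=
  Finsupp.single_mem_supported ℤ 1 h

/-- prepend a group element -/
noncomputable def consL (g : G) : BC G X →ₗ[ℤ] BC G X :=
  Finsupp.lmapDomain ℤ ℤ (fun p => (g :: p.1, p.2))

@[simp] lemma consL_single (g : G) (p : List G × X) :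
    consL g (Finsupp.single p 1) = Finsupp.single (g :: p.1, p.2) 1 := by
  simp [consL]

/-- merge a group element into the head of the list -/
def mu (g : G) : List G × X → List G × X
  | ([], x) => ([], g • x)
  | (h :: l, x) => ((g * h) :: l, x)

noncomputable def muL (g : G) : BC G X →ₗ[ℤ] BC G X :=
  Finsupp.lmapDomain ℤ ℤ (mu g)

@[simp] lemma muL_single (g : G) (p : List G × X) :
    muL g (Finsupp.single p 1) = Finsupp.single (mu g p) 1 := by
  simp [muL]

lemma muL_consL (g h : G) (z : BC G X) : muL g (consL h z) = consL (g * h) z := by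
  have : (muL g).comp (consL h) = (consL (g * h) : BC G X →ₗ[ℤ] BC G X) := by
    apply Finsupp.lhom_ext'; intro p; ext; simp [mu]
  exact congrArg (fun f => f z) this

/-- alternating sum of all faces but the zeroth, on basis elements -/
noncomputable def P0 : List G → X → BC G X
  | [], _ => 0
  | g :: l, x => Finsupp.single (mu g (l, x)) 1 - consL g (P0 l x)

noncomputable def P : BC G X →ₗ[ℤ] BC G X :=
  Finsupp.linearCombination ℤ (fun p => P0 p.1 p.2)

@[simp] lemma P_single (p : List G × X) : P (Finsupp.single p 1) = P0 p.1 p.2 := by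
  simp [P]

/-- the zeroth face on basis elements -/
noncomputable def D00 : List G → X → BC G X
  | [], _ => 0
  | _ :: l, x => Finsupp.single (l, x) 1

noncomputable def D0 : BC G X →ₗ[ℤ] BC G X :=
  Finsupp.linearCombination ℤ (fun p => D00 p.1 p.2)

@[simp] lemma D0_single (p : List G × X) : D0 (Finsupp.single p 1) = D00 p.1 p.2 := by
  simp [D0]

/-- the bar differential -/
noncomputable def dv : BC G X →ₗ[ℤ] BC G X := D0 - P

lemma dv_apply (z : BC G X) : dv z = D0 z - P z := rfl

lemma D0_consL (g : G) (z : BC G X) : D0 (consL g z) = z := by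
  have : D0.comp (consL g) = (LinearMap.id : BC G X →ₗ[ℤ] BC G X) := by
    apply Finsupp.lhom_ext'; intro p; ext1; simp [D00]
  exact congrArg (fun f => f z) this

lemma P_consL (g : G) (z : BC G X) : P (consL g z) = muL g z - consL g (P z) := by
  have : P.comp (consL g) = (muL g - (consL g).comp P : BC G X →ₗ[ℤ] BC G X) := by
    apply Finsupp.lhom_ext'; intro p; ext1; simp [P0]
  exact congrArg (fun f => f z) this

lemma P_mu (g : G) (p : List G × X) :
    P (Finsupp.single (mu g p) 1) = muL g (P (Finsupp.single p 1)) := by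
  obtain ⟨l, x⟩ := p
  cases l with
  | nil => simp [mu, P0]
  | cons h l =>
    simp only [mu, P_single, P0, map_sub, muL_single, muL_consL]
    congr 2
    cases l <;> simp [mu, mul_smul, mul_assoc]

lemma P_P0 (l : List G) (x : X) : P (P0 l x) = 0 := by
  induction l with
  | nil => simp [P0]
  | cons g l ih =>
    rw [P0, map_sub, P_mu, P_consL, P_single, ih]; simp

lemma D0_mu (g : G) (l : List G) (x : X) : D00 (mu g (l, x)).1 (mu g (l, x)).2 = D00 l x := by
  cases l <;> simp [mu, D00]

lemma dv_dv (z : BC G X) : dv (dv z) = 0 := by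
  have : (dv : BC G X →ₗ[ℤ] BC G X).comp dv = 0 := by
    apply Finsupp.lhom_ext'; rintro ⟨l, x⟩; ext1
    simp only [LinearMap.comp_apply, Finsupp.lsingle_apply, LinearMap.zero_apply, dv_apply,
      D0_single, P_single, map_sub, P_P0]
    cases l with
    | nil => simp [D00, P0]
    | cons g l =>
      rw [show D00 (g :: l) x = Finsupp.single (l, x) 1 from rfl,
        show P0 (g :: l) x = Finsupp.single (mu g (l, x)) 1 - consL g (P0 l x) from rfl]
      simp only [map_sub, D0_single, P_single, D0_mu, D0_consL]
      abel
  exact congrArg (fun f => f z) this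

/-! ### The prism operator -/

variable (t : X → G)

/-- conjugated simplex -/
def Phi0 : List G → X → List G × X
  | [], x => ([], t x • x)
  | g :: l, x =>
    ((t (g • l.prod • x) * g * (t (l.prod • x))⁻¹) :: (Phi0 l x).1, (Phi0 l x).2)

noncomputable def Phi : BC G X →ₗ[ℤ] BC G X :=
  Finsupp.lmapDomain ℤ ℤ (fun p => Phi0 t p.1 p.2)

@[simp] lemma Phi_single (p : List G × X) :
    Phi t (Finsupp.single p 1) = Finsupp.single (Phi0 t p.1 p.2) 1 := by
  simp [Phi]

noncomputable def h0 : List G → X → BC G X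
  | [], x => Finsupp.single ([t x], x) 1
  | g :: l, x => Finsupp.single (t (g • l.prod • x) :: g :: l, x) 1
      - consL (t (g • l.prod • x) * g * (t (l.prod • x))⁻¹) (h0 l x)

noncomputable def hP : BC G X →ₗ[ℤ] BC G X :=
  Finsupp.linearCombination ℤ (fun p => h0 t p.1 p.2)

@[simp] lemma hP_single (p : List G × X) : hP t (Finsupp.single p 1) = h0 t p.1 p.2 := by
  simp [hP]

lemma hP_consL (g : G) (y : X) {z : BC G X}
    (hz : z ∈ Finsupp.supported ℤ ℤ {p : List G × X | p.1.prod • p.2 = y}) :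
    hP t (consL g z) = consL (t (g • y)) (consL g z)
      - consL (t (g • y) * g * (t y)⁻¹) (hP t z) := by
  refine eq_supp ((hP t).comp (consL g)) ((consL (t (g • y))).comp (consL g)
    - (consL (t (g • y) * g * (t y)⁻¹)).comp (hP t)) ?_ hz
  rintro ⟨l, x⟩ rfl
  simp [h0]

lemma P0_act (l : List G) (x : X) :
    P0 l x ∈ Finsupp.supported ℤ ℤ {p : List G × X | p.1.prod • p.2 = l.prod • x} := by
  induction l with
  | nil => simp [P0]
  | cons g l ih =>
    rw [P0]
    refine Submodule.sub_mem _ (single_mem ?_) ?_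
    · cases l <;> simp [mu, mul_smul]
    · refine map_supp (consL g) ?_ ih
      rintro ⟨l', x'⟩ hp
      rw [consL_single]
      apply single_mem
      simp only [Set.mem_ofPred_eq, List.prod_cons, mul_smul] at hp ⊢
      rw [hp]

lemma muL_h0 (g : G) (l : List G) (x : X) :
    muL (t (g • l.prod • x) * g * (t (l.prod • x))⁻¹) (h0 t l x)
      = Finsupp.single ((t (g • l.prod • x) * g) :: l, x) 1 -
        (match l with
        | [] => 0
        | k :: l' => consL (t (g • k • l'.prod • x) * (g * k) * (t (l'.prod • x))⁻¹)
            (h0 t l' x)) := by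
  cases l with
  | nil => simp [h0, mu]
  | cons k l' =>
    simp only [h0, map_sub, muL_single, mu, muL_consL, List.prod_cons, mul_smul]
    congr 2
    · simp
    · congr 1; group

lemma prism_P (l : List G) (x : X) :
    P (h0 t l x) + hP t (P0 l x) = Finsupp.single (Phi0 t l x) 1 := by
  induction l with
  | nil => simp [h0, P0, Phi0, mu]
  | cons g l ih =>
    have e1 : P (h0 t (g :: l) x) = Finsupp.single ((t (g • l.prod • x) * g) :: l, x) 1
        - consL (t (g • l.prod • x)) (P0 (g :: l) x)
        - (muL (t (g • l.prod • x) * g * (t (l.prod • x))⁻¹) (h0 t l x)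
          - consL (t (g • l.prod • x) * g * (t (l.prod • x))⁻¹) (P (h0 t l x))) := by
      rw [h0, map_sub, P_consL, P_single]
      simp [P0, mu]
    have e2 : hP t (P0 (g :: l) x) = h0 t (mu g (l, x)).1 (mu g (l, x)).2
        - (consL (t (g • l.prod • x)) (consL g (P0 l x))
          - consL (t (g • l.prod • x) * g * (t (l.prod • x))⁻¹) (hP t (P0 l x))) := by
      rw [P0, map_sub, hP_single, hP_consL t g _ (P0_act l x)]
    have e3 : Finsupp.single (Phi0 t (g :: l) x) 1 =
        consL (t (g • l.prod • x) * g * (t (l.prod • x))⁻¹) (P (h0 t l x) + hP t (P0 l x)) := by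
      rw [ih]; simp [Phi0]
    rw [e1, e2, e3, muL_h0, map_add]
    cases l with
    | nil => simp [P0, mu, h0]
    | cons k l' =>
      simp only [P0, mu, h0, map_sub, consL_single, List.prod_cons, mul_smul]
      abel

lemma prism_D (l : List G) (x : X) :
    D0 (h0 t l x) + hP t (D00 l x) = Finsupp.single (l, x) 1 := by
  cases l with
  | nil => simp [h0, D00]
  | cons g l => simp [h0, D00, D0_consL]

/-- The prism identity. -/
lemma prism (z : BC G X) : dv (hP t z) + hP t (dv z) = z - Phi t z := by
  have : dv.comp (hP t) + (hP t).comp dv = LinearMap.id - Phi t := by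
    apply Finsupp.lhom_ext'; rintro ⟨l, x⟩; ext1
    simp only [LinearMap.comp_apply, Finsupp.lsingle_apply, LinearMap.add_apply,
      LinearMap.sub_apply, LinearMap.id_apply, dv_apply, hP_single, D0_single, P_single,
      map_sub, Phi_single]
    rw [← prism_P, ← prism_D t l x]
    abel
  exact congrArg (fun f => f z) this

lemma Phi_dv (z : BC G X) : Phi t (dv z) = dv (Phi t z) := by
  have h1 := congrArg dv (prism t z)
  have h2 := prism t (dv z)
  simp only [map_add, map_sub, dv_dv, map_zero, add_zero, zero_add] at h1 h2
  have h3 := h1.symm.trans h2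
  have := sub_right_injective h3
  exact this.symm

end Chains

end UStab

namespace UStab

set_option linter.unusedSectionVars false

/-- entrywise action on lists -/
instance listAct {G V : Type} [Group G] [MulAction G V] : MulAction G (List V) where
  smul g l := l.map (fun v => g • v)
  one_smul l := by
    change l.map (fun v => (1 : G) • v) = l
    simp
  mul_smul g h l := by
    change l.map (fun v => (g * h) • v) = (l.map (fun v => h • v)).map (fun v => g • v)
    simp [mul_smul, Function.comp_def]

section Double

variable {G V : Type} [Group G] [MulAction G V]

@[simp] lemma smul_nil (g : G) : g • ([] : List V) = [] := rfl
@[simp] lemma smul_cons (g : G) (v : V) (l : List V) : g • (v :: l) = (g • v) :: (g • l) := rfl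
@[simp] lemma length_smul_list (g : G) (l : List V) : (g • l).length = l.length := by
  change (l.map _).length = _
  simp
lemma mem_smul_list {g : G} {l : List V} {v : V} : v ∈ g • l ↔ ∃ u ∈ l, g • u = v := by
  change v ∈ l.map _ ↔ _
  simp
lemma smul_list_eq {g : G} {l : List V} (h : ∀ v ∈ l, g • v = v) : g • l = l := by
  change l.map _ = _
  rw [List.map_congr_left h]; simp
lemma smul_list_fix {g : G} {l : List V} (h : g • l = l) : ∀ v ∈ l, g • v = v := by
  induction l with
  | nil => simp
  | cons a l ih =>
    simp only [smul_cons, List.cons.injEq] at h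
    intro v hv
    rcases List.mem_cons.1 hv with rfl | hv
    · exact h.1
    · exact ih h.2 v hv

/-- prepend labels -/
noncomputable def preX (A : List V) : BC G (List V) →ₗ[ℤ] BC G (List V) :=
  Finsupp.lmapDomain ℤ ℤ (fun p => (p.1, A ++ p.2))

@[simp] lemma preX_single (A : List V) (p : List G × List V) :
    preX A (Finsupp.single p 1) = Finsupp.single (p.1, A ++ p.2) 1 := by
  simp [preX]

/-- constant label -/
noncomputable def lab (A : List V) : BC G (List V) →ₗ[ℤ] BC G (List V) :=
  Finsupp.lmapDomain ℤ ℤ (fun p => (p.1, A))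

@[simp] lemma lab_single (A : List V) (p : List G × List V) :
    lab A (Finsupp.single p 1) = Finsupp.single (p.1, A) 1 := by
  simp [lab]

lemma preX_lab (A B : List V) (z : BC G (List V)) : preX A (lab B z) = lab (A ++ B) z := by
  have : (preX A).comp (lab B) = (lab (A ++ B) : BC G (List V) →ₗ[ℤ] _) := by
    apply Finsupp.lhom_ext'; intro p; ext1; simp
  exact congrArg (fun f => f z) this

lemma preX_preX (A B : List V) (z : BC G (List V)) : preX A (preX B z) = preX (A ++ B) z := by
  have : (preX A).comp (preX B) = (preX (A ++ B) : BC G (List V) →ₗ[ℤ] _) := by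
    apply Finsupp.lhom_ext'; intro p; ext1; simp
  exact congrArg (fun f => f z) this

noncomputable def Q0 (l : List G) : List V → BC G (List V)
  | [] => 0
  | z :: Γ => Finsupp.single (l, Γ) 1 - preX [z] (Q0 l Γ)

/-- the horizontal differential -/
noncomputable def dh : BC G (List V) →ₗ[ℤ] BC G (List V) :=
  Finsupp.linearCombination ℤ (fun p => Q0 p.1 p.2)

@[simp] lemma dh_single (p : List G × List V) : dh (Finsupp.single p 1) = Q0 p.1 p.2 := by
  simp [dh]

lemma dh_pre (v : V) (z : BC G (List V)) : dh (preX [v] z) = z - preX [v] (dh z) := by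
  have : dh.comp (preX [v]) = (LinearMap.id - (preX [v]).comp dh : BC G (List V) →ₗ[ℤ] _) := by
    apply Finsupp.lhom_ext'; intro p; ext1; simp [Q0]
  exact congrArg (fun f => f z) this

lemma dh_lab_cons (v : V) (R : List V) (z : BC G (List V)) :
    dh (lab (v :: R) z) = lab R z - preX [v] (dh (lab R z)) := by
  rw [← dh_pre, preX_lab]; rfl

lemma dh_lab_nil (z : BC G (List V)) : dh (lab [] z) = 0 := by
  have : dh.comp (lab []) = (0 : BC G (List V) →ₗ[ℤ] _) := by
    apply Finsupp.lhom_ext'; intro p; ext1; simp [Q0]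
  exact congrArg (fun f => f z) this

lemma dh_Q0 (l : List G) (Γ : List V) : dh (Q0 l Γ) = 0 := by
  induction Γ with
  | nil => simp [Q0]
  | cons z Γ ih => rw [Q0, map_sub, dh_pre, ih]; simp

lemma dh_dh (z : BC G (List V)) : dh (dh z) = 0 := by
  have : dh.comp dh = (0 : BC G (List V) →ₗ[ℤ] _) := by
    apply Finsupp.lhom_ext'; intro p; ext1; simp [dh_Q0]
  exact congrArg (fun f => f z) this

lemma consL_preX (g : G) (A : List V) (z : BC G (List V)) :
    consL g (preX A z) = preX A (consL g z) := by
  have : (consL g).comp (preX A) = ((preX A).comp (consL g) : BC G (List V) →ₗ[ℤ] _) := by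
    apply Finsupp.lhom_ext'; intro p; ext1; simp
  exact congrArg (fun f => f z) this

lemma Q0_cons (g : G) (l : List G) (Γ : List V) : Q0 (g :: l) Γ = consL g (Q0 l Γ) := by
  induction Γ with
  | nil => simp [Q0]
  | cons z Γ ih => rw [Q0, Q0, ih, map_sub, consL_preX, consL_single]

lemma Q0_supp (l : List G) (Γ : List V) :
    Q0 l Γ ∈ Finsupp.supported ℤ ℤ {p : List G × List V | p.1 = l} := by
  induction Γ with
  | nil => simp [Q0]
  | cons z Γ ih =>
    rw [Q0]
    refine Submodule.sub_mem _ (single_mem rfl) (map_supp _ ?_ ih)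
    intro p hp
    rw [preX_single]
    exact single_mem hp

lemma Q0_mu (g : G) (l : List G) (Γ : List V) :
    Q0 (mu g (l, Γ)).1 (mu g (l, Γ)).2 = muL g (Q0 l Γ) := by
  cases l with
  | cons h l => simp only [mu, Q0_cons, muL_consL]
  | nil =>
    simp only [mu]
    induction Γ with
    | nil => simp [Q0]
    | cons z Γ ih =>
      have : muL g (preX [z] (Q0 ([] : List G) Γ)) = preX [g • z] (muL g (Q0 [] Γ)) := by
        refine eq_supp ((muL g).comp (preX [z])) ((preX [g • z]).comp (muL g)) ?_ (Q0_supp _ _)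
        rintro ⟨l, x⟩ rfl
        simp [mu]
      rw [smul_cons, Q0, Q0, ih, map_sub, this, muL_single]
      rfl

lemma dh_consL (g : G) (z : BC G (List V)) : dh (consL g z) = consL g (dh z) := by
  have : dh.comp (consL g) = ((consL g).comp dh : BC G (List V) →ₗ[ℤ] _) := by
    apply Finsupp.lhom_ext'; intro p; ext1; simp [Q0_cons]
  exact congrArg (fun f => f z) this

lemma dh_P0 (l : List G) (Γ : List V) : dh (P0 l Γ) = P (Q0 l Γ) := by
  induction l with
  | nil =>
    have : P (Q0 ([] : List G) Γ) = (0 : BC G (List V) →ₗ[ℤ] BC G (List V)) (Q0 [] Γ) := by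
      refine eq_supp P 0 ?_ (Q0_supp _ _)
      rintro ⟨l, x⟩ rfl
      simp [P0]
    rw [this]; simp [P0]
  | cons g l ih =>
    rw [P0, map_sub, dh_single, Q0_mu, Q0_cons, P_consL, dh_consL, ih]

lemma dh_D00 (l : List G) (Γ : List V) : dh (D00 l Γ) = D0 (Q0 l Γ) := by
  cases l with
  | nil =>
    have : D0 (Q0 ([] : List G) Γ) = (0 : BC G (List V) →ₗ[ℤ] BC G (List V)) (Q0 [] Γ) := by
      refine eq_supp D0 0 ?_ (Q0_supp _ _)
      rintro ⟨l, x⟩ rfl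
      simp [D00]
    rw [this]; simp [D00]
  | cons g l => rw [D00, dh_single, Q0_cons, D0_consL]

lemma dh_dv (z : BC G (List V)) : dh (dv z) = dv (dh z) := by
  have : dh.comp dv = (dv.comp dh : BC G (List V) →ₗ[ℤ] _) := by
    apply Finsupp.lhom_ext'; intro p; ext1; simp [dv_apply, dh_P0, dh_D00]
  exact congrArg (fun f => f z) this

/-! ### supports -/

/-- chains with `q` group entries in `K` and `k` labels in `O` -/
def sset (K : Subgroup G) (O : Set V) (k q : ℕ) : Set (List G × List V) :=
  {p | p.1.length = q ∧ (∀ g ∈ p.1, g ∈ K) ∧ p.2.length = k ∧ ∀ v ∈ p.2, v ∈ O}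

noncomputable def sp (K : Subgroup G) (O : Set V) (k q : ℕ) : Submodule ℤ (BC G (List V)) :=
  Finsupp.supported ℤ ℤ (sset K O k q)

lemma sp_mono {K K' : Subgroup G} {O O' : Set V} (hK : K ≤ K') (hO : O ⊆ O') (k q : ℕ) :
    sp K O k q ≤ sp K' O' k q :=
  Finsupp.supported_mono fun _ hp =>
    ⟨hp.1, fun g hg => hK (hp.2.1 g hg), hp.2.2.1, fun v hv => hO (hp.2.2.2 v hv)⟩

lemma sp_mono_K {K K' : Subgroup G} (hK : K ≤ K') {O : Set V} {k q : ℕ} :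
    sp K O k q ≤ sp K' O k q := sp_mono hK subset_rfl k q

lemma consL_sp {K : Subgroup G} {O : Set V} {k q : ℕ} {g : G} (hg : g ∈ K)
    {z : BC G (List V)} (hz : z ∈ sp K O k q) : consL g z ∈ sp K O k (q + 1) := by
  refine map_supp _ ?_ hz
  rintro ⟨l, x⟩ ⟨h1, h2, h3, h4⟩
  rw [consL_single]
  refine single_mem ⟨by simpa using h1, ?_, h3, h4⟩
  intro h hh
  rcases List.mem_cons.1 hh with rfl | hh
  · exact hg
  · exact h2 h hh

lemma mu_sset {K : Subgroup G} {O : Set V} (hO : ∀ g ∈ K, ∀ v ∈ O, g • v ∈ O) {k q : ℕ}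
    {g : G} (hg : g ∈ K) {p : List G × List V} (hp : p ∈ sset K O k q) :
    mu g p ∈ sset K O k q := by
  obtain ⟨l, x⟩ := p
  obtain ⟨h1, h2, h3, h4⟩ := hp
  cases l with
  | nil =>
    refine ⟨h1, h2, by simpa [mu] using h3, ?_⟩
    intro v hv
    obtain ⟨u, hu, rfl⟩ := mem_smul_list.1 hv
    exact hO g hg u (h4 u hu)
  | cons h l =>
    refine ⟨by simpa [mu] using h1, ?_, h3, h4⟩
    intro g' hg'
    rcases List.mem_cons.1 hg' with rfl | hg'
    · exact K.mul_mem hg (h2 h (by simp))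
    · exact h2 g' (List.mem_cons_of_mem _ hg')

lemma P0_sp {K : Subgroup G} {O : Set V} (hO : ∀ g ∈ K, ∀ v ∈ O, g • v ∈ O) {k q : ℕ} 
    (l : List G) (x : List V) (h : (l, x) ∈ sset K O k q) : P0 l x ∈ sp K O k (q - 1) := by
  induction l generalizing q with
  | nil => simp [P0]
  | cons g l ih =>
    obtain ⟨h1, h2, h3, h4⟩ := h
    simp only [List.length_cons] at h1
    subst h1
    have hl : (l, x) ∈ sset K O k l.length := ⟨rfl, fun g hg => h2 g (List.mem_cons_of_mem _ hg), h3, h4⟩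
    rw [P0]
    refine Submodule.sub_mem _ (single_mem ?_) ?_
    · exact mu_sset hO (h2 g (by simp)) hl
    · have := ih hl
      cases l with
      | nil => simp [P0]
      | cons g' l' => exact consL_sp (h2 g (by simp)) this

lemma dv_sp {K : Subgroup G} {O : Set V} (hO : ∀ g ∈ K, ∀ v ∈ O, g • v ∈ O) {k q : ℕ} 
    {z : BC G (List V)} (hz : z ∈ sp K O k q) : dv z ∈ sp K O k (q - 1) := by
  refine map_supp _ ?_ hz
  rintro ⟨l, x⟩ hp
  rw [dv_apply, P_single, D0_single]
  refine Submodule.sub_mem _ ?_ (P0_sp hO l x hp)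
  cases l with
  | nil => simp [D00]
  | cons g l =>
    obtain ⟨h1, h2, h3, h4⟩ := hp
    refine single_mem ⟨?_, fun g hg => h2 g (List.mem_cons_of_mem _ hg), h3, h4⟩
    simp only [List.length_cons] at h1
    simp [← h1]

lemma dv_zero {K : Subgroup G} {O : Set V} {k : ℕ} 
    {z : BC G (List V)} (hz : z ∈ sp K O k 0) : dv z = 0 := by
  refine eq_supp dv 0 ?_ hz
  rintro ⟨l, x⟩ hp
  have : l = [] := List.length_eq_zero_iff.1 hp.1
  subst this
  simp [dv_apply, D00, P0]

lemma pre_sp {K : Subgroup G} {O : Set V} {k q : ℕ} {w : V} (hw : w ∈ O)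
    {z : BC G (List V)} (hz : z ∈ sp K O k q) : preX [w] z ∈ sp K O (k + 1) q := by
  refine map_supp _ ?_ hz
  rintro ⟨l, x⟩ ⟨h1, h2, h3, h4⟩
  rw [preX_single]
  refine single_mem ⟨h1, h2, by simpa using h3, ?_⟩
  intro v hv
  rcases List.mem_cons.1 hv with rfl | hv
  · exact hw
  · exact h4 v hv

lemma Q0_sp {K : Subgroup G} {O : Set V} {k q : ℕ} (l : List G) (x : List V)
    (hp : (l, x) ∈ sset K O k q) : Q0 l x ∈ sp K O (k - 1) q := by
  induction x generalizing k with
  | nil => simp [Q0]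
  | cons v x ih =>
    obtain ⟨h1, h2, h3, h4⟩ := hp
    simp only [List.length_cons] at h3
    subst h3
    have hx : (l, x) ∈ sset K O x.length q :=
      ⟨h1, h2, rfl, fun v hv => h4 v (List.mem_cons_of_mem _ hv)⟩
    rw [Q0]
    refine Submodule.sub_mem _ (single_mem hx) ?_
    have hv := h4 v (by simp)
    have := ih hx
    cases x with
    | nil => simp [Q0]
    | cons a x => exact pre_sp hv this

lemma dh_sp {K : Subgroup G} {O : Set V} {k q : ℕ}
    {z : BC G (List V)} (hz : z ∈ sp K O k q) : dh z ∈ sp K O (k - 1) q := by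
  refine map_supp _ ?_ hz
  rintro ⟨l, x⟩ hp
  rw [dh_single]
  exact Q0_sp l x hp

lemma lab_sp {K : Subgroup G} {O O' : Set V} {k q : ℕ} {R : List V} (hR : ∀ v ∈ R, v ∈ O')
    {z : BC G (List V)} (hz : z ∈ sp K O k q) : lab R z ∈ sp K O' R.length q := by
  refine map_supp _ ?_ hz
  rintro ⟨l, x⟩ ⟨h1, h2, h3, h4⟩
  rw [lab_single]
  exact single_mem ⟨h1, h2, rfl, hR⟩

lemma lab_P0 {R : List V} {l : List G} (hl : ∀ g ∈ l, g • R = R) (x : List V) :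
    lab R (P0 l x) = P0 l R := by
  induction l with
  | nil => simp [P0]
  | cons g l ih =>
    have hc : ∀ z : BC G (List V), lab R (consL g z) = consL g (lab R z) := by
      intro z
      have : (lab R).comp (consL g) = ((consL g).comp (lab R) : BC G (List V) →ₗ[ℤ] _) := by
        apply Finsupp.lhom_ext'; intro p; ext1; simp
      exact congrArg (fun f => f z) this
    rw [P0, P0, map_sub, hc, ih (fun g hg => hl g (List.mem_cons_of_mem _ hg)), lab_single]
    congr 2
    cases l with
    | nil => simp [mu, hl g (by simp)]
    | cons h l => simp [mu]

lemma dv_lab {K : Subgroup G} {O : Set V} {k q : ℕ} {R : List V} (hR : ∀ g ∈ K, g • R = R)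
    {z : BC G (List V)} (hz : z ∈ sp K O k q) : dv (lab R z) = lab R (dv z) := by
  have h : ∀ p ∈ sset K O k q, (dv.comp (lab R)) (Finsupp.single p 1)
      = ((lab R).comp dv) (Finsupp.single p 1) := ?_
  · have := eq_supp (dv.comp (lab R)) ((lab R).comp dv) h hz
    rwa [LinearMap.comp_apply, LinearMap.comp_apply] at this
  rintro ⟨l, x⟩ ⟨h1, h2, h3, h4⟩
  have : D00 l R = lab R (D00 l x) := by cases l <;> simp [D00]
  simp only [LinearMap.comp_apply, lab_single, dv_apply, map_sub, P_single, D0_single, this]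
  rw [lab_P0 (fun g hg => hR g (h2 g hg))]

/-- relative cycles -/
noncomputable def Zr (Kh K : Subgroup G) (Oh O : Set V) (k q : ℕ) :
    Submodule ℤ (BC G (List V)) :=
  sp Kh Oh k q ⊓ (sp K O k (q - 1)).comap dv

lemma mem_Zr {Kh K : Subgroup G} {Oh O : Set V} {k q : ℕ} {x : BC G (List V)} :
    x ∈ Zr Kh K Oh O k q ↔ x ∈ sp Kh Oh k q ∧ dv x ∈ sp K O k (q - 1) := Iff.rfl

/-- relative boundaries -/
noncomputable def Br (Kh K : Subgroup G) (Oh O : Set V) (k q : ℕ) :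
    Submodule ℤ (BC G (List V)) :=
  sp K O k q ⊔ (sp Kh Oh k (q + 1)).map dv

/-- null chains -/
noncomputable def Nul (Kh K : Subgroup G) (Oh O : Set V) (k q : ℕ) :
    Submodule ℤ (BC G (List V)) :=
  Br Kh K Oh O k q ⊔ (Zr Kh K Oh O (k + 1) q).map dh

variable {Kh K : Subgroup G} {Oh O : Set V}

lemma Br_le_Nul {k q : ℕ} : Br Kh K Oh O k q ≤ Nul Kh K Oh O k q := le_sup_left
lemma sp_le_Br {k q : ℕ} : sp K O k q ≤ Br Kh K Oh O k q := le_sup_left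
lemma dv_mem_Br {k q : ℕ} {y : BC G (List V)} (hy : y ∈ sp Kh Oh k (q + 1)) :
    dv y ∈ Br Kh K Oh O k q :=
  Submodule.mem_sup_right ⟨y, hy, rfl⟩
lemma dh_mem_Nul {k q : ℕ} {y : BC G (List V)} (hy : y ∈ Zr Kh K Oh O (k + 1) q) :
    dh y ∈ Nul Kh K Oh O k q :=
  Submodule.mem_sup_right ⟨y, hy, rfl⟩

lemma mem_Br {k q : ℕ} {x : BC G (List V)} : x ∈ Br Kh K Oh O k q ↔
    ∃ s ∈ sp K O k q, ∃ y ∈ sp Kh Oh k (q + 1), s + dv y = x := by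
  rw [Br, Submodule.mem_sup]
  constructor
  · rintro ⟨s, hs, _, ⟨y, hy, rfl⟩, h⟩; exact ⟨s, hs, y, hy, h⟩
  · rintro ⟨s, hs, y, hy, h⟩; exact ⟨s, hs, _, ⟨y, hy, rfl⟩, h⟩

lemma mem_Nul {k q : ℕ} {x : BC G (List V)} : x ∈ Nul Kh K Oh O k q ↔
    ∃ s ∈ sp K O k q, ∃ y ∈ sp Kh Oh k (q + 1), ∃ c ∈ Zr Kh K Oh O (k + 1) q,
      s + dv y + dh c = x := by
  rw [Nul, Submodule.mem_sup]
  constructor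
  · rintro ⟨a, ha, _, ⟨c, hc, rfl⟩, h⟩
    obtain ⟨s, hs, y, hy, rfl⟩ := mem_Br.1 ha
    exact ⟨s, hs, y, hy, c, hc, h⟩
  · rintro ⟨s, hs, y, hy, c, hc, h⟩
    exact ⟨_, mem_Br.2 ⟨s, hs, y, hy, rfl⟩, _, ⟨c, hc, rfl⟩, h⟩

/-- The spectral sequence lemma, lifting form. -/
lemma lift_lemma (hKO : ∀ g ∈ K, ∀ v ∈ O, g • v ∈ O) (hKOh : ∀ g ∈ Kh, ∀ v ∈ Oh, g • v ∈ Oh)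
    (hK : K ≤ Kh) (hO : O ⊆ Oh) {zs : V} (hz : zs ∈ O) (q0 : ℕ)
    (H : ∀ k q, 2 ≤ k → k + q = q0 + 1 → Zr Kh K Oh O k q ≤ Nul Kh K Oh O k q)
    (q : ℕ) : ∀ k, k + q = q0 → ∀ x ∈ Zr Kh K Oh O k q, dh x ∈ sp K O (k - 1) q →
      (k = 0 → dh x = 0) →
      ∃ x' ∈ Zr Kh K Oh O (k + 1) q, x - dh x' ∈ sp K O k q := by
  induction q with
  | zero =>
    intro k hk x hx hdx h0
    obtain ⟨hx, -⟩ := mem_Zr.1 hx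
    refine ⟨preX [zs] x, mem_Zr.2 ⟨pre_sp (hO hz) hx, ?_⟩, ?_⟩
    · rw [dv_zero (pre_sp (hO hz) hx)]; exact Submodule.zero_mem _
    · rw [dh_pre, sub_sub_cancel]
      rcases Nat.eq_zero_or_pos k with h | h
      · rw [h0 h, map_zero]; exact Submodule.zero_mem _
      · have := pre_sp hz hdx
        rwa [Nat.sub_add_cancel h] at this
  | succ q ih =>
    intro k hk x hx hdx h0
    obtain ⟨hx, hdv⟩ := mem_Zr.1 hx
    rw [Nat.add_sub_cancel] at hdv
    have hdx' : preX [zs] (dh x) ∈ sp K O k (q + 1) := by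
      rcases Nat.eq_zero_or_pos k with h | h
      · rw [h0 h, map_zero]; exact Submodule.zero_mem _
      · have := pre_sp hz hdx
        rwa [Nat.sub_add_cancel h] at this
    have hx' := pre_sp (hO hz) hx
    have hx2 := dv_sp hKOh hx'
    rw [Nat.add_sub_cancel] at hx2
    have hx2z : dv (preX [zs] x) ∈ Zr Kh K Oh O (k + 1) q := by
      refine mem_Zr.2 ⟨hx2, ?_⟩
      rw [dv_dv]; exact Submodule.zero_mem _
    have hx2d : dh (dv (preX [zs] x)) ∈ sp K O (k + 1 - 1) q := by
      rw [dh_dv, dh_pre, map_sub]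
      exact Submodule.sub_mem _ hdv (dv_sp hKO hdx')
    obtain ⟨x3, hx3, h3⟩ := ih (k + 1) (by omega) (dv (preX [zs] x)) hx2z hx2d (by omega)
    obtain ⟨s, hs, y, hy, c, hc, rfl⟩ := mem_Nul.1 (H (k + 2) q (by omega) (by omega) hx3)
    have hdy := dh_sp hy
    have hds := dh_sp hs
    refine ⟨preX [zs] x - dh y, mem_Zr.2 ⟨Submodule.sub_mem _ hx' hdy, ?_⟩, ?_⟩
    · have e : dv (preX [zs] x - dh y) = (dv (preX [zs] x) - dh (s + dv y + dh c)) + dh s := by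
        simp only [map_sub, map_add, dh_dh, dh_dv]; abel
      rw [e]
      exact Submodule.add_mem _ h3 hds
    · rw [map_sub, dh_dh, dh_pre, sub_zero, sub_sub_cancel]
      exact hdx'

/-- The spectral sequence lemma. -/
lemma ss_lemma (hKO : ∀ g ∈ K, ∀ v ∈ O, g • v ∈ O) (hKOh : ∀ g ∈ Kh, ∀ v ∈ Oh, g • v ∈ Oh)
    (hK : K ≤ Kh) (hO : O ⊆ Oh) {zs : V} (hz : zs ∈ O) (q0 : ℕ)
    (H : ∀ k q, 2 ≤ k → k + q = q0 + 1 → Zr Kh K Oh O k q ≤ Nul Kh K Oh O k q)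
    {x : BC G (List V)} (hx : x ∈ Zr Kh K Oh O 0 q0) :
    ∃ x' ∈ Zr Kh K Oh O 1 q0, x - dh x' ∈ sp K O 0 q0 := by
  have h0 : dh x = 0 := by
    refine eq_supp dh 0 ?_ hx.1
    rintro ⟨l, x⟩ hp
    have : x = [] := List.length_eq_zero_iff.1 hp.2.2.1
    subst this
    simp [Q0]
  exact lift_lemma hKO hKOh hK hO hz q0 H q0 0 (by omega) x hx (by rw [h0]; simp) (fun _ => h0)

/-- sum over faces -/
lemma faces_mem (N : Submodule ℤ (BC G (List V))) (κ : BC G (List V)) (R A : List V)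
    (h : ∀ B z C, R = B ++ z :: C → lab (A ++ (B ++ C)) κ ∈ N) :
    preX A (dh (lab R κ)) ∈ N := by
  induction R generalizing A with
  | nil => rw [dh_lab_nil]; simp
  | cons v R ih =>
    rw [dh_lab_cons, map_sub, preX_lab, preX_preX]
    refine Submodule.sub_mem _ (by simpa using h [] v R rfl) (ih (A ++ [v]) ?_)
    rintro B z C rfl
    simpa using h (v :: B) z C rfl

end Double

end UStab

namespace UStab

set_option linter.unusedSectionVars false
set_option linter.unusedVariables false

section Shapiro

variable {G V : Type} [Group G] [MulAction G V]

lemma prod_mem_sset {K : Subgroup G} {O : Set V} (hO : ∀ g ∈ K, ∀ v ∈ O, g • v ∈ O) {k : ℕ}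
    (l : List G) (x : List V) (hl : ∀ g ∈ l, g ∈ K) (hk : x.length = k) (hx : ∀ v ∈ x, v ∈ O) :
    (l.prod • x).length = k ∧ ∀ v ∈ l.prod • x, v ∈ O := by
  refine ⟨by simpa using hk, ?_⟩
  intro v hv
  obtain ⟨u, hu, rfl⟩ := mem_smul_list.1 hv
  exact hO _ (Subgroup.list_prod_mem K hl) u (hx u hu)

lemma h0_sp {K : Subgroup G} {O : Set V} (hO : ∀ g ∈ K, ∀ v ∈ O, g • v ∈ O) {k : ℕ}
    (t : List V → G) (ht : ∀ x : List V, x.length = k → (∀ v ∈ x, v ∈ O) → t x ∈ K)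
    (l : List G) : ∀ (x : List V) (q : ℕ), (l, x) ∈ sset K O k q → h0 t l x ∈ sp K O k (q + 1) := by
  induction l with
  | nil =>
    rintro x q ⟨h1, h2, h3, h4⟩
    refine single_mem ⟨by simpa using h1.symm, ?_, h3, h4⟩
    intro g hg
    rw [List.mem_singleton.1 hg]
    exact ht x h3 h4
  | cons g l ih =>
    rintro x q ⟨h1, h2, h3, h4⟩
    have hl : ∀ h ∈ l, h ∈ K := fun h hh => h2 h (List.mem_cons_of_mem _ hh)
    have hg : g ∈ K := h2 g (by simp)
    have a1 := prod_mem_sset hO l x hl h3 h4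
    have a2 := prod_mem_sset hO [g] (l.prod • x) (by simpa using hg) a1.1 a1.2
    simp only [List.prod_cons, List.prod_nil, mul_one] at a2
    have t1 := ht _ a1.1 a1.2
    have t2 := ht _ a2.1 a2.2
    have hq : q = l.length + 1 := by simpa using h1.symm
    subst hq
    rw [h0]
    refine Submodule.sub_mem _ (single_mem ⟨by simp, ?_, h3, h4⟩) ?_
    · intro h hh
      rcases List.mem_cons.1 hh with rfl | hh
      · exact t2
      · exact h2 h hh
    · exact consL_sp (K.mul_mem (K.mul_mem t2 hg) (K.inv_mem t1))
        (ih x _ ⟨rfl, hl, h3, h4⟩)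

lemma hP_sp {K : Subgroup G} {O : Set V} (hO : ∀ g ∈ K, ∀ v ∈ O, g • v ∈ O) {k q : ℕ}
    (t : List V → G) (ht : ∀ x : List V, x.length = k → (∀ v ∈ x, v ∈ O) → t x ∈ K)
    {z : BC G (List V)} (hz : z ∈ sp K O k q) : hP t z ∈ sp K O k (q + 1) := by
  refine map_supp _ ?_ hz
  rintro ⟨l, x⟩ hp
  rw [hP_single]
  exact h0_sp hO t ht l x q hp

lemma Phi0_mem {K : Subgroup G} {O O' : Set V} (hO : ∀ g ∈ K, ∀ v ∈ O, g • v ∈ O) {k : ℕ}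
    (t : List V → G) (r : List V → List V)
    (ht : ∀ x : List V, x.length = k → (∀ v ∈ x, v ∈ O) →
      t x ∈ K ∧ t x • x = r x ∧ ∀ v ∈ r x, v ∈ O')
    (hr : ∀ g ∈ K, ∀ x : List V, x.length = k → (∀ v ∈ x, v ∈ O) → r (g • x) = r x)
    (l : List G) : ∀ (x : List V) (q : ℕ), (l, x) ∈ sset K O k q →
      Phi0 t l x ∈ sset K O' k q ∧ (Phi0 t l x).2 = r x ∧
        ∀ g ∈ (Phi0 t l x).1, g • (Phi0 t l x).2 = (Phi0 t l x).2 := by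
  induction l with
  | nil =>
    rintro x q ⟨h1, h2, h3, h4⟩
    obtain ⟨a, b, c⟩ := ht x h3 h4
    refine ⟨⟨h1, by simp [Phi0], by simpa [Phi0] using h3, ?_⟩, b, by simp [Phi0]⟩
    intro v hv
    exact c v (by rw [← b]; exact hv)
  | cons g l ih =>
    rintro x q ⟨h1, h2, h3, h4⟩
    have hl : ∀ h ∈ l, h ∈ K := fun h hh => h2 h (List.mem_cons_of_mem _ hh)
    have hg : g ∈ K := h2 g (by simp)
    have a1 := prod_mem_sset hO l x hl h3 h4
    have a2 := prod_mem_sset hO [g] (l.prod • x) (by simpa using hg) a1.1 a1.2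
    simp only [List.prod_cons, List.prod_nil, mul_one] at a2
    obtain ⟨t1, t1', t1''⟩ := ht _ a1.1 a1.2
    obtain ⟨t2, t2', t2''⟩ := ht _ a2.1 a2.2
    have hq : q = l.length + 1 := by simpa using h1.symm
    subst hq
    obtain ⟨⟨i1, i2, i3, i4⟩, i5, i6⟩ := ih x _ ⟨rfl, hl, h3, h4⟩
    have hlp : l.prod ∈ K := Subgroup.list_prod_mem K hl
    refine ⟨⟨by simpa [Phi0] using i1, ?_, i3, i4⟩, i5, ?_⟩
    · intro h hh
      rcases List.mem_cons.1 hh with rfl | hh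
      · exact (K.mul_mem (K.mul_mem t2 hg) (K.inv_mem t1))
      · exact i2 h hh
    · intro h hh
      change h • (Phi0 t l x).2 = (Phi0 t l x).2
      rcases List.mem_cons.1 hh with rfl | hh
      · rw [i5, mul_smul, mul_smul]
        have e1 : r x = t (l.prod • x) • l.prod • x := by rw [t1', hr _ hlp x h3 h4]
        rw [e1, inv_smul_smul, t2', t1', hr g hg _ a1.1 a1.2]
      · exact i6 h hh

open Classical in
/-- projection to a label -/
noncomputable def flt (R : List V) : BC G (List V) →ₗ[ℤ] BC G (List V) where
  toFun := Finsupp.filter (fun p : List G × List V => p.2 = R)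
  map_add' _ _ := Finsupp.filter_add
  map_smul' _ _ := Finsupp.filter_smul

lemma flt_apply (R : List V) (z : BC G (List V)) (p : List G × List V) [Decidable (p.2 = R)] :
    flt R z p = if p.2 = R then z p else 0 := by
  classical
  change Finsupp.filter _ z p = _
  rw [Finsupp.filter_apply]
  congr

lemma flt_eq {R : List V} {z : BC G (List V)}
    (hz : z ∈ Finsupp.supported ℤ ℤ {p : List G × List V | p.2 = R}) : flt R z = z := by
  classical
  ext p
  rw [flt_apply]
  split_ifs with h
  · rfl
  · by_contra h'
    exact h (hz (Finsupp.mem_support_iff.2 (Ne.symm h')))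

lemma flt_zero {R : List V} {z : BC G (List V)}
    (hz : z ∈ Finsupp.supported ℤ ℤ {p : List G × List V | p.2 ≠ R}) : flt R z = 0 := by
  classical
  ext p
  rw [flt_apply]
  split_ifs with h
  · by_contra h'
    exact (hz (Finsupp.mem_support_iff.2 h')) h
  · rfl

lemma P0_fix (l : List G) (x : List V) (h : ∀ g ∈ l, g • x = x) :
    P0 l x ∈ Finsupp.supported ℤ ℤ {p : List G × List V | p.2 = x} := by
  induction l with
  | nil => simp [P0]
  | cons g l ih =>
    rw [P0]
    refine Submodule.sub_mem _ (single_mem ?_) ?_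
    · cases l with
      | nil => exact h g (by simp)
      | cons a l => rfl
    · refine map_supp (consL g) ?_ (ih (fun g hg => h g (List.mem_cons_of_mem _ hg)))
      rintro ⟨l', x'⟩ hp
      rw [consL_single]
      exact single_mem hp

lemma dv_fix (l : List G) (x : List V) (h : ∀ g ∈ l, g • x = x) :
    dv (Finsupp.single (l, x) 1) ∈ Finsupp.supported ℤ ℤ {p : List G × List V | p.2 = x} := by
  rw [dv_apply, D0_single, P_single]
  refine Submodule.sub_mem _ ?_ (P0_fix l x h)
  cases l with
  | nil => simp [D00]
  | cons g l => exact single_mem rfl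

lemma flt_dv {s : Set (List G × List V)} (hs : ∀ p ∈ s, ∀ g ∈ p.1, g • p.2 = p.2) (R : List V)
    {z : BC G (List V)} (hz : z ∈ Finsupp.supported ℤ ℤ s) : flt R (dv z) = dv (flt R z) := by
  have h : ∀ p ∈ s, ((flt R).comp dv) (Finsupp.single p 1)
      = (dv.comp (flt R)) (Finsupp.single p 1) := ?_
  · have := eq_supp ((flt R).comp dv) (dv.comp (flt R)) h hz
    rwa [LinearMap.comp_apply, LinearMap.comp_apply] at this
  rintro ⟨l, x⟩ hp
  rw [LinearMap.comp_apply, LinearMap.comp_apply]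
  have hd := dv_fix l x (hs _ hp)
  by_cases hx : x = R
  · subst hx
    rw [flt_eq hd, flt_eq (z := Finsupp.single (l, x) 1) (single_mem rfl)]
  · rw [flt_zero (z := Finsupp.single (l, x) 1) (single_mem hx), map_zero]
    refine flt_zero (Finsupp.supported_mono ?_ hd)
    rintro p rfl
    exact hx

lemma flt_supp {s : Set (List G × List V)} {R : List V}
    {z : BC G (List V)} (hz : z ∈ Finsupp.supported ℤ ℤ s) :
    flt R z ∈ Finsupp.supported ℤ ℤ {p | p ∈ s ∧ p.2 = R} := by
  classical
  intro p hp
  have hp' := Finsupp.mem_support_iff.1 (Finset.mem_coe.1 hp)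
  rw [flt_apply] at hp'
  split_ifs at hp' with h
  · exact ⟨hz (Finsupp.mem_support_iff.2 hp'), h⟩
  · exact absurd rfl hp'

lemma flt_sum (z : BC G (List V)) (N : Submodule ℤ (BC G (List V)))
    (h : ∀ p ∈ z.support, flt p.2 z ∈ N) : z ∈ N := by
  classical
  have : z = ∑ R ∈ z.support.image (fun p => p.2), flt R z := by
    ext p
    rw [Finsupp.finsetSum_apply]
    simp only [flt_apply]
    by_cases hp : p ∈ z.support
    · rw [Finset.sum_eq_single p.2]
      · simp
      · intro R _ hR
        rw [if_neg (fun h => hR h.symm)]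
      · intro h
        exact absurd (Finset.mem_image_of_mem _ hp) h
    · rw [Finsupp.notMem_support_iff.1 hp]
      simp
  rw [this]
  refine Submodule.sum_mem _ ?_
  intro R hR
  obtain ⟨p, hp, rfl⟩ := Finset.mem_image.1 hR
  exact h p hp

lemma transporter {Kh K : Subgroup G} {Oh O : Set V} (hK : K ≤ Kh) (hO : O ⊆ Oh)
    {k : ℕ} (hE : ∀ Γ : List V, Γ.length = k → (∀ v ∈ Γ, v ∈ Oh) → ∃ g ∈ Kh, ∀ v ∈ g • Γ, v ∈ O)
    (hW : ∀ Γ : List V, Γ.length = k → (∀ v ∈ Γ, v ∈ O) → ∀ g ∈ Kh, (∀ v ∈ g • Γ, v ∈ O) →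
      ∃ g' ∈ K, g' • Γ = g • Γ) :
    ∃ (t : List V → G) (r : List V → List V),
      (∀ g ∈ Kh, ∀ x : List V, r (g • x) = r x) ∧
      (∀ x : List V, x.length = k → (∀ v ∈ x, v ∈ Oh) →
        t x ∈ Kh ∧ t x • x = r x ∧ ∀ v ∈ r x, v ∈ O) ∧
      (∀ x : List V, x.length = k → (∀ v ∈ x, v ∈ O) → t x ∈ K) := by
  classical
  let s : Setoid (List V) :=
    { r := fun x y => ∃ g ∈ Kh, g • x = y
      iseqv :=
        { refl := fun x => ⟨1, Kh.one_mem, one_smul _ _⟩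
          symm := by
            rintro x y ⟨g, hg, rfl⟩
            exact ⟨g⁻¹, Kh.inv_mem hg, inv_smul_smul _ _⟩
          trans := by
            rintro x y z ⟨g, hg, rfl⟩ ⟨h, hh, rfl⟩
            exact ⟨h * g, Kh.mul_mem hh hg, mul_smul _ _ _⟩ } }
  let ρ : Quotient s → List V := fun ξ =>
    if h : ∃ R : List V, (∀ v ∈ R, v ∈ O) ∧ Quotient.mk s R = ξ then h.choose else []
  have hρ : ∀ x : List V, x.length = k → (∀ v ∈ x, v ∈ Oh) →
      (∀ v ∈ ρ (Quotient.mk s x), v ∈ O) ∧ ∃ g ∈ Kh, g • x = ρ (Quotient.mk s x) := by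
    intro x hk hx
    obtain ⟨g, hg, hgx⟩ := hE x hk hx
    have h : ∃ R : List V, (∀ v ∈ R, v ∈ O) ∧ Quotient.mk s R = Quotient.mk s x :=
      ⟨g • x, hgx, Quotient.sound (s.symm ⟨g, hg, rfl⟩)⟩
    have e : ρ (Quotient.mk s x) = h.choose := dif_pos h
    rw [e]
    refine ⟨h.choose_spec.1, ?_⟩
    exact s.symm (Quotient.exact h.choose_spec.2)
  have hex : ∀ x : List V, ∃ g : G, (x.length = k → (∀ v ∈ x, v ∈ Oh) →
      (g ∈ Kh ∧ g • x = ρ (Quotient.mk s x))) ∧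
      (x.length = k → (∀ v ∈ x, v ∈ O) → g ∈ K ∧ g • x = ρ (Quotient.mk s x)) := by
    intro x
    by_cases h : x.length = k ∧ ∀ v ∈ x, v ∈ Oh
    · obtain ⟨h1, g, hg, h2⟩ := hρ x h.1 h.2
      by_cases h' : ∀ v ∈ x, v ∈ O
      · obtain ⟨g', hg', e⟩ := hW x h.1 h' g hg (by rw [h2]; exact h1)
        exact ⟨g', fun _ _ => ⟨hK hg', e.trans h2⟩, fun _ _ => ⟨hg', e.trans h2⟩⟩
      · exact ⟨g, fun _ _ => ⟨hg, h2⟩, fun _ h'' => absurd h'' h'⟩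
    · refine ⟨1, fun a b => absurd ⟨a, b⟩ h, fun a b => absurd ⟨a, fun v hv => hO (b v hv)⟩ h⟩
  choose t ht using hex
  refine ⟨t, fun x => ρ (Quotient.mk s x), ?_, ?_, ?_⟩
  · intro g hg x
    exact congrArg ρ (Quotient.sound (s.symm ⟨g, hg, rfl⟩))
  · intro x hk hx
    exact ⟨((ht x).1 hk hx).1, ((ht x).1 hk hx).2, (hρ x hk hx).1⟩
  · intro x hk hx
    exact ((ht x).2 hk hx).1

lemma Phi_sp {K : Subgroup G} {O O' : Set V} (hO : ∀ g ∈ K, ∀ v ∈ O, g • v ∈ O) {k q : ℕ}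
    (t : List V → G) (r : List V → List V)
    (ht : ∀ x : List V, x.length = k → (∀ v ∈ x, v ∈ O) →
      t x ∈ K ∧ t x • x = r x ∧ ∀ v ∈ r x, v ∈ O')
    (hr : ∀ g ∈ K, ∀ x : List V, x.length = k → (∀ v ∈ x, v ∈ O) → r (g • x) = r x)
    {z : BC G (List V)} (hz : z ∈ sp K O k q) :
    Phi t z ∈ Finsupp.supported ℤ ℤ
      {p | p ∈ sset K O' k q ∧ ∀ g ∈ p.1, g • p.2 = p.2} := by
  refine map_supp _ ?_ hz
  rintro ⟨l, x⟩ hp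
  rw [Phi_single]
  have := Phi0_mem hO t r ht hr l x q hp
  exact single_mem ⟨this.1, this.2.2⟩

lemma lab_flt (R : List V) (z : BC G (List V)) : lab R (lab [] (flt R z)) = flt R z := by
  have h := flt_supp (R := R) (s := Set.univ) (z := z) (by simp)
  have := eq_supp ((lab R).comp (lab [])) LinearMap.id ?_ h
  · simpa only [LinearMap.comp_apply, LinearMap.id_apply] using this
  rintro ⟨l, x⟩ ⟨-, rfl⟩
  simp

lemma lab_nil_sp {s : Set (List G × List V)} {K : Subgroup G} {q : ℕ} 
    (hs : ∀ p ∈ s, p.1.length = q ∧ ∀ g ∈ p.1, g ∈ K) {z : BC G (List V)}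
    (hz : z ∈ Finsupp.supported ℤ ℤ s) : lab [] z ∈ sp K ∅ 0 q := by
  refine map_supp _ ?_ hz
  intro p hp
  rw [lab_single]
  exact single_mem ⟨(hs p hp).1, (hs p hp).2, rfl, by simp⟩

/-- Shapiro-type generation lemma. -/
lemma shapiro {Kh K : Subgroup G} {Oh O : Set V} 
    (hKO : ∀ g ∈ K, ∀ v ∈ O, g • v ∈ O) (hKOh : ∀ g ∈ Kh, ∀ v ∈ Oh, g • v ∈ Oh)
    (hK : K ≤ Kh) (hO : O ⊆ Oh) {k q : ℕ}
    (hE : ∀ Γ : List V, Γ.length = k → (∀ v ∈ Γ, v ∈ Oh) → ∃ g ∈ Kh, ∀ v ∈ g • Γ, v ∈ O)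
    (hW : ∀ Γ : List V, Γ.length = k → (∀ v ∈ Γ, v ∈ O) → ∀ g ∈ Kh, (∀ v ∈ g • Γ, v ∈ O) →
      ∃ g' ∈ K, g' • Γ = g • Γ) (N : Submodule ℤ (BC G (List V)))
    (hN : Br Kh K Oh O k q ≤ N)
    (h : ∀ R : List V, R.length = k → (∀ v ∈ R, v ∈ O) →
      ∀ κ ∈ Zr (Kh ⊓ MulAction.stabilizer G R) (K ⊓ MulAction.stabilizer G R) ∅ ∅ 0 q,
        lab R κ ∈ N) {c : BC G (List V)} (hc : c ∈ Zr Kh K Oh O k q) : c ∈ N := by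
  obtain ⟨t, r, hr, ht, htK⟩ := transporter hK hO hE hW
  obtain ⟨hc1, hc2⟩ := mem_Zr.1 hc
  rcases Nat.eq_zero_or_pos q with rfl | hq
  · refine map_supp LinearMap.id ?_ hc1
    rintro ⟨l, x⟩ ⟨h1, h2, h3, h4⟩
    have hl : l = [] := List.length_eq_zero_iff.1 h1
    subst hl
    obtain ⟨g, hg, hgx⟩ := hE x h3 h4
    have e : (Finsupp.single (([] : List G), x) (1 : ℤ)) =
        dv (Finsupp.single ([g], x) 1) + Finsupp.single ([], g • x) 1 := by
      rw [dv_apply, D0_single, P_single]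
      simp [D00, P0, mu]
    rw [LinearMap.id_apply, e]
    refine N.add_mem (hN (dv_mem_Br (single_mem ⟨by simp, by simpa using hg, h3, h4⟩))) ?_
    have hgk : (g • x).length = k := by simpa using h3
    have := h (g • x) hgk hgx (Finsupp.single ([], []) 1) (mem_Zr.2 ⟨single_mem ⟨rfl, by simp, rfl, by simp⟩, by
        rw [dv_apply, D0_single, P_single]; simp [D00, P0]⟩)
    rwa [lab_single] at this
  have hpr := prism t c
  have ht1 : ∀ x : List V, x.length = k → (∀ v ∈ x, v ∈ Oh) → t x ∈ Kh :=
    fun x a b => (ht x a b).1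
  have e : c = (dv (hP t c) + hP t (dv c)) + Phi t c := by rw [hpr]; abel
  have hdc := hP_sp hKO t htK hc2
  rw [Nat.sub_add_cancel hq] at hdc
  rw [e]
  refine N.add_mem (N.add_mem (hN (dv_mem_Br (hP_sp hKOh t ht1 hc1))) (hN (sp_le_Br hdc))) ?_
  have hPhi := Phi_sp hKOh t r ht (fun g hg x _ _ => hr g hg x) hc1
  have hPhid := Phi_sp (O' := O) hKO t r (fun x a b =>
    ⟨htK x a b, (ht x a (fun v hv => hO (b v hv))).2⟩) (fun g hg x _ _ => hr g (hK hg) x) hc2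
  rw [Phi_dv] at hPhid
  refine flt_sum _ N ?_
  rintro ⟨l, R⟩ hp
  obtain ⟨⟨p1, p2, p3, p4⟩, p5⟩ := hPhi (Finset.mem_coe.2 hp)
  change flt R _ ∈ N
  rw [← lab_flt]
  refine h R p3 p4 _ ?_
  have f1 := flt_supp (R := R) hPhi
  have f2 := flt_supp (R := R) hPhid
  have f3 : lab [] (flt R (Phi t c)) ∈ sp (Kh ⊓ MulAction.stabilizer G R) ∅ 0 q := by
    refine lab_nil_sp ?_ f1
    rintro ⟨l, x⟩ ⟨⟨⟨a1, a2, a3, a4⟩, a5⟩, rfl⟩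
    exact ⟨a1, fun g hg => ⟨a2 g hg, a5 g hg⟩⟩
  refine mem_Zr.2 ⟨f3, ?_⟩
  have f4 : dv (lab [] (flt R (Phi t c))) = lab [] (flt R (dv (Phi t c))) := by
    rw [flt_dv (fun p hp => hp.2) R hPhi]
    refine dv_lab (K := ⊤) (O := Set.univ) (k := k) (q := q) (fun g _ => rfl) ?_
    refine Finsupp.supported_mono ?_ f1
    rintro ⟨l, x⟩ ⟨⟨⟨a1, a2, a3, a4⟩, a5⟩, rfl⟩
    exact ⟨a1, fun _ _ => trivial, a3, fun _ _ => trivial⟩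
  rw [f4]
  refine lab_nil_sp ?_ f2
  rintro ⟨l, x⟩ ⟨⟨⟨a1, a2, a3, a4⟩, a5⟩, rfl⟩
  exact ⟨a1, fun g hg => ⟨a2 g hg, a5 g hg⟩⟩

end Shapiro

end UStab

namespace UStab

set_option linter.unusedSectionVars false
set_option linter.unusedVariables false

section ConstPrism

variable {G V : Type} [Group G] [MulAction G V]

/-- prism for a constant group element -/
noncomputable abbrev hc (g : G) : BC G (List V) →ₗ[ℤ] BC G (List V) := hP (fun _ => g)
noncomputable abbrev cj (g : G) : BC G (List V) →ₗ[ℤ] BC G (List V) := Phi (fun _ => g)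

lemma Phi0_const (g : G) (l : List G) (x : List V) :
    Phi0 (fun _ => g) l x = (l.map (fun h => g * h * g⁻¹), g • x) := by
  induction l with
  | nil => rfl
  | cons a l ih => simp [Phi0, ih]

lemma cj_single (g : G) (l : List G) (x : List V) :
    cj g (Finsupp.single (l, x) 1) = Finsupp.single (l.map (fun h => g * h * g⁻¹), g • x) 1 := by
  rw [Phi_single, Phi0_const]

lemma hc_sp {K : Subgroup G} {O : Set V} (hO : ∀ g ∈ K, ∀ v ∈ O, g • v ∈ O) {k q : ℕ}
    {g : G} (hg : g ∈ K) {z : BC G (List V)} (hz : z ∈ sp K O k q) :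
    hc g z ∈ sp K O k (q + 1) := hP_sp hO _ (fun _ _ _ => hg) hz

/-- a chain is homologous to its conjugate -/
lemma cj_Br {Kh K : Subgroup G} {Oh O : Set V} 
    (hKOh : ∀ g ∈ Kh, ∀ v ∈ Oh, g • v ∈ Oh) {k q : ℕ} {g : G} (hg : g ∈ Kh)
    {z : BC G (List V)} (hz : z ∈ sp Kh Oh k q) (h : hc g (dv z) ∈ sp K O k q) :
    z - cj g z ∈ Br Kh K Oh O k q := by
  rw [← prism]
  exact Submodule.add_mem _ (dv_mem_Br (hc_sp hKOh hg hz)) (sp_le_Br h)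

lemma hc_dv_sp {Kh K : Subgroup G} {Oh O : Set V} (hKO : ∀ g ∈ K, ∀ v ∈ O, g • v ∈ O)
    {k q : ℕ} {g : G} (hg : g ∈ K) {z : BC G (List V)} (hz : z ∈ Zr Kh K Oh O k q) :
    hc g (dv z) ∈ sp K O k q := by
  obtain ⟨h1, h2⟩ := mem_Zr.1 hz
  rcases Nat.eq_zero_or_pos q with rfl | hq
  · rw [dv_zero h1, map_zero]; exact Submodule.zero_mem _
  · have := hc_sp hKO hg h2
    rwa [Nat.sub_add_cancel hq] at this

lemma cj_lab {L : Subgroup G} {O : Set V} {k q : ℕ} {g : G} (hg : ∀ h ∈ L, g * h = h * g)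
    {z : BC G (List V)} (hz : z ∈ sp L O k q) (Γ : List V) :
    cj g (lab Γ z) = lab (g • Γ) z := by
  have := eq_supp ((cj g).comp (lab Γ)) (lab (g • Γ)) ?_ hz
  · rwa [LinearMap.comp_apply] at this
  rintro ⟨l, x⟩ ⟨h1, h2, h3, h4⟩
  rw [LinearMap.comp_apply, lab_single, lab_single, cj_single]
  congr 2
  have : ∀ h ∈ l, g * h * g⁻¹ = h := fun h hh => by rw [hg h (h2 h hh)]; group
  rw [List.map_congr_left this]; simp

lemma cj_sp {K K' : Subgroup G} {q : ℕ} {g : G} (hg : ∀ h ∈ K, g * h * g⁻¹ ∈ K')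
    {O : Set V} {z : BC G (List V)} (hz : z ∈ sp K O 0 q) : cj g z ∈ sp K' O 0 q := by
  refine map_supp _ ?_ hz
  rintro ⟨l, x⟩ ⟨h1, h2, h3, h4⟩
  have : x = [] := List.length_eq_zero_iff.1 h3
  subst this
  rw [cj_single]
  refine single_mem ⟨by simpa using h1, ?_, rfl, by simp⟩
  intro h hh
  obtain ⟨h', hh', rfl⟩ := List.mem_map.1 hh
  exact hg h' (h2 h' hh')

/-! ### additivity -/

lemma h0_comm_cons {c g : G} (hcg : c * g = g * c) (l : List G) (x : List V) :
    h0 (fun _ => c) (g :: l) x = Finsupp.single (c :: g :: l, x) 1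
      - consL g (h0 (fun _ => c) l x) := by
  rw [h0]
  congr 3
  rw [hcg]; group

/-- two-fold insertion -/
noncomputable def i20 (c d : G) : List G → List V → BC G (List V)
  | [], x => Finsupp.single ([c, d], x) 1
  | g :: l, x => consL c (h0 (fun _ => d) (g :: l) x) + consL g (i20 c d l x)

noncomputable def i2 (c d : G) : BC G (List V) →ₗ[ℤ] BC G (List V) :=
  Finsupp.linearCombination ℤ (fun p => i20 c d p.1 p.2)

@[simp] lemma i2_single (c d : G) (p : List G × List V) :
    i2 c d (Finsupp.single p 1) = i20 c d p.1 p.2 := by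
  simp [i2]

lemma i2_consL (c d g : G) (z : BC G (List V)) :
    i2 c d (consL g z) = consL c (hc d (consL g z)) + consL g (i2 c d z) := by
  have : (i2 c d).comp (consL g) = (consL c).comp ((hc d).comp (consL g))
      + ((consL g).comp (i2 c d) : BC G (List V) →ₗ[ℤ] _) := by
    apply Finsupp.lhom_ext'; intro p; ext1; simp [i20]
  exact congrArg (fun f => f z) this

lemma i2_D (c d : G) (l : List G) (x : List V) :
    D0 (i20 c d l x) - i2 c d (D00 l x) = h0 (fun _ => d) l x := by
  cases l with
  | nil => simp [i20, D00, h0]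
  | cons g l =>
    rw [i20, D00, map_add, D0_consL, D0_consL, i2_single]
    simp

lemma P_h0 {d : G} (l : List G) (hl : ∀ g ∈ l, d * g = g * d) :
    P (h0 (fun _ => d) l ([] : List V)) = Finsupp.single (l, []) 1 - hc d (P0 l []) := by
  have := prism_P (fun _ => d) l ([] : List V)
  rw [Phi0_const] at this
  have e : l.map (fun h => d * h * d⁻¹) = l := by
    rw [List.map_congr_left (g := id)]
    · simp
    · intro h hh
      rw [hl h hh]; simp
  rw [e] at this
  rw [← smul_nil d, ← this]
  simp

lemma i2_P {c d : G} (l : List G) (hc' : ∀ g ∈ l, c * g = g * c) (hd : ∀ g ∈ l, d * g = g * d) :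
    P (i20 c d l ([] : List V)) - i2 c d (P0 l []) =
      h0 (fun _ => c * d) l [] - h0 (fun _ => c) l [] := by
  induction l with
  | nil => simp [i20, P0, h0, mu]
  | cons g l ih =>
    have hcg := hc' g (by simp)
    have hdg := hd g (by simp)
    have hcd : (c * d) * g = g * (c * d) := by rw [mul_assoc, hdg, ← mul_assoc, hcg, mul_assoc]
    have ih' := ih (fun a ha => hc' a (List.mem_cons_of_mem _ ha))
      (fun a ha => hd a (List.mem_cons_of_mem _ ha))
    have e1 : P (i20 c d (g :: l) ([] : List V)) =
        muL c (h0 (fun _ => d) (g :: l) []) - consL c (P (h0 (fun _ => d) (g :: l) []))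
        + (muL g (i20 c d l []) - consL g (P (i20 c d l []))) := by
      rw [i20, map_add, P_consL, P_consL]
    have e2 : i2 c d (P0 (g :: l) ([] : List V)) = i20 c d (mu g (l, ([] : List V))).1 (mu g (l, ([] : List V))).2
        - (consL c (hc d (consL g (P0 l []))) + consL g (i2 c d (P0 l []))) := by
      rw [P0, map_sub, i2_single, i2_consL]
    have e3 : hc d (P0 (g :: l) ([] : List V)) = h0 (fun _ => d) (mu g (l, ([] : List V))).1 (mu g (l, ([] : List V))).2
        - hc d (consL g (P0 l [])) := by
      rw [P0, map_sub, hP_single]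
    have e4 : muL c (h0 (fun _ => d) (g :: l) ([] : List V)) =
        Finsupp.single ((c * d) :: g :: l, []) 1 - consL (c * g) (h0 (fun _ => d) l []) := by
      rw [h0_comm_cons hdg, map_sub, muL_consL, muL_single]; rfl
    have e5 : muL g (i20 c d l ([] : List V)) - i20 c d (mu g (l, ([] : List V))).1 (mu g (l, ([] : List V))).2
        = consL (c * g) (h0 (fun _ => d) l ([] : List V))
          - consL c (h0 (fun _ => d) (mu g (l, ([] : List V))).1 (mu g (l, ([] : List V))).2) := by
      cases l with
      | nil => simp [i20, mu, h0, hcg]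
      | cons k l =>
        simp only [i20, mu, map_add, muL_consL, hcg]
        abel
    rw [e1, e2, P_h0 (g :: l) hd, e3, e4, h0_comm_cons hcd, h0_comm_cons hcg, map_sub, map_sub,
      consL_single]
    have ih2 := congrArg (consL g) ih'
    simp only [map_sub] at ih2
    linear_combination (norm := abel) e5 - ih2

lemma hc_add {c d : G} {L : Subgroup G} {p : ℕ} (hcL : ∀ g ∈ L, c * g = g * c)
    (hdL : ∀ g ∈ L, d * g = g * d) {b : BC G (List V)} (hb : b ∈ sp L ∅ 0 p) (hb0 : dv b = 0) :
    dv (i2 c d b) = hc c b + hc d b - hc (c * d) b := by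
  have h := eq_supp (dv.comp (i2 c d) - (i2 c d).comp dv) (hc c + hc d - hc (c * d)) ?_ hb
  · simpa only [LinearMap.sub_apply, LinearMap.comp_apply, LinearMap.add_apply, hb0, map_zero,
      sub_zero] using h
  rintro ⟨l, x⟩ ⟨h1, h2, h3, h4⟩
  have : x = [] := List.length_eq_zero_iff.1 h3
  subst this
  have a1 := i2_D c d l ([] : List V)
  have a2 := i2_P (V := V) l (fun g hg => hcL g (h2 g hg)) (fun g hg => hdL g (h2 g hg))
  simp only [LinearMap.sub_apply, LinearMap.comp_apply, LinearMap.add_apply, dv_apply, D0_single,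
    P_single, i2_single, hP_single, map_sub]
  linear_combination (norm := abel) a1 - a2

lemma h0_sp' {K : Subgroup G} {c : G} (hc : c ∈ K) (l : List G) (hl : ∀ g ∈ l, g ∈ K) :
    h0 (fun _ => c) l ([] : List V) ∈ sp K ∅ 0 (l.length + 1) :=
  h0_sp (by simp) _ (fun _ _ _ => hc) l [] _ ⟨rfl, hl, rfl, by simp⟩

lemma i2_sp {K : Subgroup G} {c d : G} (hc' : c ∈ K) (hd : d ∈ K) {p : ℕ}
    {b : BC G (List V)} (hb : b ∈ sp K ∅ 0 p) : i2 c d b ∈ sp K ∅ 0 (p + 2) := by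
  refine map_supp _ ?_ hb
  rintro ⟨l, x⟩ ⟨h1, h2, h3, h4⟩
  have : x = [] := List.length_eq_zero_iff.1 h3
  subst this
  rw [i2_single]
  simp only at h1 h2 ⊢
  subst h1
  clear h3 h4 hb
  induction l with
  | nil =>
    exact single_mem ⟨rfl, by simp [hc', hd], rfl, by simp⟩
  | cons g l ih =>
    rw [i20]
    refine Submodule.add_mem _ (consL_sp hc' (h0_sp' hd _ h2)) (consL_sp (h2 g (by simp)) ?_)
    exact ih (fun a ha => h2 a (List.mem_cons_of_mem _ ha))

/-- bounding chains -/
noncomputable def Bd (K : Subgroup G) (p : ℕ) : Submodule ℤ (BC G (List V)) :=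
  (sp K ∅ 0 (p + 1)).map dv

lemma f_add {Kh : Subgroup G} {c d : G} {L : Subgroup G} (hL : L ≤ Kh) (hcK : c ∈ Kh) (hdK : d ∈ Kh)
    {p : ℕ} (hcL : ∀ g ∈ L, c * g = g * c)
    (hdL : ∀ g ∈ L, d * g = g * d) {b : BC G (List V)} (hb : b ∈ sp L ∅ 0 p) (hb0 : dv b = 0) :
    hc c b + hc d b - hc (c * d) b ∈ Bd Kh (p + 1) := by
  rw [← hc_add hcL hdL hb hb0]
  exact ⟨_, i2_sp hcK hdK (sp_mono_K hL hb), rfl⟩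

lemma f_conj {Kh : Subgroup G} {c d : G} {L : Subgroup G} (hL : L ≤ Kh) (hcK : c ∈ Kh) (hdK : d ∈ Kh)
    {p : ℕ} (hcL : ∀ g ∈ L, c * g = g * c)
    (hdL : ∀ g ∈ L, d * g = g * d) {b : BC G (List V)} (hb : b ∈ sp L ∅ 0 p) (hb0 : dv b = 0) :
    hc c b - hc (d * c * d⁻¹) b ∈ Bd Kh (p + 1) := by
  have hcb : hc c b ∈ sp Kh ∅ 0 (p + 1) := hc_sp (by simp) hcK (sp_mono_K hL hb)
  have e1 : cj c b = b := by
    have := eq_supp (cj c) LinearMap.id ?_ hb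
    · simpa using this
    rintro ⟨l, x⟩ ⟨h1, h2, h3, h4⟩
    have : x = [] := List.length_eq_zero_iff.1 h3
    subst this
    rw [cj_single]
    have : ∀ h ∈ l, c * h * c⁻¹ = h := fun h hh => by rw [hcL h (h2 h hh)]; group
    rw [List.map_congr_left this]; simp
  have e2 : dv (hc c b) = 0 := by
    have := prism (fun _ => c) b
    rw [hb0, map_zero, add_zero] at this
    rw [this]
    rw [show Phi (fun _ => c) b = b from e1, sub_self]
  have e3 : cj d (hc c b) = hc (d * c * d⁻¹) b := by
    have := eq_supp ((cj d).comp (hc c)) (hc (d * c * d⁻¹)) ?_ hb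
    · simpa using this
    rintro ⟨l, x⟩ ⟨h1, h2, h3, h4⟩
    have : x = [] := List.length_eq_zero_iff.1 h3
    subst this
    rw [LinearMap.comp_apply, hP_single, hP_single]
    simp only at h2 ⊢
    clear h1 h3 h4
    induction l with
    | nil => rw [h0, h0, cj_single]; simp
    | cons g l ih =>
      have hg := h2 g (by simp)
      have hl : ∀ h ∈ (g :: l), d * h * d⁻¹ = h := fun h hh => by rw [hdL h (h2 h hh)]; group
      have hcc : ∀ z : BC G (List V), cj d (consL g z) = consL (d * g * d⁻¹) (cj d z) := by
        intro z
        have : (cj d).comp (consL g) = ((consL (d * g * d⁻¹)).comp (cj d) : BC G (List V) →ₗ[ℤ] _) := by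
          apply Finsupp.lhom_ext'; intro p; ext1
          simp [Phi0_const]
        exact congrArg (fun f => f z) this
      rw [h0_comm_cons (hcL g hg), h0_comm_cons, map_sub, hcc, ih (fun a ha => h2 a (List.mem_cons_of_mem _ ha)),
        cj_single, List.map_cons, List.map_congr_left hl, hl g (by simp)]
      · simp
      · have h1 := hdL g hg
        have h2 := hcL g hg
        have h3 : d⁻¹ * g = g * d⁻¹ := by
          rw [inv_mul_eq_iff_eq_mul, ← mul_assoc, h1]; group
        rw [mul_assoc, h3, ← mul_assoc, mul_assoc d c g, h2, ← mul_assoc d g c, h1]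
        group
  have := prism (fun _ => d) (hc c b)
  rw [e2, map_zero, add_zero] at this
  rw [← e3, ← this]
  exact ⟨_, hc_sp (by simp) hdK hcb, rfl⟩

end ConstPrism

end UStab

namespace UStab

set_option linter.unusedSectionVars false
set_option linter.unusedVariables false

/-- Hermitian form data -/
structure Herm {F V : Type} [Field F] [AddCommGroup V] [Module F V] (σ : F →+* F)
    (ω : V → V → F) : Prop where
  inv : ∀ x, σ (σ x) = x
  ne : ∃ x, σ x ≠ x
  addr : ∀ v w w', ω v (w + w') = ω v w + ω v w'
  smulr : ∀ v (c : F) w, ω v (c • w) = c * ω v w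
  conj : ∀ v w, σ (ω v w) = ω w v
  rep : ∀ f : V →ₗ[F] F, ∃ t, ∀ w, ω t w = f w

section Geometry

variable {F V : Type} [Field F] [AddCommGroup V] [Module F V] {σ : F →+* F} {ω : V → V → F}

namespace Herm

variable (h : Herm σ ω)
include h

lemma addl (v v' w : V) : ω (v + v') w = ω v w + ω v' w := by
  rw [← h.conj w, h.addr, map_add, h.conj, h.conj]
lemma smull (c : F) (v w : V) : ω (c • v) w = σ c * ω v w := by
  rw [← h.conj w, h.smulr, map_mul, h.conj]
lemma zeror (v : V) : ω v 0 = 0 := by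
  have := h.smulr v 0 0; simpa using this
lemma zerol (v : V) : ω 0 v = 0 := by
  have := h.smull 0 0 v; simpa using this
lemma negr (v w : V) : ω v (-w) = - ω v w := by
  have := h.smulr v (-1) w; simpa using this
lemma negl (v w : V) : ω (-v) w = - ω v w := by
  have := h.smull (-1) v w; simpa using this
lemma subr (v w w' : V) : ω v (w - w') = ω v w - ω v w' := by
  rw [sub_eq_add_neg, h.addr, h.negr, sub_eq_add_neg]
lemma subl (v v' w : V) : ω (v - v') w = ω v w - ω v' w := by
  rw [sub_eq_add_neg, h.addl, h.negl, sub_eq_add_neg]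
lemma symm0 {v w : V} (e : ω v w = 0) : ω w v = 0 := by
  rw [← h.conj, e, map_zero]
lemma nsym (v : V) : σ (ω v v) = ω v v := h.conj v v

lemma skew : ∃ s, s ≠ 0 ∧ s + σ s = 0 := by
  obtain ⟨x, hx⟩ := h.ne
  refine ⟨x - σ x, sub_ne_zero.2 (Ne.symm hx), ?_⟩
  rw [map_sub, h.inv]; ring

lemma trace (c : F) (hc : σ c = c) : ∃ l, l + σ l = c := by
  have : ∃ r, r + σ r ≠ 0 := by
    by_contra hcon
    push Not at hcon
    obtain ⟨x, hx⟩ := h.ne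
    have h1 := hcon 1
    have h2 := hcon x
    have h3 : x + x = 0 := by
      have : x * (1 + σ 1) = 0 := by rw [h1, mul_zero]
      rw [map_one] at this; linear_combination this
    exact hx (by linear_combination h2 - h3)
  obtain ⟨r, hr⟩ := this
  have hs : σ (r + σ r) = r + σ r := by rw [map_add, h.inv]; ring
  refine ⟨c * r / (r + σ r), ?_⟩
  rw [map_div₀, map_mul, hc, hs]
  field_simp

lemma trace_ne (c : F) (hc : σ c = c) : ∃ l, l ≠ 0 ∧ l + σ l = c := by
  obtain ⟨l, hl⟩ := h.trace c hc
  by_cases h0 : l = 0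
  · obtain ⟨s, hs, hs'⟩ := h.skew
    refine ⟨s, hs, ?_⟩
    rw [hs', ← hl, h0]; simp
  · exact ⟨l, h0, hl⟩

/-- scaled version of trace -/
lemma trace_mul (c p : F) (hc : σ c = c) (hp : p ≠ 0) : ∃ l, l * p + σ l * σ p = c := by
  obtain ⟨l, hl⟩ := h.trace c hc
  refine ⟨l / p, ?_⟩
  have : σ p ≠ 0 := by simpa using hp
  rw [map_div₀]
  field_simp
  exact hl

lemma sigma_ne {p : F} (hp : p ≠ 0) : σ p ≠ 0 := by simpa using hp

lemma dual {B : Submodule F V} {u : V} (hu : u ∉ B) : ∃ t, (∀ b ∈ B, ω t b = 0) ∧ ω t u = 1 := by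
  obtain ⟨f, hf, hB⟩ := Submodule.exists_dual_map_eq_bot_of_notMem hu inferInstance
  obtain ⟨t, ht⟩ := h.rep ((f u)⁻¹ • f)
  refine ⟨t, ?_, ?_⟩
  · intro b hb
    rw [ht]
    have : f b ∈ B.map f := ⟨b, hb, rfl⟩
    rw [hB] at this
    simp [(Submodule.mem_bot F).1 this]
  · rw [ht]; simp [hf]

lemma nondeg {v : V} (hv : ∀ w, ω v w = 0) : v = 0 := by
  by_contra h0
  obtain ⟨t, -, ht⟩ := h.dual (B := ⊥) (u := v) (by simpa using h0)
  have := h.symm0 (hv t)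
  rw [this] at ht
  exact zero_ne_one ht

end Herm

/-- orthogonal complement -/
def prp (h : Herm σ ω) (T : Submodule F V) : Submodule F V where
  carrier := {x | ∀ t ∈ T, ω t x = 0}
  add_mem' := fun {a b} ha hb t ht => by rw [h.addr, ha t ht, hb t ht, add_zero]
  zero_mem' := fun t _ => h.zeror t
  smul_mem' := fun c x hx t ht => by rw [h.smulr, hx t ht, mul_zero]

lemma mem_prp {h : Herm σ ω} {T : Submodule F V} {x : V} : x ∈ prp h T ↔ ∀ t ∈ T, ω t x = 0 :=
  Iff.rfl

lemma prp_anti {h : Herm σ ω} {T T' : Submodule F V} (e : T ≤ T') : prp h T' ≤ prp h T :=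
  fun _ hx t ht => hx t (e ht)

lemma le_prp_comm {h : Herm σ ω} {T T' : Submodule F V} (e : T ≤ prp h T') : T' ≤ prp h T :=
  fun _ hx t ht => h.symm0 (e ht _ hx)

lemma sup_le_prp {h : Herm σ ω} {T T' : Submodule F V} {x : V} (h1 : x ∈ prp h T)
    (h2 : x ∈ prp h T') : x ∈ prp h (T ⊔ T') := by
  intro t ht
  obtain ⟨a, ha, b, hb, rfl⟩ := Submodule.mem_sup.1 ht
  rw [h.addl, h1 a ha, h2 b hb, add_zero]

lemma mem_prp_span {h : Herm σ ω} {s : Set V} {x : V} :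
    x ∈ prp h (Submodule.span F s) ↔ ∀ t ∈ s, ω t x = 0 := by
  constructor
  · intro hx t ht; exact hx t (Submodule.subset_span ht)
  · intro hx
    have : Submodule.span F s ≤ prp h (Submodule.span F {x}) := by
      rw [Submodule.span_le]
      intro t ht y hy
      obtain ⟨c, rfl⟩ := Submodule.mem_span_singleton.1 hy
      rw [h.smull, h.symm0 (hx t ht), mul_zero]
    intro t ht
    exact h.symm0 (this ht x (Submodule.mem_span_singleton_self x))

/-- span of two vectors -/
abbrev sp2 (F : Type) {V : Type} [Field F] [AddCommGroup V] [Module F V] (x y : V) :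
    Submodule F V := Submodule.span F {x, y}
abbrev sp1 (F : Type) {V : Type} [Field F] [AddCommGroup V] [Module F V] (x : V) :
    Submodule F V := Submodule.span F {x}

lemma mem_sp1 (x : V) : x ∈ sp1 F x := Submodule.mem_span_singleton_self x
lemma mem_sp2l (x y : V) : x ∈ sp2 F x y := Submodule.subset_span (by simp)
lemma mem_sp2r (x y : V) : y ∈ sp2 F x y := Submodule.subset_span (by simp)
lemma sp1_le {x : V} {T : Submodule F V} : sp1 F x ≤ T ↔ x ∈ T :=
  Submodule.span_singleton_le_iff_mem x T
lemma sp2_le {x y : V} {T : Submodule F V} : sp2 F x y ≤ T ↔ x ∈ T ∧ y ∈ T := by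
  rw [sp2, Submodule.span_le]
  simp [Set.insert_subset_iff]
lemma mem_prp_sp1 {h : Herm σ ω} {x y : V} : x ∈ prp h (sp1 F y) ↔ ω y x = 0 := by
  rw [mem_prp_span]; simp
lemma mem_prp_sp2 {h : Herm σ ω} {x y z : V} :
    x ∈ prp h (sp2 F y z) ↔ ω y x = 0 ∧ ω z x = 0 := by
  rw [mem_prp_span]; simp

/-- hyperbolic pair -/
def Hyp (ω : V → V → F) (x x' : V) : Prop := ω x x = 0 ∧ ω x' x' = 0 ∧ ω x x' = 1

lemma Hyp.r (h : Herm σ ω) {x x' : V} (hx : Hyp ω x x') : ω x' x = 1 := by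
  rw [← h.conj, hx.2.2, map_one]

/-! ### group elements -/

lemma smul_def (g : bilinIsoms F ω) (v : V) : g • v = g.1 v := rfl
lemma g_isom (g : bilinIsoms F ω) (v w : V) : ω (g • v) (g • w) = ω v w := g.2 v w
lemma g_add (g : bilinIsoms F ω) (v w : V) : g • (v + w) = g • v + g • w := map_add g.1 v w
lemma g_sub (g : bilinIsoms F ω) (v w : V) : g • (v - w) = g • v - g • w := map_sub g.1 v w
lemma g_smul (g : bilinIsoms F ω) (c : F) (v : V) : g • (c • v) = c • (g • v) := map_smul g.1 c v

/-- pointwise fixer -/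
def Fx (ω : V → V → F) (T : Submodule F V) : Subgroup (bilinIsoms F ω) where
  carrier := {g | ∀ t ∈ T, g • t = t}
  one_mem' := fun t _ => one_smul _ t
  mul_mem' := fun {a b} ha hb t ht => by rw [mul_smul, hb t ht, ha t ht]
  inv_mem' := fun {a} ha t ht => by rw [inv_smul_eq_iff, ha t ht]

lemma mem_Fx {T : Submodule F V} {g : bilinIsoms F ω} : g ∈ Fx ω T ↔ ∀ t ∈ T, g • t = t := Iff.rfl

lemma Fx_anti {T T' : Submodule F V} (e : T ≤ T') : Fx ω T' ≤ Fx ω T :=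
  fun _ hg t ht => hg t (e ht)

lemma mem_Fx_sup {T T' : Submodule F V} {g : bilinIsoms F ω} (h1 : g ∈ Fx ω T)
    (h2 : g ∈ Fx ω T') : g ∈ Fx ω (T ⊔ T') := by
  intro t ht
  obtain ⟨a, ha, b, hb, rfl⟩ := Submodule.mem_sup.1 ht
  rw [g_add, h1 a ha, h2 b hb]

lemma mem_Fx_span {s : Set V} {g : bilinIsoms F ω} (h1 : ∀ v ∈ s, g • v = v) :
    g ∈ Fx ω (Submodule.span F s) := by
  intro t ht
  induction ht using Submodule.span_induction with
  | mem x hx => exact h1 x hx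
  | zero => exact map_zero g.1
  | add x y _ _ hx hy => rw [g_add, hx, hy]
  | smul a x _ hx => rw [g_smul, hx]

/-- building isometries -/
lemma mkIso (f f' : V →ₗ[F] V) (h1 : ∀ v, f (f' v) = v) (h2 : ∀ v, f' (f v) = v)
    (h3 : ∀ v w, ω (f v) (f w) = ω v w) : ∃ g : bilinIsoms F ω, ∀ v, g • v = f v :=
  ⟨⟨LinearEquiv.ofLinearMap f f' (LinearMap.ext h1) (LinearMap.ext h2), h3⟩, fun _ => rfl⟩

/-- the form as a linear map in the second variable -/
def Herm.lin (h : Herm σ ω) (v : V) : V →ₗ[F] F where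
  toFun := ω v
  map_add' := h.addr v
  map_smul' c w := h.smulr v c w

lemma quasi (h : Herm σ ω) (d : V) (s : F) (hs : s ≠ 0) (hd : ω d d = - s - σ s) :
    ∃ g : bilinIsoms F ω, ∀ x, g • x = x + (s⁻¹ * ω d x) • d := by
  have hs' : σ s ≠ 0 := h.sigma_ne hs
  refine mkIso (LinearMap.id + ((s⁻¹ • h.lin d).smulRight d))
    (LinearMap.id + (((σ s)⁻¹ • h.lin d).smulRight d)) ?_ ?_ ?_
  · intro v
    change (v + ((σ s)⁻¹ * ω d v) • d) + (s⁻¹ * ω d (v + ((σ s)⁻¹ * ω d v) • d)) • d = v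
    rw [h.addr, h.smulr, hd, add_assoc, ← add_smul]
    convert add_zero v
    convert zero_smul F d
    field_simp; ring
  · intro v
    change (v + (s⁻¹ * ω d v) • d) + ((σ s)⁻¹ * ω d (v + (s⁻¹ * ω d v) • d)) • d = v
    rw [h.addr, h.smulr, hd, add_assoc, ← add_smul]
    convert add_zero v
    convert zero_smul F d
    field_simp; ring
  · intro v w
    change ω (v + (s⁻¹ * ω d v) • d) (w + (s⁻¹ * ω d w) • d) = ω v w
    simp only [h.addr, h.addl, h.smulr, h.smull, hd, map_mul, map_inv₀, h.conj]
    field_simp; ring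

/-- Witt for one vector -/
lemma witt1 (h : Herm σ ω) {T : Submodule F V} {v v' : V} (hv : v ∉ T) (hv' : v' ∉ T)
    (hp : ∀ t ∈ T, ω t v = ω t v') (hn : ω v v = ω v' v') : ∃ g ∈ Fx ω T, g • v = v' := by
  have key : ∀ v v' : V, (∀ t ∈ T, ω t v = ω t v') → ω v v = ω v' v' → ω (v' - v) v ≠ 0 →
      ∃ g ∈ Fx ω T, g • v = v' := by
    intro v v' hp hn hs
    obtain ⟨g, hg⟩ := quasi h (v' - v) (ω (v' - v) v) hs (by
      rw [h.conj]
      simp only [h.subr, h.subl]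
      rw [hn]; ring)
    refine ⟨g, ?_, ?_⟩
    · intro t ht
      rw [hg, h.symm0 (v := t) (by rw [h.subr, hp t ht, sub_self])]
      simp
    · rw [hg, inv_mul_cancel₀ hs, one_smul]; abel
  by_cases hs : ω (v' - v) v = 0
  · obtain ⟨t1, ht1, ht1'⟩ := h.dual hv
    obtain ⟨t2, ht2, ht2'⟩ := h.dual hv'
    have : ∃ t0, (∀ b ∈ T, ω t0 b = 0) ∧ ω t0 v ≠ 0 ∧ ω t0 v' ≠ 0 := by
      by_cases e1 : ω t1 v' = 0
      · by_cases e2 : ω t2 v = 0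
        · refine ⟨t1 + t2, ?_, ?_, ?_⟩
          · intro b hb; rw [h.addl, ht1 b hb, ht2 b hb, add_zero]
          · rw [h.addl, ht1', e2]; simp
          · rw [h.addl, ht2', e1]; simp
        · exact ⟨t2, ht2, e2, by rw [ht2']; exact one_ne_zero⟩
      · exact ⟨t1, ht1, by rw [ht1']; exact one_ne_zero, e1⟩
    obtain ⟨t0, hT, hn1, hn2⟩ := this
    obtain ⟨ν, hν, hνs⟩ := h.trace_ne (-ω t0 t0) (by rw [map_neg, h.nsym])
    have hσν : σ ν ≠ 0 := h.sigma_ne hν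
    have hl : ∃ l : F, l ≠ 0 ∧ l * ω v t0 + σ l * ω t0 v + l * σ l * ω t0 t0 = 0 := by
      have hq : ω v t0 ≠ 0 := by rw [← h.conj]; exact h.sigma_ne hn1
      refine ⟨ω t0 v / ν, div_ne_zero hn1 hν, ?_⟩
      rw [map_div₀, h.conj]
      field_simp
      linear_combination (ω t0 v * ω v t0) * hνs
    obtain ⟨l, hl0, hl⟩ := hl
    have hσl := h.sigma_ne hl0
    have hv0 : ω v' v = ω v v := by rw [h.subl] at hs; exact sub_eq_zero.1 hs
    have hv1 : ω v v' = ω v v := by rw [← h.conj, hv0, h.nsym]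
    have hT' : ∀ t ∈ T, ω t t0 = 0 := fun t ht => h.symm0 (hT t ht)
    have hnn : ω (v + l • t0) (v + l • t0) = ω v v := by
      simp only [h.addr, h.addl, h.smulr, h.smull]
      linear_combination hl
    obtain ⟨g, hg, e⟩ := key v (v + l • t0) (by
      intro t ht; rw [h.addr, h.smulr, hT' t ht]; simp) hnn.symm (by
      rw [add_sub_cancel_left, h.smull]; exact mul_ne_zero hσl hn1)
    obtain ⟨g', hg', e'⟩ := key v' (v + l • t0) (by
      intro t ht; rw [h.addr, h.smulr, hT' t ht, hp t ht]; simp) (by rw [hnn, hn]) (by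
      rw [h.subl, h.addl, h.smull, hv1, hn, add_sub_cancel_left]; exact mul_ne_zero hσl hn2)
    refine ⟨g'⁻¹ * g, Subgroup.mul_mem _ (Subgroup.inv_mem _ hg') hg, ?_⟩
    rw [mul_smul, e, inv_smul_eq_iff, e']
  · exact key v v' hp hn hs

/-- Witt for hyperbolic pairs -/
lemma witt2 (h : Herm σ ω) {T : Submodule F V} {x x' y y' : V} (hx : Hyp ω x x') (hy : Hyp ω y y')
    (x1 : x ∈ prp h T) (x2 : x' ∈ prp h T) (y1 : y ∈ prp h T) (y2 : y' ∈ prp h T) :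
    ∃ g ∈ Fx ω T, g • x = y ∧ g • x' = y' := by
  have hxT : x ∉ T := fun hh => by
    have := x2 x hh; rw [hx.2.2] at this; exact one_ne_zero this
  have hyT : y ∉ T := fun hh => by
    have := y2 y hh; rw [hy.2.2] at this; exact one_ne_zero this
  obtain ⟨g, hg, e⟩ := witt1 h hxT hyT (fun t ht => by rw [x1 t ht, y1 t ht]) (by rw [hx.1, hy.1])
  have e2 : ω y (g • x') = 1 := by rw [← e, g_isom (ω := ω) g _ _, hx.2.2]
  have hgT : ∀ t ∈ T, ω t (g • x') = 0 := fun t ht => by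
    have := g_isom g t x'
    rw [hg t ht] at this
    rw [this, x2 t ht]
  have notin : ∀ z, (∀ t ∈ T, ω t z = 0) → ω y z = 1 → z ∉ T ⊔ sp1 F y := by
    intro z hz1 hz2 hz
    have : y ∈ prp h (T ⊔ sp1 F y) := sup_le_prp y1 (mem_prp_sp1.2 hy.1)
    have := h.symm0 (this z hz)
    rw [hz2] at this
    exact one_ne_zero this
  obtain ⟨g', hg', e'⟩ := witt1 h (T := T ⊔ sp1 F y) (v := g • x') (v' := y')
    (notin _ hgT e2) (notin _ y2 hy.2.2) (by
      intro t ht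
      obtain ⟨a, ha, b, hb, rfl⟩ := Submodule.mem_sup.1 ht
      obtain ⟨c, rfl⟩ := Submodule.mem_span_singleton.1 hb
      rw [h.addl, h.addl, h.smull, h.smull, hgT a ha, y2 a ha, e2, hy.2.2]) (by
      rw [g_isom (ω := ω) g _ _, hx.2.1, hy.2.1])
  refine ⟨g' * g, Subgroup.mul_mem _ (Fx_anti le_sup_left hg') hg, ?_, ?_⟩
  · rw [mul_smul, e, hg' y (le_sup_right (a := T) (mem_sp1 y))]
  · rw [mul_smul, e']

end Geometry

end UStab

namespace UStab

set_option linter.unusedSectionVars false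
set_option linter.unusedVariables false

section Geometry2

variable {F V : Type} [Field F] [AddCommGroup V] [Module F V] {σ : F →+* F} {ω : V → V → F}

/-- at least `m` hyperbolic planes orthogonal to `T` -/
def J (h : Herm σ ω) : ℕ → Submodule F V → Prop
  | 0, _ => True
  | m + 1, T => ∃ x x', Hyp ω x x' ∧ x ∈ prp h T ∧ x' ∈ prp h T ∧ J h m (T ⊔ sp2 F x x')

variable (h : Herm σ ω)

lemma J_T {m : ℕ} {T T' : Submodule F V} (e : T ≤ T') (hJ : J h m T') : J h m T := by
  induction m generalizing T T' with
  | zero => trivial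
  | succ m ih =>
    obtain ⟨x, x', hx, h1, h2, h3⟩ := hJ
    exact ⟨x, x', hx, prp_anti e h1, prp_anti e h2, ih (sup_le_sup_right e _) h3⟩

lemma J_succ {m : ℕ} {T : Submodule F V} (hJ : J h (m + 1) T) : J h m T := by
  induction m generalizing T with
  | zero => trivial
  | succ m ih =>
    obtain ⟨x, x', hx, h1, h2, h3⟩ := hJ
    exact ⟨x, x', hx, h1, h2, ih h3⟩

lemma J_le {m m' : ℕ} {T : Submodule F V} (e : m ≤ m') (hJ : J h m' T) : J h m T := by
  induction e with
  | refl => exact hJ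
  | step _ ih => exact ih (J_succ h hJ)

lemma J_equiv {m : ℕ} {T T' : Submodule F V} (g : bilinIsoms F ω) (e : ∀ t ∈ T', g⁻¹ • t ∈ T)
    (hJ : J h m T) : J h m T' := by
  induction m generalizing T T' with
  | zero => trivial
  | succ m ih =>
    obtain ⟨x, x', hx, h1, h2, h3⟩ := hJ
    have key : ∀ y ∈ prp h T, g • y ∈ prp h T' := by
      intro y hy t ht
      have := g_isom (ω := ω) g (g⁻¹ • t) y
      rw [smul_inv_smul] at this
      rw [this]; exact hy _ (e t ht)
    refine ⟨g • x, g • x', ⟨?_, ?_, ?_⟩, key x h1, key x' h2, ih ?_ h3⟩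
    · rw [g_isom (ω := ω) g _ _]; exact hx.1
    · rw [g_isom (ω := ω) g _ _]; exact hx.2.1
    · rw [g_isom (ω := ω) g _ _]; exact hx.2.2
    · intro t ht
      obtain ⟨a, ha, b, hb, rfl⟩ := Submodule.mem_sup.1 ht
      obtain ⟨c, d, rfl⟩ := Submodule.mem_span_pair.1 hb
      rw [g_add, g_add, g_smul, g_smul, inv_smul_smul, inv_smul_smul]
      exact Submodule.add_mem_sup (e a ha) (Submodule.mem_span_pair.2 ⟨c, d, rfl⟩)

/-- complemented subspaces -/
def Cm (T : Submodule F V) : Prop := ∀ v, ∃ a ∈ T, v - a ∈ prp h T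

lemma Cm_top : Cm h (⊤ : Submodule F V) := fun v => ⟨v, trivial, by rw [sub_self]; exact zero_mem _⟩

lemma Cm_cut {T : Submodule F V} (hT : Cm h T) {x x' : V} (hx : Hyp ω x x') (h1 : x ∈ T)
    (h2 : x' ∈ T) : Cm h (T ⊓ prp h (sp2 F x x')) := by
  intro v
  obtain ⟨a, ha, hva⟩ := hT v
  refine ⟨a - ω x' a • x - ω x a • x', ⟨?_, ?_⟩, ?_⟩
  · exact sub_mem (sub_mem ha (Submodule.smul_mem _ _ h1)) (Submodule.smul_mem _ _ h2)
  · refine mem_prp_sp2.2 ⟨?_, ?_⟩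
    · simp only [h.subr, h.smulr, hx.1, hx.2.2]; ring
    · simp only [h.subr, h.smulr, hx.2.1, hx.r h]; ring
  · have e : v - (a - ω x' a • x - ω x a • x') = (v - a) + ω x' a • x + ω x a • x' := by abel
    rw [e]
    intro t ht
    have h3 := mem_prp_sp2.1 ht.2
    rw [h.addr, h.addr, h.smulr, h.smulr, hva t ht.1, h.symm0 h3.1, h.symm0 h3.2]
    ring

lemma Mlem {m : ℕ} {T : Submodule F V} (hJ : J h m T) : ∃ T', T ≤ T' ∧ J h m T' ∧ Cm h T' := by
  induction m generalizing T with
  | zero => exact ⟨⊤, le_top, trivial, Cm_top h⟩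
  | succ m ih =>
    obtain ⟨x, x', hx, h1, h2, h3⟩ := hJ
    obtain ⟨T', e, hJ', hC⟩ := ih h3
    have hs : sp2 F x x' ≤ T' := le_trans le_sup_right e
    refine ⟨T' ⊓ prp h (sp2 F x x'), le_inf (le_trans le_sup_left e) ?_,
      ⟨x, x', hx, ?_, ?_, J_T h (sup_le inf_le_left hs) hJ'⟩,
      Cm_cut h hC hx (sp2_le.1 hs).1 (sp2_le.1 hs).2⟩
    · exact le_prp_comm (sp2_le.2 ⟨h1, h2⟩)
    · intro t ht; exact h.symm0 (mem_prp_sp2.1 ht.2).1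
    · intro t ht; exact h.symm0 (mem_prp_sp2.1 ht.2).2

/-- transport of `J` along a Witt move -/
lemma J_move {m : ℕ} {T : Submodule F V} {v v' : V} (hv : v ∉ T) (hv' : v' ∉ T)
    (hp : ∀ t ∈ T, ω t v = ω t v') (hn : ω v v = ω v' v') (hJ : J h m (T ⊔ sp1 F v)) :
    J h m (T ⊔ sp1 F v') := by
  obtain ⟨g, hg, e⟩ := witt1 h hv hv' hp hn
  refine J_equiv h g ?_ hJ
  intro t ht
  obtain ⟨a, ha, b, hb, rfl⟩ := Submodule.mem_sup.1 ht
  obtain ⟨c, rfl⟩ := Submodule.mem_span_singleton.1 hb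
  rw [g_add, g_smul, ← e, inv_smul_smul, (Fx ω T).inv_mem hg a ha]
  exact Submodule.add_mem_sup ha (Submodule.mem_span_singleton.2 ⟨c, rfl⟩)

lemma D1 {m : ℕ} {T : Submodule F V} (hJ : J h (m + 1) T) (v : V) : J h m (T ⊔ sp1 F v) := by
  by_cases hv : v ∈ T
  · rw [sup_eq_left.2 (sp1_le.2 hv)]; exact J_succ h hJ
  obtain ⟨T', e, ⟨x, x', hx, h1, h2, h3⟩, hC⟩ := Mlem h hJ
  obtain ⟨a, ha, hva⟩ := hC v
  obtain ⟨l, hl⟩ := h.trace (ω v v - ω a a) (by rw [map_sub, h.nsym, h.nsym])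
  have n1 : a + x + l • x' ∉ T := by
    intro hh
    have h4 := h2 _ (e hh)
    rw [h.addl, h.addl, h.smull, h2 a ha, hx.2.2, hx.2.1] at h4
    simp at h4
  refine J_move h n1 hv ?_ ?_ (J_T h (sup_le (le_trans e le_sup_left) (sp1_le.2 ?_)) h3)
  · intro t ht
    have h4 := hva t (e ht)
    rw [h.subr, sub_eq_zero] at h4
    rw [h.addr, h.addr, h.smulr, h1 t (e ht), h2 t (e ht), h4]; ring
  · simp only [h.addr, h.addl, h.smulr, h.smull, hx.1, hx.2.1, hx.2.2, hx.r h, h1 a ha, h2 a ha,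
      h.symm0 (h1 a ha), h.symm0 (h2 a ha)]
    linear_combination hl
  · rw [add_assoc]
    exact Submodule.add_mem_sup ha (add_mem (mem_sp2l _ _) (Submodule.smul_mem _ _ (mem_sp2r _ _)))

lemma D2 {m : ℕ} {T : Submodule F V} (hJ : J h m T) {e v : V} (he : e ∈ T) (he' : e ∈ prp h T)
    (hv : ω e v ≠ 0) : J h m (T ⊔ sp1 F v) := by
  have hvT : ∀ v, ω e v ≠ 0 → v ∉ T := fun v hv hh => hv (h.symm0 (he' v hh))
  obtain ⟨T', hT, hJ', hC⟩ := Mlem h hJ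
  obtain ⟨a, ha, hva⟩ := hC v
  have hta : ∀ t ∈ T', ω t v = ω t a := by
    intro t ht
    have h4 := hva t ht
    rwa [h.subr, sub_eq_zero] at h4
  have hea : ω a e ≠ 0 := by
    intro h0; apply hv; rw [hta e (hT he)]; exact h.symm0 h0
  obtain ⟨l, hl⟩ := h.trace_mul (ω v v - ω a a) (ω a e) (by rw [map_sub, h.nsym, h.nsym]) hea
  rw [h.conj] at hl
  have hee : ω e e = 0 := he' e he
  refine J_move h (v := a + l • e) (hvT _ ?_) (hvT _ hv) ?_ ?_ (J_T h (sup_le hT (sp1_le.2 ?_)) hJ')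
  · rw [h.addr, h.smulr, hee, mul_zero, add_zero]
    intro h0; exact hea (h.symm0 h0)
  · intro t ht
    rw [h.addr, h.smulr, he' t ht, hta t (hT ht)]; ring
  · simp only [h.addr, h.addl, h.smulr, h.smull, hee]
    linear_combination hl
  · exact add_mem ha (Submodule.smul_mem _ _ (hT he))

/-- hyperbolic partner -/
lemma partner {S : Submodule F V} {u : V} (hu : u ∉ S) (hn : ω u u = 0) (hS : u ∈ prp h S) :
    ∃ u', Hyp ω u u' ∧ u' ∈ prp h S := by
  obtain ⟨t, ht, htu⟩ := h.dual hu
  have hut : ω u t = 1 := by rw [← h.conj, htu, map_one]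
  obtain ⟨l, hl⟩ := h.trace (-ω t t) (by rw [map_neg, h.nsym])
  refine ⟨t + l • u, ⟨hn, ?_, ?_⟩, ?_⟩
  · simp only [h.addr, h.addl, h.smulr, h.smull, hn, htu, hut]
    linear_combination hl
  · simp only [h.addr, h.smulr, hn, hut]; ring
  · intro s hs
    rw [h.addr, h.smulr, h.symm0 (ht s hs), hS s hs]; ring

lemma D3 {m : ℕ} {S : Submodule F V} {u : V} (hu : u ∉ S) (hn : ω u u = 0) (hS : u ∈ prp h S)
    (hJ : J h m (S ⊔ sp1 F u)) : J h (m + 1) S := by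
  obtain ⟨u', hy, hS'⟩ := partner h hu hn hS
  refine ⟨u, u', hy, hS, hS', J_T h ?_ (D2 h hJ (e := u) (v := u')
    (le_sup_right (a := S) (mem_sp1 u)) (sup_le_prp hS (mem_prp_sp1.2 hn)) (by
      rw [hy.2.2]; exact one_ne_zero))⟩
  refine sup_le (le_trans le_sup_left le_sup_left) (sp2_le.2 ⟨?_, ?_⟩)
  · exact le_sup_left (b := sp1 F u') (le_sup_right (a := S) (mem_sp1 u))
  · exact le_sup_right (a := S ⊔ sp1 F u) (mem_sp1 u')

lemma Cancel {m : ℕ} {T : Submodule F V} {a a' : V} (hJ : J h (m + 1) T) (ha : Hyp ω a a')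
    (h1 : a ∈ prp h T) (h2 : a' ∈ prp h T) : J h m (T ⊔ sp2 F a a') := by
  obtain ⟨x, x', hx, h3, h4, h5⟩ := hJ
  obtain ⟨g, hg, e, e'⟩ := witt2 h hx ha h3 h4 h1 h2
  refine J_equiv h g ?_ h5
  intro t ht
  obtain ⟨b, hb, b', hb', rfl⟩ := Submodule.mem_sup.1 ht
  obtain ⟨c, d, rfl⟩ := Submodule.mem_span_pair.1 hb'
  rw [← e, ← e', g_add, g_add, g_smul, g_smul, inv_smul_smul, inv_smul_smul,
    (Fx ω T).inv_mem hg b hb]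
  exact Submodule.add_mem_sup hb (Submodule.mem_span_pair.2 ⟨c, d, rfl⟩)

/-- adjoining a list of vectors -/
def sl (T : Submodule F V) (l : List V) : Submodule F V := T ⊔ Submodule.span F {v | v ∈ l}

lemma sl_le {T T' : Submodule F V} {l : List V} : sl T l ≤ T' ↔ T ≤ T' ∧ ∀ v ∈ l, v ∈ T' := by
  rw [sl, sup_le_iff, Submodule.span_le]
  rfl
lemma le_sl (T : Submodule F V) (l : List V) : T ≤ sl T l := le_sup_left
lemma mem_sl {T : Submodule F V} {l : List V} {v : V} (hv : v ∈ l) : v ∈ sl T l :=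
  le_sup_right (a := T) (Submodule.subset_span hv)

lemma D1l {m : ℕ} {T : Submodule F V} (l : List V) (hJ : J h (m + l.length) T) :
    J h m (sl T l) := by
  induction l generalizing T with
  | nil => exact J_T h (sl_le.2 ⟨le_rfl, by simp⟩) hJ
  | cons v l ih =>
    refine J_T h ?_ (ih (D1 h hJ v))
    refine sl_le.2 ⟨le_trans le_sup_left (le_sl _ _), ?_⟩
    intro w hw
    rcases List.mem_cons.1 hw with rfl | hw
    · exact le_sl _ _ (le_sup_right (a := T) (mem_sp1 w))
    · exact mem_sl hw

/-- one step in building an isotropic vector with prescribed products -/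
lemma EpsStep {B : Submodule F V} {ε u : V} (hε : ω ε ε = 0) (hJ : J h 1 (B ⊔ sp1 F ε)) (hu : u ∉ B)
    (γ : F) : ∃ ε', ω ε' ε' = 0 ∧ (∀ b ∈ B, ω ε' b = ω ε b) ∧ ω ε' u = γ := by
  obtain ⟨x, x', hx, h1, h2, -⟩ := hJ
  have simple : ∀ y, ω y y = 0 → y ∈ prp h (B ⊔ sp1 F ε) → ω y u ≠ 0 →
      ∃ ε', ω ε' ε' = 0 ∧ (∀ b ∈ B, ω ε' b = ω ε b) ∧ ω ε' u = γ := by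
    intro y hy hB hyu
    have hεy : ω ε y = 0 := hB ε (le_sup_right (a := B) (mem_sp1 ε))
    refine ⟨ε + (σ ((γ - ω ε u) / ω y u)) • y, ?_, ?_, ?_⟩
    · simp only [h.addr, h.addl, h.smulr, h.smull, hε, hεy, h.symm0 hεy, hy]; ring
    · intro b hb
      rw [h.addl, h.smull, h.symm0 (hB b (le_sup_left (a := B) hb))]; ring
    · rw [h.addl, h.smull, h.inv]; field_simp; ring
  by_cases e1 : ω x u = 0
  swap
  · exact simple x hx.1 h1 e1
  by_cases e2 : ω x' u = 0
  swap
  · exact simple x' hx.2.1 h2 e2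
  obtain ⟨t, ht, htu⟩ := h.dual hu
  have hεx : ω ε x = 0 := h1 ε (le_sup_right (a := B) (mem_sp1 ε))
  have hεx' : ω ε x' = 0 := h2 ε (le_sup_right (a := B) (mem_sp1 ε))
  obtain ⟨τ, hτ⟩ : ∃ τ, τ = ε + σ (γ - ω ε u) • (t - ω x' t • x - ω x t • x') := ⟨_, rfl⟩
  have hτx : ω x τ = 0 := by
    simp only [hτ, h.addr, h.smulr, h.subr, h.symm0 hεx, hx.1, hx.2.2]; ring
  have hτx' : ω x' τ = 0 := by
    simp only [hτ, h.addr, h.smulr, h.subr, h.symm0 hεx', hx.2.1, hx.r h]; ring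
  have hτB : ∀ b ∈ B, ω τ b = ω ε b := by
    intro b hb
    have hb' := le_sup_left (b := sp1 F ε) hb
    simp only [hτ, h.addl, h.smull, h.subl, h.symm0 (h1 b hb'), h.symm0 (h2 b hb'), ht b hb]; ring
  have hτu : ω τ u = γ := by
    simp only [hτ, h.addl, h.smull, h.subl, e1, e2, htu, h.inv]; ring
  obtain ⟨l, hl⟩ := h.trace (-ω τ τ) (by rw [map_neg, h.nsym])
  refine ⟨τ + x + l • x', ?_, ?_, ?_⟩
  · simp only [h.addr, h.addl, h.smulr, h.smull, hx.1, hx.2.1, hx.2.2, hx.r h, hτx, hτx',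
      h.symm0 hτx, h.symm0 hτx']
    linear_combination hl
  · intro b hb
    have hb' := le_sup_left (b := sp1 F ε) hb
    rw [h.addl, h.addl, h.smull, h.symm0 (h1 b hb'), h.symm0 (h2 b hb'), hτB b hb]; ring
  · rw [h.addl, h.addl, h.smull, e1, e2, hτu]; ring

lemma Eps1 {A : Submodule F V} {u : V} (hJ : J h 1 A) (hu : u ∉ A) (γ : F) :
    ∃ ε, ω ε ε = 0 ∧ ε ∈ prp h A ∧ ω ε u = γ := by
  obtain ⟨ε, h1, h2, h3⟩ := EpsStep h (B := A) (ε := 0) (h.zerol 0)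
    (J_T h (sup_le le_rfl (sp1_le.2 (zero_mem _))) hJ) hu γ
  exact ⟨ε, h1, fun b hb => h.symm0 (by rw [h2 b hb, h.zerol]), h3⟩

lemma EpsJ {A : Submodule F V} {m : ℕ} {ε u : V} (hJ : J h (m + 1) A) (hε : ω ε ε = 0)
    (hA : ε ∈ prp h A) (hu : ω ε u ≠ 0) : J h m (A ⊔ sp1 F ε ⊔ sp1 F u) :=
  D2 h (D1 h hJ ε) (le_sup_right (a := A) (mem_sp1 ε)) (sup_le_prp hA (mem_prp_sp1.2 hε)) hu

lemma Eps2 {A : Submodule F V} {u u' : V} (hJ : J h 2 A) (hu : u ∉ A) (hu' : u' ∉ A ⊔ sp1 F u)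
    {γ : F} (hγ : γ ≠ 0) (γ' : F) :
    ∃ ε, ω ε ε = 0 ∧ ε ∈ prp h A ∧ ω ε u = γ ∧ ω ε u' = γ' := by
  obtain ⟨ε, h1, h2, h3⟩ := Eps1 h (J_succ h hJ) hu γ
  have hJ' := EpsJ h hJ h1 h2 (by rw [h3]; exact hγ)
  obtain ⟨ε', h4, h5, h6⟩ := EpsStep h (B := A ⊔ sp1 F u) h1
    (J_T h (by
      refine sup_le (sup_le (le_trans le_sup_left le_sup_left) le_sup_right)
        (le_trans le_sup_right le_sup_left)) hJ') hu' γ'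
  refine ⟨ε', h4, fun b hb => h.symm0 ?_, ?_, h6⟩
  · rw [h5 b (le_sup_left (a := A) hb), h.symm0 (h2 b hb)]
  · rw [h5 u (le_sup_right (a := A) (mem_sp1 u)), h3]

/-! ### commuting elements -/

lemma g_ext {g g' : bilinIsoms F ω} (e : ∀ v : V, g • v = g' • v) : g = g' :=
  Subtype.ext (LinearEquiv.ext e)

lemma prp_prp {T : Submodule F V} (hT : Cm h T) {y : V} (hy : y ∈ prp h (prp h T)) : y ∈ T := by
  obtain ⟨a, ha, hya⟩ := hT y
  have : y - a = 0 := by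
    refine h.nondeg fun w => h.symm0 ?_
    obtain ⟨b, hb, hwb⟩ := hT w
    have e : w = b + (w - b) := by abel
    rw [e, h.addl, hya b hb, h.subr, hy _ hwb, h.symm0 (hwb a ha)]; ring
  rw [sub_eq_zero.1 this]; exact ha

lemma comm_Fx {T : Submodule F V} (hT : Cm h T) {g k : bilinIsoms F ω} (hg : g ∈ Fx ω (prp h T))
    (hk : k ∈ Fx ω T) : g * k = k * g := by
  refine g_ext fun v => ?_
  obtain ⟨a, ha, hva⟩ := hT v
  have hga : g • a ∈ T := by
    refine prp_prp h hT fun t ht => ?_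
    have := g_isom (ω := ω) g t a
    rw [hg t ht] at this
    rw [this]; exact h.symm0 (ht a ha)
  have hkb : k • (v - a) ∈ prp h T := fun t ht => by
    have := g_isom (ω := ω) k t (v - a)
    rw [hk t ht] at this
    rw [this]; exact hva t ht
  have e : v = a + (v - a) := by abel
  rw [mul_smul, mul_smul, e, g_add, g_add, g_add, g_add, hk a ha, hg _ hkb, hg _ hva, hk _ hga]

lemma Cm_hyp {x x' : V} (hx : Hyp ω x x') : Cm h (sp2 F x x') := by
  intro v
  refine ⟨ω x' v • x + ω x v • x', add_mem (Submodule.smul_mem _ _ (mem_sp2l _ _))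
    (Submodule.smul_mem _ _ (mem_sp2r _ _)), mem_prp_sp2.2 ⟨?_, ?_⟩⟩
  · simp only [h.subr, h.addr, h.smulr, hx.1, hx.2.2]; ring
  · simp only [h.subr, h.addr, h.smulr, hx.2.1, hx.r h]; ring

/-! ### Eichler transformations -/

/-- Eichler linear map -/
def El (p r : V) (t : F) : V →ₗ[F] V :=
  LinearMap.id + (t • h.lin r).smulRight p - (σ t • h.lin p).smulRight r

lemma El_apply (p r : V) (t : F) (v : V) :
    El h p r t v = v + (t * ω r v) • p - (σ t * ω p v) • r := rfl

lemma El_add {p r : V} (hp : ω p p = 0) (hr : ω r r = 0) (hpr : ω p r = 0) (s t : F) (v : V) :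
    El h p r s (El h p r t v) = El h p r (s + t) v := by
  simp only [El_apply, h.addr, h.subr, h.smulr, hp, hr, hpr, h.symm0 hpr, map_add]
  module

lemma El_zero (p r : V) (v : V) : El h p r 0 v = v := by
  simp [El_apply]

lemma El_ex {p r : V} (hp : ω p p = 0) (hr : ω r r = 0) (hpr : ω p r = 0) (t : F) :
    ∃ g : bilinIsoms F ω, ∀ v, g • v = El h p r t v := by
  refine mkIso (El h p r t) (El h p r (-t)) ?_ ?_ ?_
  · intro v; rw [El_add h hp hr hpr, add_neg_cancel, El_zero]
  · intro v; rw [El_add h hp hr hpr, neg_add_cancel, El_zero]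
  · intro v w
    simp only [El_apply, h.addr, h.addl, h.subr, h.subl, h.smulr, h.smull, hp, hr, hpr,
      h.symm0 hpr, map_mul, h.conj, h.inv]
    ring

end Geometry2

end UStab

namespace UStab

set_option linter.unusedSectionVars false
set_option linter.unusedVariables false
set_option linter.unusedSimpArgs false

section Swap

variable {F V : Type} [Field F] [AddCommGroup V] [Module F V] {σ : F →+* F} {ω : V → V → F}
variable (h : Herm σ ω)

lemma fx_comm_conj {k g : bilinIsoms F ω} {p r : V} {t : F} (hg : ∀ v, g • v = El h p r t v)
    (hp : k • p = p) (hr : k • r = r) : g * k = k * g := by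
  refine g_ext fun v => ?_
  have e1 : ω r (k • v) = ω r v := by
    have := g_isom (ω := ω) k r v; rwa [hr] at this
  have e2 : ω p (k • v) = ω p v := by
    have := g_isom (ω := ω) k p v; rwa [hp] at this
  rw [mul_smul, mul_smul, hg, hg, El_apply, El_apply, g_sub, g_add, g_smul, g_smul, hp, hr, e1, e2]

lemma El_Fx {g : bilinIsoms F ω} {S : Submodule F V} {p r : V} {t : F}
    (hg : ∀ v, g • v = El h p r t v) (hp : p ∈ prp h S) (hr : r ∈ prp h S) : g ∈ Fx ω S := by
  intro s hs
  rw [hg, El_apply, h.symm0 (hp s hs), h.symm0 (hr s hs)]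
  simp

lemma E_bd (hF : ∃ x : F, x ≠ 0 ∧ x ≠ 1) {S : Submodule F V} {p p' r : V} (hp : Hyp ω p p')
    (hr : ω r r = 0) (hpr : ω p r = 0) (hpr' : ω p' r = 0) (hpS : p ∈ prp h S) (hpS' : p' ∈ prp h S)
    (hrS : r ∈ prp h S) {L : Subgroup (bilinIsoms F ω)} (hL : L ≤ Fx ω S)
    (hLf : ∀ k ∈ L, k • p = p ∧ k • p' = p' ∧ k • r = r) {m : ℕ}
    {b : BC (bilinIsoms F ω) (List V)} (hb : b ∈ sp L ∅ 0 m) (hb0 : dv b = 0) {t : F}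
    {g : bilinIsoms F ω} (hg : ∀ v, g • v = El h p r t v) :
    hc g b ∈ Bd (V := V) (Fx ω S) (m + 1) := by
  obtain ⟨u, hu0, hu1⟩ := hF
  have hσu := h.sigma_ne hu0
  have hs : Hyp ω (u • p) ((σ u)⁻¹ • p') := by
    refine ⟨?_, ?_, ?_⟩
    · rw [h.smulr, h.smull, hp.1]; ring
    · rw [h.smulr, h.smull, hp.2.1]; ring
    · rw [h.smulr, h.smull, hp.2.2]; field_simp
  have q1 : p ∈ prp h (prp h (sp2 F p p')) := fun t ht => h.symm0 (ht _ (mem_sp2l _ _))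
  have q2 : p' ∈ prp h (prp h (sp2 F p p')) := fun t ht => h.symm0 (ht _ (mem_sp2r _ _))
  obtain ⟨s, hsF, hsp, -⟩ := witt2 h (T := prp h (sp2 F p p')) hp hs q1 q2
    (Submodule.smul_mem _ _ q1) (Submodule.smul_mem _ _ q2)
  have hsr : s • r = r := hsF r (mem_prp_sp2.2 ⟨hpr, hpr'⟩)
  obtain ⟨g0, hg0⟩ := El_ex h hp.1 hr hpr (t / (u - 1))
  have hu1' : u - 1 ≠ 0 := sub_ne_zero.2 hu1
  have hconj : s * g0 * s⁻¹ = g * g0 := by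
    refine g_ext fun v => ?_
    have e1 : ω r (s⁻¹ • v) = ω r v := by
      have := g_isom (ω := ω) s r (s⁻¹ • v); rwa [hsr, smul_inv_smul, eq_comm] at this
    have e2 : ω p (s⁻¹ • v) = σ u * ω p v := by
      have := g_isom (ω := ω) s p (s⁻¹ • v)
      rwa [hsp, smul_inv_smul, h.smull, eq_comm] at this
    rw [mul_smul, mul_smul, mul_smul, hg0, hg, hg0, El_add h hp.1 hr hpr, El_apply, El_apply,
      g_sub, g_add, g_smul, g_smul, smul_inv_smul, hsp, hsr, e1, e2, smul_smul]
    have e3 : t + t / (u - 1) = t / (u - 1) * u := by field_simp; ring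
    rw [e3, map_mul]
    module
  have hsS : s ∈ Fx ω S := Fx_anti (le_prp_comm (sp2_le.2 ⟨hpS, hpS'⟩)) hsF
  have hsL : ∀ k ∈ L, s * k = k * s := fun k hk =>
    comm_Fx h (Cm_hyp h hp) hsF (mem_Fx_span (by
      rintro v (rfl | hv)
      · exact (hLf k hk).1
      · rw [Set.mem_singleton_iff.1 hv]; exact (hLf k hk).2.1))
  have hEL : ∀ {t : F} {g : bilinIsoms F ω}, (∀ v, g • v = El h p r t v) →
      ∀ k ∈ L, g * k = k * g := fun hg k hk =>
    fx_comm_conj h hg (hLf k hk).1 (hLf k hk).2.2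
  have a1 := f_add (V := V) hL (El_Fx h hg hpS hrS) (El_Fx h hg0 hpS hrS) (hEL hg) (hEL hg0) hb hb0
  have a2 := f_conj (V := V) hL (El_Fx h hg0 hpS hrS) hsS (hEL hg0) hsL hb hb0
  rw [hconj] at a2
  have a3 := Submodule.sub_mem _ a1 a2
  convert a3 using 1
  abel

lemma swap_Br (hF : ∃ x : F, x ≠ 0 ∧ x ≠ 1) {S : Submodule F V} {a a' x x' : V} (ha : Hyp ω a a')
    (hx : Hyp ω x x') (haS : a ∈ prp h S) (haS' : a' ∈ prp h S)
    (hxS : x ∈ prp h (S ⊔ sp2 F a a')) (hxS' : x' ∈ prp h (S ⊔ sp2 F a a')) {p : ℕ}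
    {κ : BC (bilinIsoms F ω) (List V)}
    (hκ : κ ∈ Zr (Fx ω (S ⊔ sp2 F x x')) (Fx ω (S ⊔ sp2 F x x' ⊔ sp2 F a a')) ∅ ∅ 0 (p + 1)) :
    κ ∈ Br (Fx ω S) (Fx ω (S ⊔ sp2 F a a')) ∅ ∅ 0 (p + 1) := by
  have haH : a ∈ S ⊔ sp2 F a a' := le_sup_right (a := S) (mem_sp2l _ _)
  have haH' : a' ∈ S ⊔ sp2 F a a' := le_sup_right (a := S) (mem_sp2r _ _)
  have ax : ω a x = 0 := hxS a haH
  have ax' : ω a x' = 0 := hxS' a haH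
  have a'x : ω a' x = 0 := hxS a' haH'
  have a'x' : ω a' x' = 0 := hxS' a' haH'
  have hxS1 : x ∈ prp h S := prp_anti le_sup_left hxS
  have hxS1' : x' ∈ prp h S := prp_anti le_sup_left hxS'
  obtain ⟨g1, hg1⟩ := El_ex h ha.1 hx.2.1 ax' 1
  obtain ⟨g2, hg2⟩ := El_ex h hx.1 ha.2.1 (h.symm0 a'x) (-1)
  obtain ⟨k1, k2⟩ := mem_Zr.1 hκ
  set L := Fx ω (S ⊔ sp2 F x x' ⊔ sp2 F a a') with hLdef
  have hL : L ≤ Fx ω S := Fx_anti (le_trans le_sup_left le_sup_left)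
  have hK1 : Fx ω (S ⊔ sp2 F x x') ≤ Fx ω S := Fx_anti le_sup_left
  have hLx : ∀ k ∈ L, k • x = x ∧ k • x' = x' ∧ k • a = a ∧ k • a' = a' := by
    intro k hk
    have t1 : sp2 F x x' ≤ S ⊔ sp2 F x x' ⊔ sp2 F a a' := le_trans le_sup_right le_sup_left
    have t2 : sp2 F a a' ≤ S ⊔ sp2 F x x' ⊔ sp2 F a a' := le_sup_right
    exact ⟨hk _ (t1 (mem_sp2l _ _)), hk _ (t1 (mem_sp2r _ _)), hk _ (t2 (mem_sp2l _ _)),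
      hk _ (t2 (mem_sp2r _ _))⟩
  have hb0 : dv (dv κ) = 0 := dv_dv κ
  have f1 : hc g1 (dv κ) ∈ Bd (V := V) (Fx ω S) (p + 1) :=
    E_bd h hF ha hx.2.1 ax' a'x' haS haS' hxS1' hL
      (fun k hk => ⟨(hLx k hk).2.2.1, (hLx k hk).2.2.2, (hLx k hk).2.1⟩) k2 hb0 hg1
  have f2 : hc g2 (dv κ) ∈ Bd (V := V) (Fx ω S) (p + 1) :=
    E_bd h hF hx ha.2.1 (h.symm0 a'x) (h.symm0 a'x') hxS1 hxS1' haS' hL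
      (fun k hk => ⟨(hLx k hk).1, (hLx k hk).2.1, (hLx k hk).2.2.2⟩) k2 hb0 hg2
  have m1 : g1 ∈ Fx ω S := El_Fx h hg1 haS hxS1'
  have m2 : g2 ∈ Fx ω S := El_Fx h hg2 hxS1 haS'
  have c1 : ∀ k ∈ L, g1 * k = k * g1 := fun k hk =>
    fx_comm_conj h hg1 (hLx k hk).2.2.1 (hLx k hk).2.1
  have c2 : ∀ k ∈ L, g2 * k = k * g2 := fun k hk =>
    fx_comm_conj h hg2 (hLx k hk).1 (hLx k hk).2.2.2
  have c12 : ∀ k ∈ L, (g1 * g2) * k = k * (g1 * g2) := fun k hk => by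
    rw [mul_assoc, c2 k hk, ← mul_assoc, c1 k hk, mul_assoc]
  have m12 := (Fx ω S).mul_mem m1 m2
  have d1 := f_add (V := V) hL m1 m2 c1 c2 k2 hb0
  have d2 := f_add (V := V) hL m12 m1 c12 c1 k2 hb0
  have f3 : hc (g1 * g2 * g1) (dv κ) ∈ Bd (V := V) (Fx ω S) (p + 1) := by
    have := Submodule.sub_mem _ (Submodule.add_mem _ (Submodule.add_mem _ f1 f2) f1)
      (Submodule.add_mem _ d1 d2)
    convert this using 1
    abel
  set c := g1 * g2 * g1 with hcdef
  have cx : c • x = a := by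
    rw [hcdef, mul_smul, mul_smul, hg1, El_apply, hg2, El_apply, hg1, El_apply]
    simp only [h.addr, h.subr, h.smulr, hx.1, hx.2.1, hx.2.2, hx.r h, ha.1, ha.2.1, ha.2.2, ha.r h,
      ax, ax', a'x, a'x', h.symm0 ax, h.symm0 ax', h.symm0 a'x, h.symm0 a'x', map_neg, map_one]
    module
  have cx' : c • x' = a' := by
    rw [hcdef, mul_smul, mul_smul, hg1, El_apply, hg2, El_apply, hg1, El_apply]
    simp only [h.addr, h.subr, h.smulr, hx.1, hx.2.1, hx.2.2, hx.r h, ha.1, ha.2.1, ha.2.2, ha.r h,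
      ax, ax', a'x, a'x', h.symm0 ax, h.symm0 ax', h.symm0 a'x, h.symm0 a'x', map_neg, map_one]
    module
  have mc : c ∈ Fx ω S := (Fx ω S).mul_mem m12 m1
  have hcj : cj c κ ∈ sp (Fx ω (S ⊔ sp2 F a a')) ∅ 0 (p + 1) := by
    refine cj_sp ?_ k1
    intro k hk
    have hk1 := hk x (le_sup_right (a := S) (mem_sp2l _ _))
    have hk2 := hk x' (le_sup_right (a := S) (mem_sp2r _ _))
    refine mem_Fx_sup ?_ (mem_Fx_span ?_)
    · exact (Fx ω S).mul_mem ((Fx ω S).mul_mem mc (hK1 hk)) ((Fx ω S).inv_mem mc)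
    · rintro v (rfl | hv)
      · rw [mul_smul, mul_smul, ← cx, inv_smul_smul, hk1]
      · rw [Set.mem_singleton_iff.1 hv, mul_smul, mul_smul, ← cx', inv_smul_smul, hk2]
  have hp := prism (fun _ => c) κ
  have e : κ = cj c κ + (dv (hc c κ) + hc c (dv κ)) := by
    rw [hp]; abel
  rw [e]
  refine Submodule.add_mem _ (sp_le_Br hcj) (Submodule.add_mem _ ?_ ?_)
  · exact dv_mem_Br (hc_sp (by simp) mc (sp_mono_K hK1 k1))
  · obtain ⟨y, hy, hy'⟩ := f3
    rw [← hy']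
    exact dv_mem_Br hy

end Swap

end UStab

namespace UStab

set_option linter.unusedSectionVars false
set_option linter.unusedVariables false

section Infra

variable {F V : Type} [Field F] [AddCommGroup V] [Module F V] {σ : F →+* F} {ω : V → V → F}

/-- relative cycles for the fixers -/
noncomputable abbrev ZZ (ω : V → V → F) (H S : Submodule F V) (q : ℕ) :
    Submodule ℤ (BC (bilinIsoms F ω) (List V)) := Zr (Fx ω S) (Fx ω (S ⊔ H)) ∅ ∅ 0 q
/-- relative boundaries for the fixers -/
noncomputable abbrev BB (ω : V → V → F) (H S : Submodule F V) (q : ℕ) :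
    Submodule ℤ (BC (bilinIsoms F ω) (List V)) := Br (Fx ω S) (Fx ω (S ⊔ H)) ∅ ∅ 0 q

lemma ZZ_mono {H S T : Submodule F V} (e : S ≤ T) (q : ℕ) : ZZ ω H T q ≤ ZZ ω H S q := by
  intro x hx
  obtain ⟨h1, h2⟩ := mem_Zr.1 hx
  exact mem_Zr.2 ⟨sp_mono_K (Fx_anti e) h1, sp_mono_K (Fx_anti (sup_le_sup_right e H)) h2⟩

lemma BB_mono {H S T : Submodule F V} (e : S ≤ T) (q : ℕ) : BB ω H T q ≤ BB ω H S q := by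
  intro x hx
  obtain ⟨s, h1, y, h2, rfl⟩ := mem_Br.1 hx
  exact mem_Br.2 ⟨s, sp_mono_K (Fx_anti (sup_le_sup_right e H)) h1, y,
    sp_mono_K (Fx_anti e) h2, rfl⟩

lemma sp_zero {K K' : Subgroup (bilinIsoms F ω)} {O : Set V} {k : ℕ} :
    sp K O k 0 ≤ sp K' O k 0 :=
  Finsupp.supported_mono fun p hp => by
    have : p.1 = [] := List.length_eq_zero_iff.1 hp.1
    exact ⟨hp.1, by rw [this]; simp, hp.2.2⟩

lemma ZZ_zero {H S : Submodule F V} {κ} (hκ : κ ∈ ZZ ω H S 0) (T : Submodule F V) :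
    κ ∈ ZZ ω H T 0 := by
  obtain ⟨h1, h2⟩ := mem_Zr.1 hκ
  refine mem_Zr.2 ⟨sp_zero h1, ?_⟩
  rw [dv_zero h1]; exact Submodule.zero_mem _

variable (h : Herm σ ω) {a a' : V}

/-- vanishing -/
def Rst (a a' : V) (q : ℕ) : Prop := ∀ S : Submodule F V, S ≤ prp h (sp2 F a a') → J h (q + 1) S →
  ZZ ω (sp2 F a a') S q ≤ BB ω (sp2 F a a') S q
/-- surjectivity -/
def Bst (a a' : V) (q : ℕ) : Prop := ∀ S T : Submodule F V, S ≤ T → T ≤ prp h (sp2 F a a') →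
  J h q T → ∀ x ∈ ZZ ω (sp2 F a a') S q, ∃ x' ∈ ZZ ω (sp2 F a a') T q,
    x - x' ∈ BB ω (sp2 F a a') S q

lemma indepH (ha : Hyp ω a a') {T : Submodule F V} {y : V} (hT : T ≤ prp h (sp2 F a a'))
    (hy : y ∈ prp h (sp2 F a a')) (hyT : y ∈ T ⊔ sp2 F a a') : y ∈ T := by
  obtain ⟨t, ht, b, hb, rfl⟩ := Submodule.mem_sup.1 hyT
  have hb' : b ∈ prp h (sp2 F a a') := by
    have := sub_mem hy (hT ht); rwa [add_sub_cancel_left] at this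
  obtain ⟨c, d, rfl⟩ := Submodule.mem_span_pair.1 hb
  have h1 := mem_prp_sp2.1 hb'
  simp only [h.addr, h.smulr, ha.1, ha.2.1, ha.2.2, ha.r h] at h1
  have hc : c = 0 := by simpa using h1.2
  have hd : d = 0 := by simpa using h1.1
  rw [hc, hd]; simpa using ht

lemma sl_prp {S H : Submodule F V} (hS : S ≤ prp h H) {R : List V} (hR : ∀ v ∈ R, v ∈ prp h H) :
    sl S R ≤ prp h H := sl_le.2 ⟨hS, hR⟩

lemma hW_lem (ha : Hyp ω a a') {S : Submodule F V} (hS : S ≤ prp h (sp2 F a a')) {Γ : List V}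
    (hΓ : ∀ v ∈ Γ, v ∈ prp h (sp2 F a a')) {g : bilinIsoms F ω} (hg : g ∈ Fx ω S)
    (hgΓ : ∀ v ∈ g • Γ, v ∈ prp h (sp2 F a a')) :
    ∃ g' ∈ Fx ω (S ⊔ sp2 F a a'), g' • Γ = g • Γ := by
  have hT := le_prp_comm (sl_prp h hS hgΓ)
  have key : ∀ b ∈ sp2 F a a', g • b ∈ prp h (sl S (g • Γ)) := by
    intro b hb
    refine sup_le_prp ?_ (mem_prp_span.2 ?_)
    · intro s hs
      have := g_isom (ω := ω) g s b
      rw [hg s hs] at this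
      rw [this]; exact h.symm0 (hS hs b hb)
    · intro v hv
      obtain ⟨u, hu, rfl⟩ := mem_smul_list.1 hv
      rw [g_isom (ω := ω) g u b]; exact h.symm0 (hΓ u hu b hb)
  have hgH : Hyp ω (g • a) (g • a') := by
    refine ⟨?_, ?_, ?_⟩
    · rw [g_isom (ω := ω) g _ _]; exact ha.1
    · rw [g_isom (ω := ω) g _ _]; exact ha.2.1
    · rw [g_isom (ω := ω) g _ _]; exact ha.2.2
  obtain ⟨k, hk, e1, e2⟩ := witt2 h hgH ha (key a (mem_sp2l _ _)) (key a' (mem_sp2r _ _))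
    (hT (mem_sp2l _ _)) (hT (mem_sp2r _ _))
  refine ⟨k * g, mem_Fx_sup ?_ (mem_Fx_span ?_), ?_⟩
  · exact (Fx ω S).mul_mem (Fx_anti (le_sl _ _) hk) hg
  · rintro v (rfl | hv)
    · rw [mul_smul, e1]
    · rw [Set.mem_singleton_iff.1 hv, mul_smul, e2]
  · rw [mul_smul]
    exact smul_list_eq fun v hv => hk v (mem_sl hv)

lemma hE_lem (ha : Hyp ω a a') {S : Submodule F V} (hS : S ≤ prp h (sp2 F a a')) {Γ : List V}
    (hJ : J h 1 (sl S Γ)) : ∃ g ∈ Fx ω S, ∀ v ∈ g • Γ, v ∈ prp h (sp2 F a a') := by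
  obtain ⟨x, x', hx, h1, h2, -⟩ := hJ
  have hS' := le_prp_comm hS
  obtain ⟨g, hg, e1, e2⟩ := witt2 h hx ha (prp_anti (le_sl S Γ) h1) (prp_anti (le_sl S Γ) h2)
    (hS' (mem_sp2l _ _)) (hS' (mem_sp2r _ _))
  refine ⟨g, hg, fun v hv => ?_⟩
  obtain ⟨u, hu, rfl⟩ := mem_smul_list.1 hv
  refine mem_prp_sp2.2 ⟨?_, ?_⟩
  · rw [← e1, g_isom (ω := ω) g _ _]; exact h.symm0 (h1 u (mem_sl hu))
  · rw [← e2, g_isom (ω := ω) g _ _]; exact h.symm0 (h2 u (mem_sl hu))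

lemma Fx_stab (S : Submodule F V) (R : List V) :
    Fx ω S ⊓ MulAction.stabilizer (bilinIsoms F ω) R = Fx ω (sl S R) := by
  ext g
  constructor
  · rintro ⟨h1, h2⟩
    exact mem_Fx_sup h1 (mem_Fx_span (smul_list_fix (MulAction.mem_stabilizer_iff.1 h2)))
  · intro hg
    exact ⟨Fx_anti (le_sl S R) hg, MulAction.mem_stabilizer_iff.2
      (smul_list_eq fun v hv => hg v (mem_sl hv))⟩

lemma sl_sup (S H : Submodule F V) (R : List V) : sl (S ⊔ H) R = sl S R ⊔ H := by
  rw [sl, sl, sup_right_comm]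

/-- data of a label set -/
structure Lset (ha : Hyp ω a a') (S : Submodule F V) (Oh : Set V) : Prop where
  hS : S ≤ prp h (sp2 F a a')
  st : ∀ g ∈ Fx ω S, ∀ v ∈ Oh, g • v ∈ Oh

variable {h} {ha : Hyp ω a a'} {S : Submodule F V} {Oh : Set V}

namespace Lset

variable (L : Lset h ha S Oh)
include L

lemma stO : ∀ g ∈ Fx ω (S ⊔ sp2 F a a'), ∀ v ∈ Oh ∩ (prp h (sp2 F a a') : Set V),
    g • v ∈ Oh ∩ (prp h (sp2 F a a') : Set V) := by
  rintro g hg v ⟨h1, h2⟩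
  refine ⟨L.st g (Fx_anti le_sup_left hg) v h1, fun t ht => ?_⟩
  have := g_isom (ω := ω) g t v
  rw [hg t (le_sup_right (a := S) ht)] at this
  rw [this]; exact h2 t ht

lemma shap {k q : ℕ} (hq : J h 1 S → True)
    (hJ : ∀ R : List V, R.length = k → (∀ v ∈ R, v ∈ Oh) → J h 1 (sl S R))
    (N : Submodule ℤ (BC (bilinIsoms F ω) (List V)))
    (hN : Br (Fx ω S) (Fx ω (S ⊔ sp2 F a a')) Oh (Oh ∩ prp h (sp2 F a a')) k q ≤ N)
    (hR : ∀ R : List V, R.length = k → (∀ v ∈ R, v ∈ Oh ∧ v ∈ prp h (sp2 F a a')) →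
      ∀ κ ∈ ZZ ω (sp2 F a a') (sl S R) q, lab R κ ∈ N)
    {c} (hc : c ∈ Zr (Fx ω S) (Fx ω (S ⊔ sp2 F a a')) Oh (Oh ∩ prp h (sp2 F a a')) k q) :
    c ∈ N := by
  refine shapiro L.stO L.st (Fx_anti le_sup_left) Set.inter_subset_left ?_ ?_ N hN ?_ hc
  · intro Γ hΓ hΓO
    obtain ⟨g, hg, hgΓ⟩ := hE_lem h ha L.hS (hJ Γ hΓ hΓO)
    refine ⟨g, hg, fun v hv => ⟨?_, hgΓ v hv⟩⟩
    obtain ⟨u, hu, rfl⟩ := mem_smul_list.1 hv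
    exact L.st g hg u (hΓO u hu)
  · intro Γ hΓ hΓO g hg hgΓ
    exact hW_lem h ha L.hS (fun v hv => (hΓO v hv).2) hg (fun v hv => (hgΓ v hv).2)
  · intro R hRk hRO κ hκ
    refine hR R hRk hRO κ ?_
    rwa [Fx_stab, Fx_stab, sl_sup] at hκ

lemma H_of {k q : ℕ}
    (hJ : 1 ≤ q → ∀ R : List V, R.length = k → (∀ v ∈ R, v ∈ Oh) → J h 1 (sl S R))
    (hR : ∀ R : List V, R.length = k → (∀ v ∈ R, v ∈ Oh) →
      (1 ≤ q → ∀ v ∈ R, v ∈ prp h (sp2 F a a')) →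
      ∀ κ ∈ ZZ ω (sp2 F a a') (sl S R) q,
      lab R κ ∈ Nul (Fx ω S) (Fx ω (S ⊔ sp2 F a a')) Oh (Oh ∩ prp h (sp2 F a a')) k q) :
    Zr (Fx ω S) (Fx ω (S ⊔ sp2 F a a')) Oh (Oh ∩ prp h (sp2 F a a')) k q ≤
      Nul (Fx ω S) (Fx ω (S ⊔ sp2 F a a')) Oh (Oh ∩ prp h (sp2 F a a')) k q := by
  intro c hc
  rcases Nat.eq_zero_or_pos q with rfl | hq
  · refine map_supp LinearMap.id ?_ (mem_Zr.1 hc).1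
    rintro ⟨l, x⟩ ⟨h1, h2, h3, h4⟩
    have hl : l = [] := List.length_eq_zero_iff.1 h1
    subst hl
    have hm : (Finsupp.single (([] : List (bilinIsoms F ω)), ([] : List V)) (1 : ℤ)) ∈
        sp (Fx ω (sl S x)) ∅ 0 0 := single_mem ⟨rfl, by simp, rfl, by simp⟩
    have := hR x h3 h4 (by simp) (Finsupp.single ([], []) 1)
      (mem_Zr.2 ⟨hm, by rw [dv_zero hm]; exact Submodule.zero_mem _⟩)
    rwa [lab_single] at this
  · exact L.shap (fun _ => trivial) (hJ hq) _ Br_le_Nul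
      (fun R h1 h2 κ hκ => hR R h1 (fun v hv => (h2 v hv).1) (fun _ v hv => (h2 v hv).2) κ hκ) hc

lemma lab_Zr {q : ℕ} {R : List V} (hR : ∀ v ∈ R, v ∈ Oh)
    (hRH : 1 ≤ q → ∀ v ∈ R, v ∈ prp h (sp2 F a a')) {κ}
    (hκ : κ ∈ ZZ ω (sp2 F a a') (sl S R) q) :
    lab R κ ∈ Zr (Fx ω S) (Fx ω (S ⊔ sp2 F a a')) Oh (Oh ∩ prp h (sp2 F a a')) R.length q := by
  obtain ⟨h1, h2⟩ := mem_Zr.1 hκ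
  refine mem_Zr.2 ⟨sp_mono_K (Fx_anti (le_sl S R)) (lab_sp hR h1), ?_⟩
  rw [dv_lab (K := Fx ω (sl S R)) (fun g hg => smul_list_eq fun v hv => hg v (mem_sl hv)) h1]
  rcases Nat.eq_zero_or_pos q with rfl | hq
  · rw [dv_zero h1, map_zero]; exact Submodule.zero_mem _
  · exact sp_mono_K (Fx_anti (sup_le_sup_right (le_sl S R) _))
      (lab_sp (O' := Oh ∩ (prp h (sp2 F a a') : Set V)) (fun v hv => ⟨hR v hv, hRH hq v hv⟩) h2)

lemma lab_Br {q : ℕ} {R : List V} (hR : ∀ v ∈ R, v ∈ Oh)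
    (hRH : ∀ v ∈ R, v ∈ prp h (sp2 F a a')) {κ}
    (hκ : κ ∈ BB ω (sp2 F a a') (sl S R) q) :
    lab R κ ∈ Br (Fx ω S) (Fx ω (S ⊔ sp2 F a a')) Oh (Oh ∩ prp h (sp2 F a a')) R.length q := by
  obtain ⟨s, h1, y, h2, rfl⟩ := mem_Br.1 hκ
  rw [map_add]
  refine Submodule.add_mem _ (sp_le_Br ?_) ?_
  · exact sp_mono_K (Fx_anti (sup_le_sup_right (le_sl S R) _))
      (lab_sp (O' := Oh ∩ (prp h (sp2 F a a') : Set V)) (fun v hv => ⟨hR v hv, hRH v hv⟩) h1)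
  · rw [← dv_lab (K := Fx ω (sl S R)) (fun g hg => smul_list_eq fun v hv => hg v (mem_sl hv)) h2]
    exact dv_mem_Br (sp_mono_K (Fx_anti (le_sl S R)) (lab_sp hR h2))

/-- enough hyperbolic planes implies null -/
lemma null {q : ℕ} (hq : 1 ≤ q → Rst h a a' q) {R : List V} (hR : ∀ v ∈ R, v ∈ Oh)
    (hRH : 1 ≤ q → ∀ v ∈ R, v ∈ prp h (sp2 F a a')) (hJ : J h (q + 1) (sl S R)) {κ}
    (hκ : κ ∈ ZZ ω (sp2 F a a') (sl S R) q) :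
    lab R κ ∈ Nul (Fx ω S) (Fx ω (S ⊔ sp2 F a a')) Oh (Oh ∩ prp h (sp2 F a a')) R.length q := by
  rcases Nat.eq_zero_or_pos q with rfl | hq'
  · obtain ⟨g, hg, hgR⟩ := hE_lem h ha L.hS hJ
    refine map_supp (lab R) ?_ (mem_Zr.1 hκ).1
    rintro ⟨l, x⟩ ⟨h1, h2, h3, h4⟩
    have hl : l = [] := List.length_eq_zero_iff.1 h1
    subst hl
    have e : (Finsupp.single (([] : List (bilinIsoms F ω)), R) (1 : ℤ)) =
        dv (Finsupp.single ([g], R) 1) + Finsupp.single ([], g • R) 1 := by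
      rw [dv_apply, D0_single, P_single]
      simp [D00, P0, mu]
    rw [lab_single, e]
    refine Br_le_Nul (Submodule.add_mem _ (dv_mem_Br (single_mem ⟨rfl, ?_, rfl, hR⟩))
      (sp_le_Br (single_mem ⟨rfl, by simp, by simp, ?_⟩)))
    · intro k hk
      have : k = g := by simpa using hk
      rw [this]; exact hg
    · intro v hv
      refine ⟨?_, hgR v hv⟩
      obtain ⟨u, hu, rfl⟩ := mem_smul_list.1 hv
      exact L.st g hg u (hR u hu)
  · exact Br_le_Nul (L.lab_Br hR (hRH hq')
      (hq hq' _ (sl_prp h L.hS (hRH hq')) hJ hκ))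

/-- replacing a cycle by one with smaller support -/
lemma core {q : ℕ} (hB : 1 ≤ q → Bst h a a' q) {R : List V} {w : V}
    (hR : ∀ v ∈ w :: R, v ∈ Oh) (hRH : 1 ≤ q → ∀ v ∈ w :: R, v ∈ prp h (sp2 F a a'))
    (hJ : 1 ≤ q → J h (q - 1) (sl S (w :: R) ⊔ sp2 F a a')) {κ}
    (hκ : κ ∈ ZZ ω (sp2 F a a') (sl S R) q) :
    ∃ T', sl S (w :: R) ≤ T' ∧ Cm h T' ∧ (1 ≤ q → T' ≤ prp h (sp2 F a a')) ∧
      ∃ κ' ∈ ZZ ω (sp2 F a a') T' q,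
      (lab R κ' ∈ Nul (Fx ω S) (Fx ω (S ⊔ sp2 F a a')) Oh (Oh ∩ prp h (sp2 F a a')) R.length q →
      lab R κ ∈ Nul (Fx ω S) (Fx ω (S ⊔ sp2 F a a')) Oh (Oh ∩ prp h (sp2 F a a')) R.length q) := by
  rcases Nat.eq_zero_or_pos q with rfl | hq
  · exact ⟨⊤, le_top, Cm_top h, by simp, κ, ZZ_zero hκ _, id⟩
  · obtain ⟨T0, e, hJ0, hC⟩ := Mlem h (hJ hq)
    have hH : sp2 F a a' ≤ T0 := le_trans le_sup_right e
    have hT' : sl S (w :: R) ≤ T0 ⊓ prp h (sp2 F a a') :=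
      le_inf (le_trans le_sup_left e) (sl_prp h L.hS (hRH hq))
    have hRT : sl S R ≤ T0 ⊓ prp h (sp2 F a a') :=
      le_trans (sl_le.2 ⟨le_sl _ _, fun v hv => mem_sl (List.mem_cons_of_mem _ hv)⟩) hT'
    have hJ' : J h q (T0 ⊓ prp h (sp2 F a a')) := by
      obtain ⟨p, rfl⟩ : ∃ p, q = p + 1 := ⟨q - 1, by omega⟩
      exact ⟨a, a', ha, fun t ht => h.symm0 (mem_prp_sp2.1 ht.2).1,
        fun t ht => h.symm0 (mem_prp_sp2.1 ht.2).2, J_T h (sup_le inf_le_left hH) hJ0⟩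
    obtain ⟨κ', hκ', hd⟩ := hB hq _ _ hRT inf_le_right hJ' κ hκ
    refine ⟨_, hT', Cm_cut h hC ha (hH (mem_sp2l _ _)) (hH (mem_sp2r _ _)),
      fun _ => inf_le_right, κ', hκ', fun hh => ?_⟩
    have h3 := Br_le_Nul (L.lab_Br (fun v hv => hR v (List.mem_cons_of_mem _ hv))
      (fun v hv => hRH hq v (List.mem_cons_of_mem _ hv)) hd)
    rw [map_sub] at h3
    have := Submodule.add_mem _ h3 hh
    rwa [sub_add_cancel] at this

/-- nullity from faces -/
lemma of_faces {q : ℕ} {R : List V} {w : V}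
    (hR : ∀ v ∈ w :: R, v ∈ Oh) (hRH : 1 ≤ q → ∀ v ∈ w :: R, v ∈ prp h (sp2 F a a')) {κ}
    (hκ : κ ∈ ZZ ω (sp2 F a a') (sl S (w :: R)) q)
    (hf : preX [w] (dh (lab R κ)) ∈
      Nul (Fx ω S) (Fx ω (S ⊔ sp2 F a a')) Oh (Oh ∩ prp h (sp2 F a a')) R.length q) :
    lab R κ ∈ Nul (Fx ω S) (Fx ω (S ⊔ sp2 F a a')) Oh (Oh ∩ prp h (sp2 F a a')) R.length q := by
  have h1 := dh_mem_Nul (L.lab_Zr hR hRH hκ)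
  rw [dh_lab_cons] at h1
  have := Submodule.add_mem _ h1 hf
  rwa [sub_add_cancel] at this

/-- combined: null if for the new vector all faces are null -/
lemma of_null_faces {q : ℕ} (hB : 1 ≤ q → Bst h a a' q) {R : List V} {w : V}
    (hR : ∀ v ∈ w :: R, v ∈ Oh) (hRH : 1 ≤ q → ∀ v ∈ w :: R, v ∈ prp h (sp2 F a a'))
    (hJ : 1 ≤ q → J h (q - 1) (sl S (w :: R) ⊔ sp2 F a a')) {κ}
    (hκ : κ ∈ ZZ ω (sp2 F a a') (sl S R) q)
    (hf : ∀ A z C, R = A ++ z :: C → ∀ κ' ∈ ZZ ω (sp2 F a a') (sl S (w :: (A ++ C))) q,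
      lab (w :: (A ++ C)) κ' ∈
        Nul (Fx ω S) (Fx ω (S ⊔ sp2 F a a')) Oh (Oh ∩ prp h (sp2 F a a')) R.length q) :
    lab R κ ∈ Nul (Fx ω S) (Fx ω (S ⊔ sp2 F a a')) Oh (Oh ∩ prp h (sp2 F a a')) R.length q := by
  obtain ⟨T', h1, h2, h3, κ', hκ', h4⟩ := L.core hB hR hRH hJ hκ
  refine h4 (L.of_faces hR hRH (ZZ_mono h1 q hκ') ?_)
  refine faces_mem _ κ' R [w] fun A z C e => ?_
  refine hf A z C e κ' (ZZ_mono (le_trans (sl_le.2 ⟨le_sl _ _, ?_⟩) h1) q hκ')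
  intro v hv
  refine mem_sl ?_
  rw [e]
  simp only [List.mem_cons, List.mem_append] at hv ⊢
  tauto

/-- final step of the spectral sequence argument -/
lemma finish {q : ℕ} (hJ : ∀ v ∈ Oh, J h 1 (sl S [v])) (hne : ∃ v ∈ Oh, v ∈ prp h (sp2 F a a'))
    (HH : ∀ k q', 2 ≤ k → k + q' = q + 1 →
      Zr (Fx ω S) (Fx ω (S ⊔ sp2 F a a')) Oh (Oh ∩ prp h (sp2 F a a')) k q' ≤
      Nul (Fx ω S) (Fx ω (S ⊔ sp2 F a a')) Oh (Oh ∩ prp h (sp2 F a a')) k q')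
    (N : Submodule ℤ (BC (bilinIsoms F ω) (List V))) (hN : BB ω (sp2 F a a') S q ≤ N)
    (hv : ∀ v ∈ Oh, v ∈ prp h (sp2 F a a') → ∀ κ ∈ ZZ ω (sp2 F a a') (S ⊔ sp1 F v) q, κ ∈ N) :
    ZZ ω (sp2 F a a') S q ≤ N := by
  intro x hx
  obtain ⟨x1, x2⟩ := mem_Zr.1 hx
  obtain ⟨zs, z1, z2⟩ := hne
  have hO0 : ∀ {K : Subgroup (bilinIsoms F ω)} {O O' : Set V} {q}, sp K O 0 q ≤ sp K O' 0 q := by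
    intro K O O' q
    refine Finsupp.supported_mono fun p hp => ⟨hp.1, hp.2.1, hp.2.2.1, ?_⟩
    have : p.2 = [] := List.length_eq_zero_iff.1 hp.2.2.1
    rw [this]; simp
  obtain ⟨x', hx', hd⟩ := ss_lemma (O := Oh ∩ prp h (sp2 F a a')) L.stO L.st (Fx_anti le_sup_left)
    Set.inter_subset_left ⟨z1, z2⟩ q HH (mem_Zr.2 ⟨hO0 x1, hO0 x2⟩)
  have hd' : x - dh x' ∈ N := hN (sp_le_Br (hO0 hd))
  have : x' ∈ N.comap dh := by
    refine L.shap (k := 1) (fun _ => trivial) ?_ _ ?_ ?_ hx'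
    · intro R hR hRO
      obtain ⟨v, rfl⟩ := List.length_eq_one_iff.1 hR
      exact hJ v (hRO v (by simp))
    · intro c hc
      obtain ⟨s, hs, y, hy, rfl⟩ := mem_Br.1 hc
      rw [Submodule.mem_comap, map_add, dh_dv]
      exact hN (Submodule.add_mem _ (sp_le_Br (hO0 (dh_sp hs))) (dv_mem_Br (hO0 (dh_sp hy))))
    · intro R hR hRO κ hκ
      obtain ⟨v, rfl⟩ := List.length_eq_one_iff.1 hR
      have e0 : lab [] κ = κ := by
        have := eq_supp (lab []) LinearMap.id ?_ (mem_Zr.1 hκ).1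
        · simpa using this
        rintro ⟨l, x⟩ hp
        have : x = [] := List.length_eq_zero_iff.1 hp.2.2.1
        subst this
        rw [lab_single]; rfl
      rw [Submodule.mem_comap, dh_lab_cons, dh_lab_nil, map_zero, sub_zero, e0]
      have := hRO v (by simp)
      refine hv v this.1 this.2 κ (ZZ_mono (sup_le (le_sl _ _) (sp1_le.2 (mem_sl (by simp)))) q hκ)
  have := Submodule.add_mem _ hd' (Submodule.mem_comap.1 this)
  rwa [sub_add_cancel] at this

end Lset

end Infra

end UStab

namespace UStab

set_option linter.unusedSectionVars false
set_option linter.unusedVariables false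
set_option linter.unusedSimpArgs false

section BOne

variable {F V : Type} [Field F] [AddCommGroup V] [Module F V] {σ : F →+* F} {ω : V → V → F}

lemma Herm.third (h : Herm σ ω) (p q : F) : ∃ r, r ≠ p ∧ r ≠ q := by
  obtain ⟨t, ht⟩ := h.ne
  have t0 : t ≠ 0 := by rintro rfl; exact ht (map_zero σ)
  have t1 : t ≠ 1 := by rintro rfl; exact ht (map_one σ)
  by_cases e : p = q
  · exact ⟨p + 1, by simp, by rw [← e]; simp⟩
  · have e' : q - p ≠ 0 := sub_ne_zero.2 (Ne.symm e)
    refine ⟨p + t * (q - p), by simp [t0, e'], fun hh => t1 ?_⟩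
    have : (t - 1) * (q - p) = 0 := by linear_combination hh
    rcases mul_eq_zero.1 this with h1 | h1
    · exact sub_eq_zero.1 h1
    · exact absurd h1 e'

lemma sl_perm {S : Submodule F V} {R R' : List V} (e : R.Perm R') : sl S R = sl S R' := by
  unfold sl
  congr 2
  ext v
  exact e.mem_iff

lemma face_sub {w v z : V} {B C : List V} (hv : v ∈ w :: (B ++ C)) : v ∈ w :: (B ++ z :: C) := by
  simp only [List.mem_cons, List.mem_append] at hv ⊢; tauto

lemma face_in {w v z : V} {B C : List V} (hv : v ∈ B ++ z :: C) (hz : v ≠ z) :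
    v ∈ w :: (B ++ C) := by
  simp only [List.mem_cons, List.mem_append] at hv ⊢; tauto

/-- the set of vectors with the same projection and norm as `u` -/
def Ou (ω : V → V → F) (S : Submodule F V) (u : V) : Set V :=
  {v | (∀ s ∈ S, ω s v = ω s u) ∧ ω v v = ω u u}

/-- hypotheses for the surjectivity step -/
structure BDat (h : Herm σ ω) {a a' : V} (ha : Hyp ω a a') (S : Submodule F V) (u : V)
    (q : ℕ) : Prop where
  hS : S ≤ prp h (sp2 F a a')
  hu : u ∈ prp h (sp2 F a a')
  hN : ∀ v ∈ Ou ω S u, v ∉ S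
  hJ : ∀ v ∈ Ou ω S u, J h q (S ⊔ sp1 F v)

namespace BDat

variable {h : Herm σ ω} {a a' : V} {ha : Hyp ω a a'} {S : Submodule F V} {u : V} {q : ℕ}
variable (D : BDat h ha S u q)
include D

lemma lset : Lset h ha S (Ou ω S u) := ⟨D.hS, fun g hg v hv => ⟨fun s hs => by
  have := g_isom (ω := ω) g s v
  rw [hg s hs] at this
  rw [this]; exact hv.1 s hs, by rw [g_isom (ω := ω) g _ _]; exact hv.2⟩⟩

lemma csym : σ (ω u u) = ω u u := h.nsym u

lemma flip {x y : V} (e : ω x y = ω u u) : ω y x = ω u u := by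
  rw [← h.conj, e, h.nsym]

lemma good {R : List V} (hR : ∀ v ∈ R, v ∈ Ou ω S u) {q' : ℕ} (hq : R.length + q' = q + 1)
    {x y d : V} (hx : x ∈ R) (hy : y ∈ R) (hd : d ∈ R) (hxy : ω x y = ω u u)
    (hne : ω x d ≠ ω y d) : J h (q' + 1) (sl S R) := by
  classical
  have hyx : ω y x = ω u u := D.flip hxy
  have yx : y ≠ x := by rintro rfl; exact hne rfl
  have dx : d ≠ x := by rintro rfl; exact hne (by rw [(hR _ hx).2, hyx])
  have dy : d ≠ y := by rintro rfl; exact hne (by rw [(hR _ hy).2, hxy])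
  have p1 := List.perm_cons_erase hx
  have hy' : y ∈ R.erase x := (List.mem_erase_of_ne yx).2 hy
  have p2 := List.perm_cons_erase hy'
  have hd' : d ∈ (R.erase x).erase y :=
    (List.mem_erase_of_ne dy).2 ((List.mem_erase_of_ne dx).2 hd)
  have p3 := List.perm_cons_erase hd'
  generalize ((R.erase x).erase y).erase d = rest at p3
  have p : R.Perm (x :: y :: d :: rest) :=
    p1.trans ((p2.trans (p3.cons y)).cons x)
  have hl := p.length_eq
  simp only [List.length_cons] at hl
  obtain ⟨m, rfl⟩ : ∃ m, q = m + 1 := ⟨q - 1, by omega⟩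
  have j1 := D1 h (D.hJ x (hR x hx)) y
  have j2 : J h m (S ⊔ sp1 F x ⊔ sp1 F y ⊔ sp1 F d) := by
    refine D2 h j1 (e := x - y) ?_ ?_ ?_
    · exact sub_mem (le_sup_left (b := sp1 F y) (le_sup_right (a := S) (mem_sp1 x)))
        (le_sup_right (a := S ⊔ sp1 F x) (mem_sp1 y))
    · refine sup_le_prp (sup_le_prp ?_ (mem_prp_sp1.2 ?_)) (mem_prp_sp1.2 ?_)
      · intro s hs; rw [h.subr, (hR x hx).1 s hs, (hR y hy).1 s hs, sub_self]
      · rw [h.subr, (hR x hx).2, hxy, sub_self]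
      · rw [h.subr, (hR y hy).2, hyx, sub_self]
    · rw [h.subl]; exact sub_ne_zero.2 hne
  have j3 := D1l h (m := q' + 1) rest (J_le h (by omega) j2)
  refine J_T h ?_ j3
  rw [sl_perm p]
  refine sl_le.2 ⟨le_trans (le_trans (le_trans le_sup_left le_sup_left) le_sup_left) (le_sl _ _), ?_⟩
  intro v hv
  rcases List.mem_cons.1 hv with rfl | hv
  · exact le_sl _ _ (le_sup_left (b := sp1 F d) (le_sup_left (b := sp1 F y)
      (le_sup_right (a := S) (mem_sp1 v))))
  rcases List.mem_cons.1 hv with rfl | hv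
  · exact le_sl _ _ (le_sup_left (b := sp1 F d) (le_sup_right (a := S ⊔ sp1 F x) (mem_sp1 v)))
  rcases List.mem_cons.1 hv with rfl | hv
  · exact le_sl _ _ (le_sup_right (a := S ⊔ sp1 F x ⊔ sp1 F y) (mem_sp1 v))
  exact mem_sl hv

lemma dep2 {R rest : List V} (hR : ∀ v ∈ R, v ∈ Ou ω S u) {q' : ℕ} (hq : R.length + q' = q + 1)
    {x y : V} (p : R.Perm (x :: y :: rest)) (hy : y ∈ S ⊔ sp1 F x) : J h (q' + 1) (sl S R) := by
  have hl := p.length_eq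
  simp only [List.length_cons] at hl
  have j3 := D1l h (m := q' + 1) rest (J_le h (by omega) (D.hJ x (hR x (p.mem_iff.2 (by simp)))))
  refine J_T h ?_ j3
  rw [sl_perm p]
  refine sl_le.2 ⟨le_trans le_sup_left (le_sl _ _), ?_⟩
  intro v hv
  rcases List.mem_cons.1 hv with rfl | hv
  · exact le_sl _ _ (le_sup_right (a := S) (mem_sp1 v))
  rcases List.mem_cons.1 hv with rfl | hv
  · exact le_sl _ _ hy
  exact mem_sl hv

lemma dep3 {R rest : List V} (hR : ∀ v ∈ R, v ∈ Ou ω S u) {q' : ℕ} (hq : R.length + q' = q + 1)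
    {x y d : V} (p : R.Perm (x :: y :: d :: rest)) (hd : d ∈ S ⊔ sp1 F x ⊔ sp1 F y) :
    J h (q' + 1) (sl S R) := by
  have hl := p.length_eq
  simp only [List.length_cons] at hl
  obtain ⟨m, rfl⟩ : ∃ m, q = m + 1 := ⟨q - 1, by omega⟩
  have j3 := D1l h (m := q' + 1) rest (J_le h (by omega)
    (D1 h (D.hJ x (hR x (p.mem_iff.2 (by simp)))) y))
  refine J_T h ?_ j3
  rw [sl_perm p]
  refine sl_le.2 ⟨le_trans (le_trans le_sup_left le_sup_left) (le_sl _ _), ?_⟩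
  intro v hv
  rcases List.mem_cons.1 hv with rfl | hv
  · exact le_sl _ _ (le_sup_left (b := sp1 F y) (le_sup_right (a := S) (mem_sp1 v)))
  rcases List.mem_cons.1 hv with rfl | hv
  · exact le_sl _ _ (le_sup_right (a := S ⊔ sp1 F x) (mem_sp1 v))
  rcases List.mem_cons.1 hv with rfl | hv
  · exact le_sl _ _ hd
  exact mem_sl hv

set_option maxHeartbeats 400000 in
/-- lists of length at least three -/
lemma k3 {R rest : List V} (hR : ∀ v ∈ R, v ∈ Ou ω S u) {q' : ℕ} (hq : R.length + q' = q + 1)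
    (hRs : 1 ≤ q' → Rst h a a' q') (hBs : 1 ≤ q' → Bst h a a' q')
    (hRH : 1 ≤ q' → ∀ v ∈ R, v ∈ prp h (sp2 F a a'))
    {x y d : V} (p : R.Perm (x :: y :: d :: rest)) {βy βd : F} (hβ : βy ≠ ω x y)
    (hg : ∀ w, w ∈ Ou ω S u → ω w x = ω u u → ω w y = βy → ω w d = βd →
      ∀ R' : List V, (∀ v ∈ R', v ∈ Ou ω S u) → R'.length + q' = q + 1 → w ∈ R' →
      ((x ∈ R' ∧ y ∈ R') ∨ (x ∈ R' ∧ d ∈ R') ∨ (y ∈ R' ∧ d ∈ R')) → J h (q' + 1) (sl S R'))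
    {κ} (hκ : κ ∈ ZZ ω (sp2 F a a') (sl S R) q') :
    lab R κ ∈ Nul (Fx ω S) (Fx ω (S ⊔ sp2 F a a')) (Ou ω S u) (Ou ω S u ∩ prp h (sp2 F a a'))
      R.length q' := by
  classical
  have L := D.lset
  have hl := p.length_eq
  simp only [List.length_cons] at hl
  have xR : x ∈ R := p.mem_iff.2 (by simp)
  have yR : y ∈ R := p.mem_iff.2 (by simp)
  have dR : d ∈ R := p.mem_iff.2 (by simp)
  by_cases i1 : y ∈ S ⊔ sp1 F x
  · exact L.null hRs hR hRH (D.dep2 hR hq p i1) hκ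
  by_cases i2 : d ∈ S ⊔ sp1 F x ⊔ sp1 F y
  · exact L.null hRs hR hRH (D.dep3 hR hq p i2) hκ
  have nyx : y ≠ x := fun e => i1 (by rw [e]; exact le_sup_right (a := S) (mem_sp1 x))
  have ndx : d ≠ x := fun e => i2 (by
    rw [e]; exact le_sup_left (b := sp1 F y) (le_sup_right (a := S) (mem_sp1 x)))
  have ndy : d ≠ y := fun e => i2 (by
    rw [e]; exact le_sup_right (a := S ⊔ sp1 F x) (mem_sp1 y))
  have hx := hR x xR
  obtain ⟨A, a1, a2, a3, a4, a5⟩ : ∃ A, S ⊔ sp1 F x ≤ A ∧ J h 2 A ∧ y ∉ A ∧ d ∉ A ⊔ sp1 F y ∧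
      (1 ≤ q' → sp2 F a a' ≤ A ∧ J h (q - 1) A) := by
    rcases Nat.eq_zero_or_pos q' with rfl | hq'
    · exact ⟨_, le_rfl, J_le h (by omega) (D.hJ x hx), i1, i2, by simp⟩
    · have hA : S ⊔ sp1 F x ≤ prp h (sp2 F a a') := sup_le D.hS (sp1_le.2 (hRH hq' x xR))
      have hA' := le_prp_comm hA
      have hJ' : J h (q - 1) (S ⊔ sp1 F x ⊔ sp2 F a a') := by
        obtain ⟨m, rfl⟩ : ∃ m, q = m + 1 := ⟨q - 1, by omega⟩
        exact Cancel h (D.hJ x hx) ha (hA' (mem_sp2l _ _)) (hA' (mem_sp2r _ _))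
      refine ⟨S ⊔ sp1 F x ⊔ sp2 F a a', le_sup_left, J_le h (by omega) hJ', ?_, ?_,
        fun _ => ⟨le_sup_right, hJ'⟩⟩
      · exact fun hh => i1 (indepH h ha hA (hRH hq' y yR) hh)
      · intro hh
        rw [sup_right_comm] at hh
        exact i2 (indepH h ha (sup_le hA (sp1_le.2 (hRH hq' y yR))) (hRH hq' d dR) hh)
  have hxA : x ∈ A := a1 (le_sup_right (a := S) (mem_sp1 x))
  obtain ⟨ε, e1, e2, e3, e4⟩ := Eps2 h a2 a3 a4 (γ := βy - ω x y) (sub_ne_zero.2 hβ) (βd - ω x d)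
  have xe : ω x ε = 0 := e2 x hxA
  have ex : ω ε x = 0 := h.symm0 xe
  have hw : x + ε ∈ Ou ω S u := by
    refine ⟨fun s hs => ?_, ?_⟩
    · rw [h.addr, e2 s (a1 (le_sup_left (b := sp1 F x) hs)), add_zero, hx.1 s hs]
    · rw [h.addr, h.addl, h.addl, e1, xe, ex, hx.2]; ring
  have hwx : ω (x + ε) x = ω u u := by rw [h.addl, ex, hx.2, add_zero]
  have hwy : ω (x + ε) y = βy := by rw [h.addl, e3]; ring
  have hwd : ω (x + ε) d = βd := by rw [h.addl, e4]; ring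
  have hwH : 1 ≤ q' → x + ε ∈ prp h (sp2 F a a') := fun hq' =>
    add_mem (hRH hq' x xR) (prp_anti (a5 hq').1 e2)
  have hcons : ∀ v ∈ (x + ε) :: R, v ∈ Ou ω S u := by
    intro v hv
    rcases List.mem_cons.1 hv with rfl | hv
    · exact hw
    · exact hR v hv
  have hconsH : 1 ≤ q' → ∀ v ∈ (x + ε) :: R, v ∈ prp h (sp2 F a a') := by
    intro hq' v hv
    rcases List.mem_cons.1 hv with rfl | hv
    · exact hwH hq'
    · exact hRH hq' v hv
  refine L.of_null_faces hBs hcons hconsH ?_ hκ ?_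
  · intro hq'
    obtain ⟨m, rfl⟩ : ∃ m, q = m + 2 := ⟨q - 2, by omega⟩
    have j1 : J h m (A ⊔ sp1 F ε ⊔ sp1 F y) :=
      EpsJ h (a5 hq').2 e1 e2 (by rw [e3]; exact sub_ne_zero.2 hβ)
    have j2 := D1l h (m := q' - 1) (d :: rest) (J_le h (by simp only [List.length_cons]; omega) j1)
    refine J_T h ?_ j2
    have hAle : A ≤ A ⊔ sp1 F ε ⊔ sp1 F y := le_trans le_sup_left le_sup_left
    refine sup_le (sl_le.2 ⟨?_, ?_⟩) (le_trans (le_trans (a5 hq').1 hAle) (le_sl _ _))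
    · exact le_trans (le_trans (le_trans le_sup_left a1) hAle) (le_sl _ _)
    · intro v hv
      have hx' := le_sl (A ⊔ sp1 F ε ⊔ sp1 F y) (d :: rest) (hAle hxA)
      rcases List.mem_cons.1 hv with rfl | hv
      · exact add_mem hx' (le_sl _ _ (le_sup_left (b := sp1 F y)
          (le_sup_right (a := A) (mem_sp1 ε))))
      rcases List.mem_cons.1 (p.mem_iff.1 hv) with rfl | hv
      · exact hx'
      rcases List.mem_cons.1 hv with rfl | hv
      · exact le_sl _ _ (le_sup_right (a := A ⊔ sp1 F ε) (mem_sp1 v))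
      · exact mem_sl hv
  · intro B z C e κ' hκ'
    have hlen : ((x + ε) :: (B ++ C)).length = R.length := by
      rw [e]; simp; omega
    have hsub : ∀ v ∈ (x + ε) :: (B ++ C), v ∈ (x + ε) :: R := by
      intro v hv
      rw [e]; exact face_sub hv
    have hin : ∀ v ∈ R, v ≠ z → v ∈ (x + ε) :: (B ++ C) := by
      intro v hv hvz
      rw [e] at hv; exact face_in hv hvz
    have hJ' := hg _ hw hwx hwy hwd ((x + ε) :: (B ++ C)) (fun v hv => hcons v (hsub v hv))
      (by rw [hlen]; exact hq) (by simp) (by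
        by_cases z1 : x = z
        · right; right
          rw [← z1] at hin; exact ⟨hin y yR nyx, hin d dR ndx⟩
        by_cases z2 : y = z
        · right; left
          exact ⟨hin x xR z1, hin d dR (by rw [← z2]; exact ndy)⟩
        · left; exact ⟨hin x xR z1, hin y yR z2⟩)
    have := L.null hRs (fun v hv => hcons v (hsub v hv)) (fun hq' v hv => hconsH hq' v (hsub v hv))
      hJ' hκ'
    rwa [hlen] at this

lemma caseA {R rest : List V} (hR : ∀ v ∈ R, v ∈ Ou ω S u) {q' : ℕ} (hq : R.length + q' = q + 1)
    (hRs : 1 ≤ q' → Rst h a a' q') (hBs : 1 ≤ q' → Bst h a a' q')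
    (hRH : 1 ≤ q' → ∀ v ∈ R, v ∈ prp h (sp2 F a a'))
    {x y d : V} (p : R.Perm (x :: y :: d :: rest)) (hxy : ω x y ≠ ω u u)
    {κ} (hκ : κ ∈ ZZ ω (sp2 F a a') (sl S R) q') :
    lab R κ ∈ Nul (Fx ω S) (Fx ω (S ⊔ sp2 F a a')) (Ou ω S u) (Ou ω S u ∩ prp h (sp2 F a a'))
      R.length q' := by
  obtain ⟨β, b1, b2⟩ := h.third (ω x d) (ω y d)
  refine D.k3 hR hq hRs hBs hRH p (βy := ω u u) (βd := β) (Ne.symm hxy) ?_ hκ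
  rintro w hw w1 w2 w3 R' hR' hq' hwR (⟨m1, m2⟩ | ⟨m1, m2⟩ | ⟨m1, m2⟩)
  · exact D.good hR' hq' hwR m1 m2 w1 (by rw [w2]; exact Ne.symm hxy)
  · exact D.good hR' hq' hwR m1 m2 w1 (by rw [w3]; exact b1)
  · exact D.good hR' hq' hwR m1 m2 w2 (by rw [w3]; exact b2)

lemma caseB {R rest : List V} (hR : ∀ v ∈ R, v ∈ Ou ω S u) {q' : ℕ} (hq : R.length + q' = q + 1)
    (hRs : 1 ≤ q' → Rst h a a' q') (hBs : 1 ≤ q' → Bst h a a' q')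
    (hRH : 1 ≤ q' → ∀ v ∈ R, v ∈ prp h (sp2 F a a'))
    {x y d : V} (p : R.Perm (x :: y :: d :: rest)) (hxy : ω x y = ω u u) (hxd : ω x d = ω u u)
    (hyd : ω y d = ω u u)
    {κ} (hκ : κ ∈ ZZ ω (sp2 F a a') (sl S R) q') :
    lab R κ ∈ Nul (Fx ω S) (Fx ω (S ⊔ sp2 F a a')) (Ou ω S u) (Ou ω S u ∩ prp h (sp2 F a a'))
      R.length q' := by
  obtain ⟨β, b1, b2⟩ := h.third (ω u u) (ω u u + 1)
  have n1 : ω u u + 1 ≠ ω u u := by simp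
  refine D.k3 hR hq hRs hBs hRH p (βy := ω u u + 1) (βd := β) (by rw [hxy]; exact n1) ?_ hκ
  rintro w hw w1 w2 w3 R' hR' hq' hwR (⟨m1, m2⟩ | ⟨m1, m2⟩ | ⟨m1, m2⟩)
  · exact D.good hR' hq' hwR m1 m2 w1 (by rw [w2, hxy]; exact n1)
  · exact D.good hR' hq' hwR m1 m2 w1 (by rw [w3, hxd]; exact b1)
  · refine D.good hR' hq' m1 m2 hwR hyd ?_
    rw [← h.conj w y, ← h.conj w d, w2, w3]
    intro e
    exact b2 (σ.injective e).symm

lemma kge3 {R : List V} (hR : ∀ v ∈ R, v ∈ Ou ω S u) {q' : ℕ} (hq : R.length + q' = q + 1)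
    (hk : 3 ≤ R.length)
    (hRs : 1 ≤ q' → Rst h a a' q') (hBs : 1 ≤ q' → Bst h a a' q')
    (hRH : 1 ≤ q' → ∀ v ∈ R, v ∈ prp h (sp2 F a a'))
    {κ} (hκ : κ ∈ ZZ ω (sp2 F a a') (sl S R) q') :
    lab R κ ∈ Nul (Fx ω S) (Fx ω (S ⊔ sp2 F a a')) (Ou ω S u) (Ou ω S u ∩ prp h (sp2 F a a'))
      R.length q' := by
  obtain ⟨x, y, d, rest, rfl⟩ : ∃ x y d rest, R = x :: y :: d :: rest := by
    match R, hk with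
    | x :: y :: d :: rest, _ => exact ⟨x, y, d, rest, rfl⟩
  by_cases e1 : ω x y = ω u u
  · by_cases e2 : ω x d = ω u u
    · by_cases e3 : ω y d = ω u u
      · exact D.caseB hR hq hRs hBs hRH (List.Perm.refl _) e1 e2 e3 hκ
      · exact D.caseA hR hq hRs hBs hRH (x := y) (y := d) (d := x) (rest := rest)
          ((List.Perm.swap y x (d :: rest)).trans ((List.Perm.swap d x rest).cons y)) e3 hκ
    · exact D.caseA hR hq hRs hBs hRH (x := x) (y := d) (d := y) (rest := rest)
          ((List.Perm.swap d y rest).cons x) e2 hκ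
  · exact D.caseA hR hq hRs hBs hRH (List.Perm.refl _) e1 hκ

end BDat

end BOne

end UStab

namespace UStab

set_option linter.unusedSectionVars false
set_option linter.unusedVariables false
set_option linter.unusedSimpArgs false

section BTwo

variable {F V : Type} [Field F] [AddCommGroup V] [Module F V] {σ : F →+* F} {ω : V → V → F}

lemma pair_face {x y z : V} {B C : List V} (e : [x, y] = B ++ z :: C) :
    B ++ C = [y] ∨ B ++ C = [x] := by
  match B, e with
  | [], e => left; simp at e; simp [e.2]
  | [b], e => right; simp at e; simp [e]
  | b :: b' :: B, e => simp at e

lemma Cm_disj (h : Herm σ ω) {T : Submodule F V} (hT : Cm h T) {p : V} (h1 : p ∈ T)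
    (h2 : p ∈ prp h T) : p = 0 := by
  refine h.nondeg fun v => ?_
  obtain ⟨b, hb, hv⟩ := hT v
  have e : v = b + (v - b) := by abel
  rw [e, h.addr, h.symm0 (h2 b hb), hv p h1, add_zero]

namespace BDat

variable {h : Herm σ ω} {a a' : V} {ha : Hyp ω a a'} {S : Submodule F V} {u : V} {q : ℕ}
variable (D : BDat h ha S u q)
include D

lemma notin {w v v' : V} (hw : w ∈ Ou ω S u) (hv : v ∈ Ou ω S u) (hv' : v' ∈ Ou ω S u)
    (hwv : ω w v = ω u u) (hne : ω (w - v) v' ≠ 0) : v ∉ S ⊔ sp1 F w := by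
  intro hmem
  obtain ⟨s, hs, b, hb, e⟩ := Submodule.mem_sup.1 hmem
  obtain ⟨α, rfl⟩ := Submodule.mem_span_singleton.1 hb
  have hvw : ω v w = ω u u := D.flip hwv
  by_cases hα : α = 1
  · have e2 : w - v = -s := by rw [← e, hα, one_smul]; abel
    refine hne ?_
    have : ω (w - v) v' = ω (w - v) v := by
      rw [e2, h.negl, h.negl, hv'.1 s hs, hv.1 s hs]
    rw [this, h.subl, hwv, hv.2, sub_self]
  · have hα' : 1 - α ≠ 0 := sub_ne_zero.2 (Ne.symm hα)
    have e3 : (1 - α)⁻¹ • s = w - (1 - α)⁻¹ • (w - v) := by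
      have hs' : s = v - α • w := by rw [← e]; abel
      have : (1 - α)⁻¹ • (w - v) = w - (1 - α)⁻¹ • s := by
        have h4 : w - v = (1 - α) • w - s := by rw [hs', sub_smul, one_smul]; abel
        rw [h4, smul_sub, smul_smul, inv_mul_cancel₀ hα', one_smul]
      rw [this]; abel
    refine D.hN ((1 - α)⁻¹ • s) ⟨fun s' hs' => ?_, ?_⟩ (Submodule.smul_mem _ _ hs)
    · rw [e3, h.subr, h.smulr, h.subr, hw.1 s' hs', hv.1 s' hs']; ring
    · rw [e3]
      simp only [h.subr, h.subl, h.smulr, h.smull, hw.2, hv.2, hwv, hvw]; ring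

set_option maxHeartbeats 400000 in
lemma step1 {q' : ℕ} (hq : q' + 1 = q) {u1 u2 : V}
    (hR : ∀ v ∈ [u1, u2], v ∈ Ou ω S u)
    (hRs : 1 ≤ q' → Rst h a a' q') (hBs : 1 ≤ q' → Bst h a a' q')
    (hRH : 1 ≤ q' → ∀ v ∈ [u1, u2], v ∈ prp h (sp2 F a a')) (hne : ω u1 u2 ≠ ω u u)
    {κ} (hκ : κ ∈ ZZ ω (sp2 F a a') (sl S [u1, u2]) q') :
    lab [u1, u2] κ ∈ Nul (Fx ω S) (Fx ω (S ⊔ sp2 F a a')) (Ou ω S u)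
      (Ou ω S u ∩ prp h (sp2 F a a')) [u1, u2].length q' := by
  subst hq
  have L := D.lset
  have h1 : u1 ∈ Ou ω S u := hR u1 (by simp)
  have h2 : u2 ∈ Ou ω S u := hR u2 (by simp)
  by_cases i1 : u2 ∈ S ⊔ sp1 F u1
  · exact L.null hRs hR hRH (D.dep2 hR (by simp; omega) (List.Perm.refl _) i1) hκ
  obtain ⟨A, a1, a2, a3, a5⟩ : ∃ A, S ⊔ sp1 F u1 ≤ A ∧ J h 1 A ∧ u2 ∉ A ∧
      (1 ≤ q' → sp2 F a a' ≤ A ∧ J h q' A) := by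
    rcases Nat.eq_zero_or_pos q' with rfl | hq'
    · exact ⟨_, le_rfl, D.hJ u1 h1, i1, by simp⟩
    · have hA : S ⊔ sp1 F u1 ≤ prp h (sp2 F a a') := sup_le D.hS (sp1_le.2 (hRH hq' u1 (by simp)))
      have hA' := le_prp_comm hA
      have hJ' : J h q' (S ⊔ sp1 F u1 ⊔ sp2 F a a') :=
        Cancel h (D.hJ u1 h1) ha (hA' (mem_sp2l _ _)) (hA' (mem_sp2r _ _))
      refine ⟨S ⊔ sp1 F u1 ⊔ sp2 F a a', le_sup_left, J_le h hq' hJ', ?_,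
        fun _ => ⟨le_sup_right, hJ'⟩⟩
      exact fun hh => i1 (indepH h ha hA (hRH hq' u2 (by simp)) hh)
  have hxA : u1 ∈ A := a1 (le_sup_right (a := S) (mem_sp1 u1))
  have hγ : ω u u - ω u1 u2 ≠ 0 := sub_ne_zero.2 (Ne.symm hne)
  obtain ⟨ε, e1, e2, e3⟩ := Eps1 h a2 a3 (ω u u - ω u1 u2)
  have xe : ω u1 ε = 0 := e2 u1 hxA
  have ex : ω ε u1 = 0 := h.symm0 xe
  obtain ⟨w, hwdef⟩ : ∃ w, w = u1 + ε := ⟨_, rfl⟩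
  have hw : w ∈ Ou ω S u := by
    rw [hwdef]
    refine ⟨fun s hs => ?_, ?_⟩
    · rw [h.addr, e2 s (a1 (le_sup_left (b := sp1 F u1) hs)), add_zero, h1.1 s hs]
    · rw [h.addr, h.addl, h.addl, e1, xe, ex, h1.2]; ring
  have hw1 : ω w u1 = ω u u := by rw [hwdef, h.addl, ex, h1.2, add_zero]
  have hw2 : ω w u2 = ω u u := by rw [hwdef, h.addl, e3]; ring
  have hcons : ∀ v ∈ w :: [u1, u2], v ∈ Ou ω S u := by
    intro v hv
    rcases List.mem_cons.1 hv with hv | hv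
    · rw [hv]; exact hw
    · exact hR v hv
  have hconsH : 1 ≤ q' → ∀ v ∈ w :: [u1, u2], v ∈ prp h (sp2 F a a') := by
    intro hq' v hv
    rcases List.mem_cons.1 hv with hv | hv
    · rw [hv, hwdef]; exact add_mem (hRH hq' u1 (by simp)) (prp_anti (a5 hq').1 e2)
    · exact hRH hq' v hv
  have hJw : 1 ≤ q' → J h (q' - 1) (sl S (w :: [u1, u2]) ⊔ sp2 F a a') := by
    intro hq'
    obtain ⟨m, rfl⟩ : ∃ m, q' = m + 1 := ⟨q' - 1, by omega⟩
    have j1 : J h m (A ⊔ sp1 F ε ⊔ sp1 F u2) :=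
      EpsJ h (a5 hq').2 e1 e2 (by rw [e3]; exact hγ)
    refine J_T h ?_ j1
    have hAle : A ≤ A ⊔ sp1 F ε ⊔ sp1 F u2 := le_trans le_sup_left le_sup_left
    refine sup_le (sl_le.2 ⟨?_, ?_⟩) (le_trans (a5 hq').1 hAle)
    · exact le_trans (le_trans le_sup_left a1) hAle
    · intro v hv
      rcases List.mem_cons.1 hv with hv | hv
      · rw [hv, hwdef]
        exact add_mem (hAle hxA) (le_sup_left (b := sp1 F u2)
          (le_sup_right (a := A) (mem_sp1 ε)))
      rcases List.mem_cons.1 hv with hv | hv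
      · rw [hv]; exact hAle hxA
      · rw [List.mem_singleton.1 hv]; exact le_sup_right (a := A ⊔ sp1 F ε) (mem_sp1 u2)
  obtain ⟨T', t1, t2, t3, κ', hκ', t4⟩ := L.core hBs hcons hconsH hJw hκ
  refine t4 (L.of_faces hcons hconsH (ZZ_mono t1 q' hκ') ?_)
  have wT : w ∈ T' := t1 (mem_sl (by simp))
  have u1T : u1 ∈ T' := t1 (mem_sl (by simp))
  have u2T : u2 ∈ T' := t1 (mem_sl (by simp))
  have ST : S ≤ T' := le_trans (le_sl _ _) t1
  have red : ∀ v ∈ T', v ∈ S ⊔ prp h T' ⊔ sp1 F w → v ∈ S ⊔ sp1 F w := by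
    intro v hv hh
    rw [sup_right_comm] at hh
    obtain ⟨b, hb, p, hp, rfl⟩ := Submodule.mem_sup.1 hh
    have hbT : b ∈ T' := sup_le ST (sp1_le.2 wT) hb
    have hpT : p ∈ T' := by
      have := sub_mem hv hbT; rwa [add_sub_cancel_left] at this
    rw [Cm_disj h t2 hpT hp, add_zero]; exact hb
  have n1 : u1 ∉ S ⊔ prp h T' ⊔ sp1 F w := fun hh =>
    D.notin hw h1 h2 hw1 (by rw [h.subl, hw2]; exact hγ) (red u1 u1T hh)
  have n2 : u2 ∉ S ⊔ prp h T' ⊔ sp1 F w := fun hh =>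
    D.notin hw h2 h1 hw2 (by
      rw [h.subl, hw1]
      intro e
      exact hne (D.flip (sub_eq_zero.1 e).symm)) (red u2 u2T hh)
  obtain ⟨g, hg, hgu⟩ := witt1 h n1 n2 (by
    intro t ht
    obtain ⟨b, hb, p, hp, rfl⟩ := Submodule.mem_sup.1 ht
    obtain ⟨s, hs, r, hr, rfl⟩ := Submodule.mem_sup.1 hb
    obtain ⟨c, rfl⟩ := Submodule.mem_span_singleton.1 hp
    simp only [h.addl, h.smull, h1.1 s hs, h2.1 s hs, h.symm0 (hr u1 u1T), h.symm0 (hr u2 u2T),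
      hw1, hw2]) (by rw [h1.2, h2.2])
  have hgS : g ∈ Fx ω S := Fx_anti (le_trans le_sup_left le_sup_left) hg
  have hgT : g ∈ Fx ω (prp h T') := Fx_anti (le_trans le_sup_right le_sup_left) hg
  have hgw : g • w = w := hg w (le_sup_right (a := S ⊔ prp h T') (mem_sp1 w))
  have hz1 : ∀ v ∈ [w, u1], v ∈ Ou ω S u := fun v hv => by
    rcases List.mem_cons.1 hv with hv | hv
    · rw [hv]; exact hw
    · rw [List.mem_singleton.1 hv]; exact h1
  have hz2 : 1 ≤ q' → ∀ v ∈ [w, u1], v ∈ prp h (sp2 F a a') := fun hq' v hv => by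
    rcases List.mem_cons.1 hv with hv | hv
    · rw [hv]; exact hconsH hq' w (by simp)
    · rw [List.mem_singleton.1 hv]; exact hRH hq' u1 (by simp)
  have hz : lab [w, u1] κ' ∈ Zr (Fx ω S) (Fx ω (S ⊔ sp2 F a a')) (Ou ω S u)
      (Ou ω S u ∩ prp h (sp2 F a a')) 2 q' := by
    refine L.lab_Zr hz1 hz2 (ZZ_mono ?_ q' hκ')
    refine sl_le.2 ⟨ST, fun v hv => ?_⟩
    rcases List.mem_cons.1 hv with hv | hv
    · rw [hv]; exact wT
    · rw [List.mem_singleton.1 hv]; exact u1T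
  have key : lab [w, u1] κ' - cj g (lab [w, u1] κ') ∈ Br (Fx ω S) (Fx ω (S ⊔ sp2 F a a'))
      (Ou ω S u) (Ou ω S u ∩ prp h (sp2 F a a')) 2 q' := by
    refine cj_Br L.st hgS (mem_Zr.1 hz).1 ?_
    rcases Nat.eq_zero_or_pos q' with rfl | hq'
    · rw [dv_zero (mem_Zr.1 hz).1, map_zero]; exact Submodule.zero_mem _
    · exact hc_dv_sp L.stO (mem_Fx_sup hgS (Fx_anti (le_prp_comm (t3 hq')) hgT)) hz
  have e5 : cj g (lab [w, u1] κ') = lab [w, u2] κ' := by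
    rw [cj_lab (fun k hk => comm_Fx h t2 hgT hk) (mem_Zr.1 hκ').1 [w, u1], smul_cons, smul_cons,
      hgw, hgu]
    rfl
  rw [e5] at key
  have e6 : preX [w] (dh (lab [u1, u2] κ')) = lab [w, u2] κ' - lab [w, u1] κ' := by
    rw [dh_lab_cons, dh_lab_cons, dh_lab_nil, map_zero, sub_zero, preX_lab, map_sub, preX_lab,
      preX_lab]
    rfl
  rw [e6, ← neg_sub]
  exact Submodule.neg_mem _ (Br_le_Nul key)

set_option maxHeartbeats 400000 in
lemma step2 {q' : ℕ} (hq : q' + 1 = q) {u1 u2 : V}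
    (hR : ∀ v ∈ [u1, u2], v ∈ Ou ω S u)
    (hRs : 1 ≤ q' → Rst h a a' q') (hBs : 1 ≤ q' → Bst h a a' q')
    (hRH : 1 ≤ q' → ∀ v ∈ [u1, u2], v ∈ prp h (sp2 F a a')) (heq : ω u1 u2 = ω u u)
    {κ} (hκ : κ ∈ ZZ ω (sp2 F a a') (sl S [u1, u2]) q') :
    lab [u1, u2] κ ∈ Nul (Fx ω S) (Fx ω (S ⊔ sp2 F a a')) (Ou ω S u)
      (Ou ω S u ∩ prp h (sp2 F a a')) [u1, u2].length q' := by
  subst hq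
  have L := D.lset
  have h1 : u1 ∈ Ou ω S u := hR u1 (by simp)
  have h2 : u2 ∈ Ou ω S u := hR u2 (by simp)
  have heq' : ω u2 u1 = ω u u := D.flip heq
  by_cases i1 : u2 ∈ S ⊔ sp1 F u1
  · exact L.null hRs hR hRH (D.dep2 hR (by simp; omega) (List.Perm.refl _) i1) hκ
  have i0 := D.hN u1 h1
  obtain ⟨B, b1, b2, b3, b4⟩ : ∃ B, S ≤ B ∧ u1 ∉ B ∧ u2 ∉ B ⊔ sp1 F u1 ∧
      (1 ≤ q' → sp2 F a a' ≤ B) := by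
    rcases Nat.eq_zero_or_pos q' with rfl | hq'
    · exact ⟨S, le_rfl, i0, i1, by simp⟩
    · refine ⟨S ⊔ sp2 F a a', le_sup_left, ?_, ?_, fun _ => le_sup_right⟩
      · exact fun hh => i0 (indepH h ha D.hS (hRH hq' u1 (by simp)) hh)
      · intro hh
        rw [sup_right_comm] at hh
        exact i1 (indepH h ha (sup_le D.hS (sp1_le.2 (hRH hq' u1 (by simp))))
          (hRH hq' u2 (by simp)) hh)
  obtain ⟨t1, p1, p2⟩ := h.dual b2
  obtain ⟨t2, r1, r2⟩ := h.dual b3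
  obtain ⟨θ, th0, th1⟩ := h.third 0 1
  have r1' : ω t2 u1 = 0 := r1 u1 (le_sup_right (a := B) (mem_sp1 u1))
  obtain ⟨τ, hτ⟩ : ∃ τ, τ = t1 + σ (θ - ω t1 u2) • t2 := ⟨_, rfl⟩
  have τB : ∀ b ∈ B, ω τ b = 0 := by
    intro b hb
    rw [hτ, h.addl, h.smull, p1 b hb, r1 b (le_sup_left (b := sp1 F u1) hb)]; ring
  have τ1 : ω τ u1 = 1 := by rw [hτ, h.addl, h.smull, p2, r1']; ring
  have τ2 : ω τ u2 = θ := by rw [hτ, h.addl, h.smull, r2, h.inv]; ring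
  have τ1' : ω u1 τ = 1 := by rw [← h.conj, τ1, map_one]
  have τ2' : ω u2 τ = σ θ := by rw [← h.conj, τ2]
  obtain ⟨l, hl⟩ := h.trace_mul (-(ω τ τ + 1 + 1)) (θ - 1)
    (by rw [map_neg, map_add, map_add, h.nsym, map_one]) (sub_ne_zero.2 th1)
  obtain ⟨w, hwd⟩ : ∃ w, w = u1 + τ + l • (u2 - u1) := ⟨_, rfl⟩
  have hw1 : ω w u1 = ω u u + 1 := by
    rw [hwd]
    simp only [h.addl, h.smull, h.subl, h1.2, heq', τ1]; ring
  have hw2 : ω w u2 = ω u u + θ := by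
    rw [hwd]
    simp only [h.addl, h.smull, h.subl, h2.2, heq, τ2]; ring
  have hw : w ∈ Ou ω S u := by
    refine ⟨fun s hs => ?_, ?_⟩
    · rw [hwd]
      simp only [h.addr, h.smulr, h.subr, h1.1 s hs, h2.1 s hs, h.symm0 (τB s (b1 hs))]; ring
    · rw [hwd]
      simp only [h.addr, h.smulr, h.subr, h.addl, h.smull, h.subl, h1.2, h2.2, heq, heq', τ1, τ2,
        τ1', τ2']
      rw [map_sub, map_one] at hl
      linear_combination hl
  have hcons : ∀ v ∈ w :: [u1, u2], v ∈ Ou ω S u := by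
    intro v hv
    rcases List.mem_cons.1 hv with hv | hv
    · rw [hv]; exact hw
    · exact hR v hv
  have hconsH : 1 ≤ q' → ∀ v ∈ w :: [u1, u2], v ∈ prp h (sp2 F a a') := by
    intro hq' v hv
    rcases List.mem_cons.1 hv with hv | hv
    · rw [hv, hwd]
      refine add_mem (add_mem (hRH hq' u1 (by simp)) ?_) (Submodule.smul_mem _ _
        (sub_mem (hRH hq' u2 (by simp)) (hRH hq' u1 (by simp))))
      exact fun b hb => h.symm0 (τB b (b4 hq' hb))
    · exact hRH hq' v hv
  have hJw : 1 ≤ q' → J h (q' - 1) (sl S (w :: [u1, u2]) ⊔ sp2 F a a') := by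
    intro hq'
    have hA : S ⊔ sp1 F u1 ≤ prp h (sp2 F a a') := sup_le D.hS (sp1_le.2 (hRH hq' u1 (by simp)))
    have hA' := le_prp_comm hA
    have hJ' : J h q' (S ⊔ sp1 F u1 ⊔ sp2 F a a') :=
        Cancel h (D.hJ u1 h1) ha (hA' (mem_sp2l _ _)) (hA' (mem_sp2r _ _))
    obtain ⟨m, rfl⟩ : ∃ m, q' = m + 1 := ⟨q' - 1, by omega⟩
    have j1 := D1 h hJ' u2
    obtain ⟨A, hA⟩ : ∃ A, A = S ⊔ sp1 F u1 ⊔ sp2 F a a' ⊔ sp1 F u2 := ⟨_, rfl⟩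
    have m0 : S ≤ A := by
      rw [hA]; exact le_trans (le_trans le_sup_left le_sup_left) le_sup_left
    have m1 : u1 ∈ A := by
      rw [hA]; exact le_sup_left (b := sp1 F u2) (le_sup_left (b := sp2 F a a')
        (le_sup_right (a := S) (mem_sp1 u1)))
    have m2 : u2 ∈ A := by rw [hA]; exact le_sup_right (b := sp1 F u2) (mem_sp1 u2)
    have m3 : sp2 F a a' ≤ A := by rw [hA]; exact le_trans le_sup_right le_sup_left
    have m4 : u2 - u1 ∈ prp h A := by
      rw [hA]
      refine sup_le_prp (sup_le_prp (sup_le_prp ?_ (mem_prp_sp1.2 ?_)) ?_) (mem_prp_sp1.2 ?_)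
      · intro s hs; rw [h.subr, h1.1 s hs, h2.1 s hs, sub_self]
      · rw [h.subr, h1.2, heq, sub_self]
      · exact sub_mem (hRH hq' u2 (by simp)) (hRH hq' u1 (by simp))
      · rw [h.subr, h2.2, heq', sub_self]
    rw [← hA] at j1
    have j2 : J h m (A ⊔ sp1 F w) := by
      refine D2 h j1 (sub_mem m2 m1) m4 ?_
      rw [← h.conj]
      refine h.sigma_ne ?_
      rw [h.subr, hw1, hw2]
      intro e
      exact th1 (by linear_combination e)
    refine J_T h ?_ j2
    refine sup_le (sl_le.2 ⟨le_trans m0 le_sup_left, ?_⟩) (le_trans m3 le_sup_left)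
    intro v hv
    rcases List.mem_cons.1 hv with hv | hv
    · rw [hv]; exact le_sup_right (a := A) (mem_sp1 w)
    rcases List.mem_cons.1 hv with hv | hv
    · rw [hv]; exact le_sup_left (b := sp1 F w) m1
    · rw [List.mem_singleton.1 hv]; exact le_sup_left (b := sp1 F w) m2
  refine L.of_null_faces hBs hcons hconsH hJw hκ ?_
  intro B z C e κ' hκ'
  have fin : ∀ v ∈ [u1, u2], ω w v ≠ ω u u → B ++ C = [v] → lab (w :: (B ++ C)) κ' ∈
      Nul (Fx ω S) (Fx ω (S ⊔ sp2 F a a')) (Ou ω S u)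
      (Ou ω S u ∩ prp h (sp2 F a a')) [u1, u2].length q' := by
    intro v hv hwv e
    rw [e] at hκ' ⊢
    refine D.step1 rfl (u1 := w) (u2 := v) ?_ hRs hBs ?_ hwv hκ'
    · intro x hx
      rcases List.mem_cons.1 hx with hx | hx
      · rw [hx]; exact hw
      · rw [List.mem_singleton.1 hx]; exact hR v hv
    · intro hq' x hx
      rcases List.mem_cons.1 hx with hx | hx
      · rw [hx]; exact hconsH hq' w (by simp)
      · rw [List.mem_singleton.1 hx]; exact hRH hq' v hv
  rcases pair_face e with e | e
  · exact fin u2 (by simp) (by rw [hw2]; simpa using th0) e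
  · exact fin u1 (by simp) (by rw [hw1]; simp) e

end BDat

end BTwo

end UStab

namespace UStab

set_option linter.unusedSectionVars false
set_option linter.unusedVariables false
set_option linter.unusedSimpArgs false

section Main

variable {F V : Type} [Field F] [AddCommGroup V] [Module F V] {σ : F →+* F} {ω : V → V → F}
variable (h : Herm σ ω) {a a' : V} (ha : Hyp ω a a')

lemma sl_one {S : Submodule F V} {v : V} : sl S [v] ≤ S ⊔ sp1 F v :=
  sl_le.2 ⟨le_sup_left, fun x hx => by
    rw [List.mem_singleton.1 hx]; exact le_sup_right (a := S) (mem_sp1 v)⟩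

lemma conj_Fx {T T' : Submodule F V} {g : bilinIsoms F ω} (hg : ∀ t ∈ T', g⁻¹ • t ∈ T)
    {k : bilinIsoms F ω} (hk : k ∈ Fx ω T) : g * k * g⁻¹ ∈ Fx ω T' := by
  intro t ht
  rw [mul_smul, mul_smul, hk _ (hg t ht), smul_inv_smul]

lemma cj_dv (g : bilinIsoms F ω) (z : BC (bilinIsoms F ω) (List V)) :
    cj g (dv z) = dv (cj g z) := Phi_dv _ z

include ha in
lemma B1 {q : ℕ} (hq : 1 ≤ q) (IH : ∀ q', q' < q → 1 ≤ q' → Rst h a a' q' ∧ Bst h a a' q')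
    {S : Submodule F V} {u : V} (hS : S ≤ prp h (sp2 F a a')) (hu : u ∈ prp h (sp2 F a a'))
    (hJ : J h q (S ⊔ sp1 F u)) (hN : ∀ v ∈ Ou ω S u, v ∉ S) :
    ∀ x ∈ ZZ ω (sp2 F a a') S q, ∃ x' ∈ ZZ ω (sp2 F a a') (S ⊔ sp1 F u) q,
      x - x' ∈ BB ω (sp2 F a a') S q := by
  have uO : u ∈ Ou ω S u := ⟨fun _ _ => rfl, rfl⟩
  have D : BDat h ha S u q := ⟨hS, hu, hN, fun v hv =>
    J_move h (hN u uO) (hN v hv) (fun t ht => (hv.1 t ht).symm) hv.2.symm hJ⟩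
  have L := D.lset
  have main : ZZ ω (sp2 F a a') S q ≤
      BB ω (sp2 F a a') S q ⊔ ZZ ω (sp2 F a a') (S ⊔ sp1 F u) q := by
    refine L.finish ?_ ⟨u, uO, hu⟩ ?_ _ le_sup_left ?_
    · intro v hv
      exact J_T h sl_one (J_le h hq (D.hJ v hv))
    · intro k q' hk hkq
      refine L.H_of ?_ ?_
      · intro hq' R hR hRO
        match R, hR, hRO with
        | [], hR, _ => simp at hR; omega
        | v :: l, hR, hRO =>
          simp only [List.length_cons] at hR
          have j := D1l h (m := 1) l (J_le h (by omega) (D.hJ v (hRO v (by simp))))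
          refine J_T h (sl_le.2 ⟨le_trans le_sup_left (le_sl _ _), ?_⟩) j
          intro x hx
          rcases List.mem_cons.1 hx with hx | hx
          · rw [hx]; exact le_sl _ _ (le_sup_right (a := S) (mem_sp1 v))
          · exact mem_sl hx
      · intro R hR hRO hRH κ hκ
        subst hR
        have hRs : 1 ≤ q' → Rst h a a' q' := fun h1 => (IH q' (by omega) h1).1
        have hBs : 1 ≤ q' → Bst h a a' q' := fun h1 => (IH q' (by omega) h1).2
        rcases Nat.lt_or_ge R.length 3 with h3 | h3
        · obtain ⟨u1, u2, rfl⟩ := List.length_eq_two.1 (by omega : R.length = 2)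
          simp only [List.length_cons, List.length_nil] at hkq
          by_cases e : ω u1 u2 = ω u u
          · exact D.step2 (by omega) hRO hRs hBs hRH e hκ
          · exact D.step1 (by omega) hRO hRs hBs hRH e hκ
        · exact D.kge3 hRO hkq h3 hRs hBs hRH hκ
    · intro v hv hvH κ hκ
      have n1 : v ∉ S ⊔ sp2 F a a' := fun hh => hN v hv (indepH h ha hS hvH hh)
      have n2 : u ∉ S ⊔ sp2 F a a' := fun hh => hN u uO (indepH h ha hS hu hh)
      obtain ⟨g, hg, hgv⟩ := witt1 h n1 n2 (by
        intro t ht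
        obtain ⟨s, hs, b, hb, rfl⟩ := Submodule.mem_sup.1 ht
        rw [h.addl, h.addl, hv.1 s hs, hvH b hb, hu b hb]) hv.2
      have hgi : ∀ t ∈ S ⊔ sp1 F u, g⁻¹ • t ∈ S ⊔ sp1 F v := by
        intro t ht
        obtain ⟨s, hs, b, hb, rfl⟩ := Submodule.mem_sup.1 ht
        obtain ⟨c, rfl⟩ := Submodule.mem_span_singleton.1 hb
        have e : s + c • u = g • (s + c • v) := by
          rw [g_add, g_smul, hgv, hg s (le_sup_left (b := sp2 F a a') hs)]
        rw [e, inv_smul_smul]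
        exact add_mem (le_sup_left (b := sp1 F v) hs)
          (Submodule.smul_mem _ _ (le_sup_right (a := S) (mem_sp1 v)))
      have hgH : ∀ t ∈ S ⊔ sp1 F u ⊔ sp2 F a a', g⁻¹ • t ∈ S ⊔ sp1 F v ⊔ sp2 F a a' := by
        intro t ht
        obtain ⟨s, hs, b, hb, rfl⟩ := Submodule.mem_sup.1 ht
        have e : g⁻¹ • b = b := by
          rw [inv_smul_eq_iff]; exact (hg b (le_sup_right (a := S) hb)).symm
        rw [g_add, e]
        exact add_mem (le_sup_left (b := sp2 F a a') (hgi s hs))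
          (le_sup_right (a := S ⊔ sp1 F v) hb)
      obtain ⟨k1, k2⟩ := mem_Zr.1 hκ
      have hκS : κ ∈ ZZ ω (sp2 F a a') S q := ZZ_mono le_sup_left q hκ
      have d1 : κ - cj g κ ∈ BB ω (sp2 F a a') S q :=
        cj_Br (by simp) (Fx_anti le_sup_left hg) (mem_Zr.1 hκS).1
          (hc_dv_sp (by simp) hg hκS)
      have d2 : cj g κ ∈ ZZ ω (sp2 F a a') (S ⊔ sp1 F u) q := by
        refine mem_Zr.2 ⟨cj_sp (fun k hk => conj_Fx hgi hk) k1, ?_⟩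
        rw [← cj_dv]
        exact cj_sp (fun k hk => conj_Fx hgH hk) k2
      have := Submodule.add_mem _ (le_sup_left (b := ZZ ω (sp2 F a a') (S ⊔ sp1 F u) q) d1)
        (le_sup_right (a := BB ω (sp2 F a a') S q) d2)
      rwa [sub_add_cancel] at this
  intro x hx
  obtain ⟨b, hb, z, hz, e⟩ := Submodule.mem_sup.1 (main hx)
  refine ⟨z, hz, ?_⟩
  rw [← e, add_sub_cancel_right]; exact hb

/-- the isotropic vectors used for vanishing -/
def Oz (h : Herm σ ω) (S : Submodule F V) : Set V := {z | z ∈ prp h S ∧ ω z z = 0 ∧ z ∉ S}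

lemma Oz_J {S : Submodule F V} {q : ℕ} (hJ : J h (q + 1) S) {R : List V} {q' : ℕ}
    (hq : R.length + q' = q + 1)
    {x y : V} (hx : x ∈ R) (hy : y ∈ R) (hxo : x ∈ Oz h S) (hxy : ω x y ≠ 0) :
    J h (q' + 1) (sl S R) := by
  classical
  have yx : y ≠ x := by rintro rfl; exact hxy hxo.2.1
  have p1 := List.perm_cons_erase hx
  have hy' : y ∈ R.erase x := (List.mem_erase_of_ne yx).2 hy
  have p2 := List.perm_cons_erase hy'
  generalize (R.erase x).erase y = rest at p2
  have p : R.Perm (x :: y :: rest) := p1.trans (p2.cons x)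
  have hl := p.length_eq
  simp only [List.length_cons] at hl
  have j1 := EpsJ h hJ hxo.2.1 hxo.1 hxy
  have j3 := D1l h (m := q' + 1) rest (J_le h (by omega) j1)
  refine J_T h ?_ j3
  rw [sl_perm p]
  refine sl_le.2 ⟨le_trans (le_trans le_sup_left le_sup_left) (le_sl _ _), ?_⟩
  intro v hv
  rcases List.mem_cons.1 hv with hv | hv
  · rw [hv]; exact le_sl _ _ (le_sup_left (b := sp1 F y) (le_sup_right (a := S) (mem_sp1 x)))
  rcases List.mem_cons.1 hv with hv | hv
  · rw [hv]; exact le_sl _ _ (le_sup_right (a := S ⊔ sp1 F x) (mem_sp1 y))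
  exact mem_sl hv

lemma Oz_J' {S : Submodule F V} {q : ℕ} (hJ : J h (q + 1) S) {R rest : List V} {q' : ℕ}
    (hq : R.length + q' = q + 1)
    {x y : V} (e : R = x :: y :: rest) (hxy : y ∈ S ⊔ sp1 F x) :
    J h (q' + 1) (sl S R) := by
  subst e
  simp only [List.length_cons] at hq
  have j3 := D1l h (m := q' + 1) rest (J_le h (by omega) (D1 h hJ x))
  refine J_T h ?_ j3
  refine sl_le.2 ⟨le_trans le_sup_left (le_sl _ _), ?_⟩
  intro v hv
  rcases List.mem_cons.1 hv with hv | hv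
  · rw [hv]; exact le_sl _ _ (le_sup_right (a := S) (mem_sp1 x))
  rcases List.mem_cons.1 hv with hv | hv
  · rw [hv]; exact le_sl _ _ hxy
  exact mem_sl hv

include ha in
lemma Oz_lset {S : Submodule F V} (hS : S ≤ prp h (sp2 F a a')) : Lset h ha S (Oz h S) := by
  refine ⟨hS, fun g hg v hv => ⟨fun s hs => ?_, ?_, fun hh => hv.2.2 ?_⟩⟩
  · have := g_isom (ω := ω) g s v
    rw [hg s hs] at this
    rw [this]; exact hv.1 s hs
  · rw [g_isom (ω := ω) g _ _]; exact hv.2.1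
  · have := (Fx ω S).inv_mem hg _ hh
    rw [inv_smul_smul] at this
    rw [this]; exact hh

include ha in
lemma Oz_null {S : Submodule F V} (hS : S ≤ prp h (sp2 F a a')) {q q' : ℕ} (hJ : J h (q + 1) S)
    {R rest : List V} {x y : V} (eR : R = x :: y :: rest)
    (hR : ∀ v ∈ R, v ∈ Oz h S) (hq : R.length + q' = q + 1)
    (hRs : 1 ≤ q' → Rst h a a' q') (hBs : 1 ≤ q' → Bst h a a' q')
    (hRH : 1 ≤ q' → ∀ v ∈ R, v ∈ prp h (sp2 F a a'))
    {κ} (hκ : κ ∈ ZZ ω (sp2 F a a') (sl S R) q') :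
    lab R κ ∈ Nul (Fx ω S) (Fx ω (S ⊔ sp2 F a a')) (Oz h S) (Oz h S ∩ prp h (sp2 F a a'))
      R.length q' := by
  have L := Oz_lset h ha hS
  have hl : R.length = rest.length + 1 + 1 := by rw [eR]; rfl
  have xR : x ∈ R := by rw [eR]; simp
  have yR : y ∈ R := by rw [eR]; simp
  by_cases i1 : y ∈ S ⊔ sp1 F x
  · exact L.null hRs hR hRH (Oz_J' h hJ hq eR i1) hκ
  have i0 : x ∉ S := (hR x xR).2.2
  have nyx : y ≠ x := fun e => i1 (by rw [e]; exact le_sup_right (a := S) (mem_sp1 x))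
  obtain ⟨A, a1, a2, a3, a4, a5⟩ : ∃ A, S ≤ A ∧ J h 2 A ∧ x ∉ A ∧ y ∉ A ⊔ sp1 F x ∧
      (1 ≤ q' → sp2 F a a' ≤ A ∧ J h q A) := by
    rcases Nat.eq_zero_or_pos q' with rfl | hq'
    · exact ⟨_, le_rfl, J_le h (by omega) hJ, i0, i1, by simp⟩
    · have hA' := le_prp_comm hS
      have hJ' : J h q (S ⊔ sp2 F a a') :=
        Cancel h hJ ha (hA' (mem_sp2l _ _)) (hA' (mem_sp2r _ _))
      refine ⟨S ⊔ sp2 F a a', le_sup_left, J_le h (by omega) hJ', ?_, ?_,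
        fun _ => ⟨le_sup_right, hJ'⟩⟩
      · exact fun hh => i0 (indepH h ha hS (hRH hq' x xR) hh)
      · intro hh
        rw [sup_right_comm] at hh
        exact i1 (indepH h ha (sup_le hS (sp1_le.2 (hRH hq' x xR))) (hRH hq' y yR) hh)
  obtain ⟨w, e1, e2, e3, e4⟩ := Eps2 h a2 a3 a4 (γ := 1) one_ne_zero 1
  have hw : w ∈ Oz h S := ⟨prp_anti a1 e2, e1, fun hh => by
    have := (hR x xR).1 w hh
    rw [e3] at this; exact one_ne_zero this⟩
  have hcons : ∀ v ∈ w :: R, v ∈ Oz h S := by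
    intro v hv
    rcases List.mem_cons.1 hv with hv | hv
    · rw [hv]; exact hw
    · exact hR v hv
  have hconsH : 1 ≤ q' → ∀ v ∈ w :: R, v ∈ prp h (sp2 F a a') := by
    intro hq' v hv
    rcases List.mem_cons.1 hv with hv | hv
    · rw [hv]; exact prp_anti (a5 hq').1 e2
    · exact hRH hq' v hv
  refine L.of_null_faces hBs hcons hconsH ?_ hκ ?_
  · intro hq'
    obtain ⟨m, rfl⟩ : ∃ m, q = m + 1 := ⟨q - 1, by omega⟩
    have j1 : J h m (A ⊔ sp1 F w ⊔ sp1 F x) :=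
      EpsJ h (a5 hq').2 e1 e2 (by rw [e3]; exact one_ne_zero)
    have j2 := D1l h (m := q' - 1) (y :: rest) (J_le h (by simp only [List.length_cons]; omega) j1)
    refine J_T h ?_ j2
    have hAle : A ≤ A ⊔ sp1 F w ⊔ sp1 F x := le_trans le_sup_left le_sup_left
    refine sup_le (sl_le.2 ⟨?_, ?_⟩) (le_trans (le_trans (a5 hq').1 hAle) (le_sl _ _))
    · exact le_trans (le_trans a1 hAle) (le_sl _ _)
    · intro v hv
      rcases List.mem_cons.1 hv with hv | hv
      · rw [hv]; exact le_sl _ _ (le_sup_left (b := sp1 F x)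
          (le_sup_right (a := A) (mem_sp1 w)))
      rw [eR] at hv
      rcases List.mem_cons.1 hv with hv | hv
      · rw [hv]; exact le_sl _ _ (le_sup_right (a := A ⊔ sp1 F w) (mem_sp1 x))
      · exact mem_sl hv
  · intro B z C e κ' hκ'
    have hlen : (w :: (B ++ C)).length = R.length := by
      rw [e]; simp; omega
    have hsub : ∀ v ∈ w :: (B ++ C), v ∈ w :: R := by
      intro v hv
      rw [e]; exact face_sub hv
    have hin : ∀ v ∈ R, v ≠ z → v ∈ w :: (B ++ C) := by
      intro v hv hvz
      rw [e] at hv; exact face_in hv hvz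
    have hJ' : J h (q' + 1) (sl S (w :: (B ++ C))) := by
      by_cases z1 : x = z
      · exact Oz_J h hJ (by rw [hlen]; exact hq) (x := w) (y := y) (by simp)
          (hin y yR (by rw [← z1]; exact nyx)) hw (by rw [e4]; exact one_ne_zero)
      · exact Oz_J h hJ (by rw [hlen]; exact hq) (x := w) (y := x) (by simp)
          (hin x xR z1) hw (by rw [e3]; exact one_ne_zero)
    have := L.null hRs (fun v hv => hcons v (hsub v hv)) (fun hq' v hv => hconsH hq' v (hsub v hv))
      hJ' hκ'
    rwa [hlen] at this

include ha in
lemma RS {q : ℕ} (hq : 1 ≤ q) (IH : ∀ q', q' < q → 1 ≤ q' → Rst h a a' q' ∧ Bst h a a' q') :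
    Rst h a a' q := by
  intro S hS hJ
  have L := Oz_lset h ha hS
  have hS' := le_prp_comm hS
  have hJH : J h q (S ⊔ sp2 F a a') := Cancel h hJ ha (hS' (mem_sp2l _ _)) (hS' (mem_sp2r _ _))
  refine L.finish ?_ ?_ ?_ _ le_rfl ?_
  · intro v hv
    exact J_T h sl_one (J_le h hq (D1 h hJ v))
  · obtain ⟨z, z', hz, z1, z2, -⟩ := J_le h hq hJH
    refine ⟨z, ⟨prp_anti le_sup_left z1, hz.1, fun hh => ?_⟩, prp_anti le_sup_right z1⟩
    have := z2 z (le_sup_left (b := sp2 F a a') hh)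
    rw [hz.2.2] at this; exact one_ne_zero this
  · intro k q' hk hkq
    refine L.H_of ?_ ?_
    · intro hq' R hR hRO
      exact D1l h (m := 1) R (J_le h (by omega) hJ)
    · intro R hR hRO hRH κ hκ
      subst hR
      match R, hk, hRO, hRH, hkq, κ, hκ with
      | x :: y :: rest, hk, hRO, hRH, hkq, κ, hκ =>
        exact Oz_null h ha hS hJ rfl hRO hkq (fun h1 => (IH q' (by
            simp only [List.length_cons] at hkq; omega) h1).1)
          (fun h1 => (IH q' (by simp only [List.length_cons] at hkq; omega) h1).2) hRH hκ
  · intro z hz hzH κ hκ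
    have nz : z ∉ S ⊔ sp2 F a a' := fun hh => hz.2.2 (indepH h ha hS hzH hh)
    obtain ⟨z', hy, hz'⟩ := partner h nz hz.2.1 (sup_le_prp hz.1 hzH)
    have hSz : S ⊔ sp1 F z ≤ prp h (sp2 F a a') := sup_le hS (sp1_le.2 hzH)
    have e2 : S ⊔ sp1 F z ⊔ sp1 F z' = S ⊔ sp2 F z z' := by
      rw [sup_assoc]; congr 1
      exact (Submodule.span_insert z {z'}).symm
    have hJz : J h q (S ⊔ sp1 F z ⊔ sp1 F z') := by
      rw [e2]
      exact Cancel h hJ hy hz.1 (prp_anti le_sup_left hz')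
    obtain ⟨κ', hκ', hd⟩ := B1 h ha hq IH hSz (prp_anti le_sup_right hz') hJz (by
      intro v hv hh
      have h1 := hv.1 z (le_sup_right (a := S) (mem_sp1 z))
      rw [hy.2.2] at h1
      have h2 : z ∈ prp h (S ⊔ sp1 F z) := sup_le_prp hz.1 (mem_prp_sp1.2 hz.2.1)
      rw [h.symm0 (h2 v hh)] at h1
      exact zero_ne_one h1) κ hκ
    obtain ⟨p, rfl⟩ : ∃ p, q = p + 1 := ⟨q - 1, by omega⟩
    have k1 : κ' ∈ BB ω (sp2 F a a') S (p + 1) := by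
      refine swap_Br h (h.third 0 1) ha hy (hS' (mem_sp2l _ _)) (hS' (mem_sp2r _ _))
        (sup_le_prp hz.1 hzH) hz' ?_
      rwa [e2] at hκ'
    have := Submodule.add_mem _ (BB_mono le_sup_left _ hd) k1
    rwa [sub_add_cancel] at this

include ha in
lemma BS [FiniteDimensional F V] {q : ℕ} (hq : 1 ≤ q)
    (IH : ∀ q', q' < q → 1 ≤ q' → Rst h a a' q' ∧ Bst h a a' q')
    (HR : Rst h a a' q) : Bst h a a' q := by
  intro S
  induction S using (wellFounded_gt (α := Submodule F V)).induction with
  | _ S ih =>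
    intro T hST hT hJ x hx
    by_cases e : T ≤ S
    · obtain rfl : S = T := le_antisymm hST e
      exact ⟨x, hx, by rw [sub_self]; exact Submodule.zero_mem _⟩
    obtain ⟨u, huT, huS⟩ := Set.not_subset.1 e
    have hSu : S ⊔ sp1 F u ≤ T := sup_le hST (sp1_le.2 huT)
    by_cases hN : ∀ v ∈ Ou ω S u, v ∉ S
    · obtain ⟨x1, hx1, d1⟩ := B1 h ha hq IH (le_trans hST hT) (hT huT) (J_T h hSu hJ) hN x hx
      have lt : S < S ⊔ sp1 F u := lt_of_le_of_ne le_sup_left (fun ee => huS (by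
        rw [SetLike.mem_coe, ee]; exact le_sup_right (a := S) (mem_sp1 u)))
      obtain ⟨x2, hx2, d2⟩ := ih (S ⊔ sp1 F u) lt T hSu hT hJ x1 hx1
      refine ⟨x2, hx2, ?_⟩
      have := Submodule.add_mem _ d1 (BB_mono le_sup_left _ d2)
      rwa [sub_add_sub_cancel] at this
    · push Not at hN
      obtain ⟨u', hu', hS'⟩ := hN
      have hS1 : u - u' ∈ prp h S := fun s hs => by rw [h.subr, hu'.1 s hs, sub_self]
      have n1 : u - u' ∉ S := fun hh => huS (by
        have := add_mem hh hS'; rwa [sub_add_cancel] at this)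
      have e1 : ω u' u = ω u u := by rw [← hu'.1 u' hS', hu'.2]
      have e2 : ω u u' = ω u u := by rw [← h.conj, e1, h.nsym]
      have n0 : ω (u - u') (u - u') = 0 := by
        rw [h.subr, h.subl, h.subl, e1, e2, hu'.2]; ring
      have j : J h (q + 1) S := by
        refine D3 h n1 n0 hS1 (J_T h (sup_le hST (sp1_le.2 (sub_mem huT (hST hS')))) hJ)
      refine ⟨0, Submodule.zero_mem _, ?_⟩
      rw [sub_zero]
      exact HR S (le_trans hST hT) j hx

include ha in
theorem main_RB [FiniteDimensional F V] (q : ℕ) (hq : 1 ≤ q) : Rst h a a' q ∧ Bst h a a' q := by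
  induction q using Nat.strong_induction_on with
  | _ q ih =>
    have HR := RS h ha hq (fun q' h1 h2 => ih q' h1 h2)
    exact ⟨HR, BS h ha hq (fun q' h1 h2 => ih q' h1 h2) HR⟩

include ha in
theorem main_R [FiniteDimensional F V] (q : ℕ) : Rst h a a' q := by
  rcases Nat.eq_zero_or_pos q with rfl | hq
  · intro S hS hJ x hx
    exact sp_le_Br (sp_zero (mem_Zr.1 hx).1)
  · exact (main_RB h ha q hq).1

end Main

end UStab

namespace UStab

set_option linter.unusedSectionVars false
set_option linter.unusedVariables false
set_option linter.unusedSimpArgs false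

section Transfer

open GroupHomologyBar

variable {G V : Type} [Group G] [MulAction G V]

/-- from bar chains indexed by functions to chains indexed by lists -/
noncomputable def th (V : Type) (n : ℕ) : chains G ℤ n →ₗ[ℤ] BC G (List V) :=
  Finsupp.lmapDomain ℤ ℤ (fun g => (List.ofFn g, []))

lemma th_single {n : ℕ} (g : Fin n → G) (c : ℤ) :
    th V n (Finsupp.single g c) = Finsupp.single (List.ofFn g, []) c := by
  simp [th, Finsupp.mapDomain_single]

lemma th_inj (n : ℕ) : Function.Injective (th (G := G) V n) := by
  refine Finsupp.mapDomain_injective ?_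
  intro g g' e
  exact List.ofFn_injective (Prod.ext_iff.1 e).1

lemma contract_zero {n : ℕ} (g : Fin (n + 2) → G) :
    List.ofFn (Fin.contractNth 0 (· * ·) g) = (g 0 * g 1) :: List.ofFn (Fin.tail (Fin.tail g)) := by
  rw [List.ofFn_succ]
  congr 1

lemma contract_succ {n : ℕ} (j : Fin (n + 1)) (g : Fin (n + 2) → G) :
    List.ofFn (Fin.contractNth j.succ (· * ·) g)
      = g 0 :: List.ofFn (Fin.contractNth j (· * ·) (Fin.tail g)) := by
  rw [List.ofFn_succ]
  congr 1
  congr 1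
  funext k
  simp only [Fin.contractNth, Fin.val_succ, Fin.tail]
  simp only [Nat.add_lt_add_iff_right, Nat.add_right_cancel_iff]
  rfl

lemma P0_ofFn (n : ℕ) (g : Fin (n + 1) → G) :
    P0 (List.ofFn g) ([] : List V) = ∑ j : Fin (n + 1), ((-1 : ℤ) ^ (j : ℕ)) •
      Finsupp.single (List.ofFn (Fin.contractNth j (· * ·) g), ([] : List V)) (1 : ℤ) := by
  induction n with
  | zero => simp [P0, mu]
  | succ n ih =>
    rw [Fin.sum_univ_succ, contract_zero, List.ofFn_succ, P0]
    have e : (List.ofFn fun i : Fin (n + 1) => g i.succ) = List.ofFn (Fin.tail g) := rfl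
    rw [e, ih, List.ofFn_succ, sub_eq_add_neg]
    congr 1
    · simp [mu]; rfl
    · rw [map_sum, ← Finset.sum_neg_distrib]
      refine Finset.sum_congr rfl fun j _ => ?_
      rw [map_smul, consL_single, contract_succ, Fin.val_succ, pow_succ]
      simp

lemma th_d (n : ℕ) (x : chains G ℤ (n + 1)) : th V n (d G ℤ n x) = dv (th V (n + 1) x) := by
  have : (th V n).comp (d G ℤ n) = (dv : BC G (List V) →ₗ[ℤ] _).comp (th V (n + 1)) := by
    apply Finsupp.lhom_ext'; intro g; ext1
    simp only [LinearMap.comp_apply, Finsupp.lsingle_apply, th_single, d_single, map_add, map_sum,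
      map_smul]
    rw [dv_apply, D0_single, P_single, P0_ofFn, sub_eq_add_neg]
    congr 1
    · rw [List.ofFn_succ]; rfl
    · rw [← Finset.sum_neg_distrib]
      refine Finset.sum_congr rfl fun j _ => ?_
      rw [pow_succ]; simp
  exact congrArg (fun f => f x) this

lemma th_mem (K : Subgroup G) {G' : Type} [Group G'] (φ : G' →* G) (hφ : ∀ g, φ g ∈ K) (n : ℕ)
    (x : chains G' ℤ n) : th V n (chainsMap ℤ φ n x) ∈ sp K (∅ : Set V) 0 n := by
  induction x using Finsupp.induction_linear with
  | zero => simp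
  | add x y hx hy => rw [map_add, map_add]; exact add_mem hx hy
  | single g c =>
    rw [chainsMap_single, th_single]
    refine Finsupp.single_mem_supported ℤ c ⟨by simp, ?_, rfl, by simp⟩
    intro k hk
    rw [List.mem_ofFn] at hk
    obtain ⟨i, rfl⟩ := hk
    exact hφ _

lemma th_mem' (K : Subgroup G) (hφ : ∀ g : G, g ∈ K) (n : ℕ)
    (x : chains G ℤ n) : th V n x ∈ sp K (∅ : Set V) 0 n := by
  have := th_mem (V := V) K (MonoidHom.id G) hφ n x
  have e : chainsMap ℤ (MonoidHom.id G) n x = x := by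
    simp only [chainsMap, MonoidHom.coe_id, Function.id_comp]
    exact Finsupp.mapDomain_id
  rwa [e] at this

lemma th_surj (K : Subgroup G) {G' : Type} [Group G'] (φ : G' →* G)
    (hφ : ∀ g ∈ K, ∃ g', φ g' = g) (n : ℕ) {z : BC G (List V)} (hz : z ∈ sp K (∅ : Set V) 0 n) :
    ∃ x, th V n (chainsMap ℤ φ n x) = z := by
  rw [sp, Finsupp.supported_eq_span_single] at hz
  induction hz using Submodule.span_induction with
  | mem z hz =>
    obtain ⟨⟨l, y⟩, ⟨h1, h2, h3, h4⟩, rfl⟩ := hz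
    simp only at h1 h2 h3 h4
    obtain rfl := List.length_eq_zero_iff.1 h3
    subst h1
    choose f hf using fun i : Fin l.length => hφ (l.get i) (h2 _ (List.get_mem l i))
    refine ⟨Finsupp.single f 1, ?_⟩
    rw [chainsMap_single, th_single]
    congr 2
    have : φ ∘ f = l.get := funext hf
    rw [this, List.ofFn_get]
  | zero => exact ⟨0, by simp⟩
  | add x y _ _ hx hy =>
    obtain ⟨x, rfl⟩ := hx
    obtain ⟨y, rfl⟩ := hy
    exact ⟨x + y, by simp⟩
  | smul c x _ hx =>
    obtain ⟨x, rfl⟩ := hx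
    exact ⟨c • x, by simp⟩

lemma chainsMap_inj {G' : Type} [Group G'] (φ : G' →* G) (hφ : Function.Injective φ) (n : ℕ) :
    Function.Injective (chainsMap ℤ φ n) := by
  refine Finsupp.mapDomain_injective ?_
  intro g g' e
  exact funext fun i => hφ (congrFun e i)

lemma d_cM {G' : Type} [Group G'] (φ : G' →* G) (n : ℕ) (x : chains G' ℤ (n + 1)) :
    d G ℤ n (chainsMap ℤ φ (n + 1) x) = chainsMap ℤ φ n (d G' ℤ n x) :=
  congrArg (fun f => f x) (d_chainsMap ℤ φ n)

lemma cM_comp {G' G'' : Type} [Group G'] [Group G''] (φ : G' →* G) (ψ : G'' →* G') (n : ℕ)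
    (x : chains G'' ℤ n) : chainsMap ℤ (φ.comp ψ) n x = chainsMap ℤ φ n (chainsMap ℤ ψ n x) := by
  have : chainsMap ℤ (φ.comp ψ) n = (chainsMap ℤ φ n).comp (chainsMap ℤ ψ n) := by
    apply Finsupp.lhom_ext'; intro g; ext1
    simp only [LinearMap.comp_apply, Finsupp.lsingle_apply, chainsMap_single]
    rfl
  exact congrArg (fun f => f x) this

lemma dv_th_zero {n : ℕ} {x : chains G ℤ n} (hx : x ∈ cycles G ℤ n) : dv (th V n x) = 0 := by
  cases n with
  | zero =>
    induction x using Finsupp.induction_linear with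
    | zero => simp
    | add x y ihx ihy => rw [map_add, map_add, ihx trivial, ihy trivial, add_zero]
    | single g c =>
      have e : Finsupp.single g c = c • Finsupp.single g (1 : ℤ) := by simp
      rw [e, map_smul, map_smul, th_single, dv_apply, D0_single, P_single]
      simp [D00, P0]
  | succ n =>
    have hx' : d G ℤ n x = 0 := hx
    rw [← th_d, hx', map_zero]

end Transfer

section Abstract

open GroupHomologyBar

variable {F V : Type} [Field F] [AddCommGroup V] [Module F V] {σ : F →+* F} {ω : V → V → F}
  (h : Herm σ ω) {a a' : V} (ha : Hyp ω a a')

include ha in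
lemma abs_surj [FiniteDimensional F V] {G' : Type} [Group G'] (φ : G' →* bilinIsoms F ω)
    (hφ : Function.Injective φ) (hr : ∀ g ∈ Fx ω (sp2 F a a'), ∃ g', φ g' = g) (q : ℕ)
    (hJ : J h (q + 1) ⊥) : Function.Surjective (inducedMap ℤ φ q) := by
  intro X
  obtain ⟨⟨x, hx⟩, rfl⟩ := Submodule.mkQ_surjective _ X
  have hz : th V q x ∈ ZZ ω (sp2 F a a') ⊥ q := by
    refine mem_Zr.2 ⟨th_mem' _ (fun g => ?_) q x, ?_⟩
    · rw [mem_Fx]; intro t ht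
      rw [(Submodule.mem_bot F).1 ht]; exact map_zero g.1
    · rw [dv_th_zero hx]; exact zero_mem _
  obtain ⟨s, hs, y, hy, e⟩ := mem_Br.1 (main_R h ha q ⊥ bot_le hJ hz)
  rw [bot_sup_eq] at hs
  obtain ⟨s, rfl⟩ := th_surj _ φ hr q hs
  obtain ⟨y, rfl⟩ := th_surj _ (MonoidHom.id _) (fun g _ => ⟨g, rfl⟩) (q + 1) hy
  rw [← th_d, ← map_add] at e
  have e := th_inj q e
  have hs : s ∈ cycles G' ℤ q := by
    cases q with
    | zero => trivial
    | succ q =>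
      change d _ ℤ q s = 0
      have hx' : d _ ℤ q x = 0 := hx
      apply chainsMap_inj φ hφ
      have e1 := congrArg (d _ ℤ q) e
      rw [map_add, hx', d_cM] at e1
      have e2 : d _ ℤ q (d _ ℤ (q + 1) (chainsMap ℤ (MonoidHom.id (bilinIsoms F ω)) (q + 1 + 1) y))
          = 0 := by
        apply th_inj (V := V)
        rw [th_d, th_d, dv_dv, map_zero]
      rw [e2, add_zero] at e1
      rw [e1, map_zero]
  refine ⟨Submodule.Quotient.mk ⟨s, hs⟩, ?_⟩
  change Submodule.Quotient.mk _ = Submodule.Quotient.mk _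
  rw [eq_comm, Submodule.Quotient.eq]
  change _ ∈ LinearMap.range _
  refine ⟨_, (sub_eq_iff_eq_add.2 (e.symm.trans (add_comm _ _))).symm⟩

include ha in
lemma abs_inj [FiniteDimensional F V] {G G' : Type} [Group G] [Group G'] (ψ : G →* G')
    (φ : G' →* bilinIsoms F ω)
    (hφ : Function.Injective φ) (hψ : Function.Injective ψ)
    (h1 : ∀ g, φ (ψ g) ∈ Fx ω (sp2 F a a'))
    (hr : ∀ g ∈ Fx ω (sp2 F a a'), ∃ g', φ (ψ g') = g) (q : ℕ)
    (hJ : J h (q + 2) ⊥) : Function.Injective (inducedMap ℤ ψ q) := by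
  rw [← LinearMap.ker_eq_bot, LinearMap.ker_eq_bot']
  intro X hX
  obtain ⟨⟨x, hx⟩, rfl⟩ := Submodule.mkQ_surjective _ X
  have hX' : (Submodule.Quotient.mk (cyclesMap ℤ ψ q ⟨x, hx⟩) : Homology G' ℤ q) = 0 := hX
  rw [Submodule.Quotient.mk_eq_zero] at hX'
  obtain ⟨y, hy⟩ : ∃ y, d G' ℤ q y = chainsMap ℤ ψ q x := hX'
  have hdz : dv (th V (q + 1) (chainsMap ℤ φ (q + 1) y))
      = th V q (chainsMap ℤ (φ.comp ψ) q x) := by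
    rw [← th_d, d_cM, hy, cM_comp]
  have hz : th V (q + 1) (chainsMap ℤ φ (q + 1) y) ∈ ZZ ω (sp2 F a a') ⊥ (q + 1) := by
    refine mem_Zr.2 ⟨th_mem' _ (fun g => ?_) _ _, ?_⟩
    · rw [mem_Fx]; intro t ht
      rw [(Submodule.mem_bot F).1 ht]; exact map_zero g.1
    · rw [hdz, bot_sup_eq]; exact th_mem _ _ h1 _ _
  obtain ⟨s, hs, w, hw, e⟩ := mem_Br.1 (main_R h ha (q + 1) ⊥ bot_le hJ hz)
  rw [bot_sup_eq] at hs
  obtain ⟨s, rfl⟩ := th_surj _ (φ.comp ψ) hr (q + 1) hs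
  have e1 := congrArg dv e
  rw [map_add, dv_dv, add_zero, hdz, ← th_d, d_cM] at e1
  have e2 := chainsMap_inj (φ.comp ψ) (hφ.comp hψ) q (th_inj q e1)
  change Submodule.Quotient.mk _ = _
  rw [Submodule.Quotient.mk_eq_zero]
  change _ ∈ LinearMap.range _
  exact ⟨s, e2⟩

end Abstract

end UStab

namespace UStab

set_option linter.unusedSectionVars false
set_option linter.unusedVariables false
set_option linter.unusedSimpArgs false

section Concrete

variable {F V V0 : Type} [Field F] [AddCommGroup V] [Module F V] [AddCommGroup V0] [Module F V0]
  {σ : F →+* F} {ω : V → V → F} {ω0 : V0 → V0 → F}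

/-- adding a one dimensional orthogonal summand -/
lemma Herm_add (h0 : Herm σ ω0) (e : V ≃ₗ[F] V0 × F) (ε : F) (hε : ε ≠ 0) (hs : σ ε = ε)
    (hω : ∀ v w, ω v w = ω0 (e v).1 (e w).1 + ε * (σ (e v).2 * (e w).2)) : Herm σ ω where
  inv := h0.inv
  ne := h0.ne
  addr v w w' := by simp only [hω, map_add, Prod.fst_add, Prod.snd_add, h0.addr]; ring
  smulr v c w := by simp only [hω, map_smul, Prod.smul_fst, Prod.smul_snd, h0.smulr, smul_eq_mul]; ring
  conj v w := by simp only [hω, map_add, map_mul, h0.conj, h0.inv, hs]; ring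
  rep f := by
    obtain ⟨t, ht⟩ := h0.rep (f ∘ₗ e.symm.toLinearMap ∘ₗ LinearMap.inl F V0 F)
    refine ⟨e.symm (t, σ (ε⁻¹ * f (e.symm (0, 1)))), fun w => ?_⟩
    rw [hω, LinearEquiv.apply_symm_apply, ht, h0.inv, ← mul_assoc, mul_inv_cancel_left₀ hε]
    simp only [LinearMap.comp_apply, LinearEquiv.coe_coe, LinearMap.inl_apply]
    rw [mul_comm, ← smul_eq_mul, ← map_smul, ← map_smul, ← map_add, ← map_add]
    rw [show ((e w).1, (0 : F)) + (e w).2 • ((0 : V0), (1 : F)) = e w by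
      ext <;> simp, LinearEquiv.symm_apply_apply]

/-- isometries fixing the added vector come from the smaller space -/
lemma descend (e : V ≃ₗ[F] V0 × F) (ε : F) (hε : ε ≠ 0) (h00 : ∀ v, ω0 0 v = 0)
    (hω : ∀ v w, ω v w = ω0 (e v).1 (e w).1 + ε * (σ (e v).2 * (e w).2))
    (g : bilinIsoms F ω) (hg : g.1 (e.symm (0, 1)) = e.symm (0, 1)) :
    ∃ g0 : bilinIsoms F ω0, ∀ v, g.1 v = e.symm (g0.1 (e v).1, (e v).2) := by
  have key : ∀ k : bilinIsoms F ω, k.1 (e.symm (0, 1)) = e.symm (0, 1) → ∀ v,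
      (e (k.1 v)).2 = (e v).2 := by
    intro k hk v
    have h1 := k.2 (e.symm (0, 1)) v
    rw [hk, hω, hω] at h1
    simpa [h00, hε] using h1
  have hgi : (g⁻¹).1 (e.symm (0, 1)) = e.symm (0, 1) := by
    change g.1.symm _ = _
    rw [LinearEquiv.symm_apply_eq, hg]
  have dec : ∀ v, v = e.symm ((e v).1, 0) + (e v).2 • e.symm (0, 1) := by
    intro v
    apply e.injective
    ext <;> simp
  have hgg : ∀ v, g.1 ((g⁻¹).1 v) = v := fun v => g.1.apply_symm_apply v
  have hgg' : ∀ v, (g⁻¹).1 (g.1 v) = v := fun v => g.1.symm_apply_apply v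
  let f : ∀ k : bilinIsoms F ω, V0 →ₗ[F] V0 := fun k =>
    LinearMap.fst F V0 F ∘ₗ e.toLinearMap ∘ₗ k.1.toLinearMap ∘ₗ e.symm.toLinearMap ∘ₗ
      LinearMap.inl F V0 F
  have hf : ∀ k x, f k x = (e (k.1 (e.symm (x, 0)))).1 := fun k x => rfl
  have hf2 : ∀ k : bilinIsoms F ω, k.1 (e.symm (0, 1)) = e.symm (0, 1) → ∀ x,
      e.symm (f k x, 0) = k.1 (e.symm (x, 0)) := by
    intro k hk x
    rw [LinearEquiv.symm_apply_eq, hf]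
    ext
    · rfl
    · rw [key k hk]; simp
  have i1 : ∀ x, f g (f g⁻¹ x) = x := by
    intro x; rw [hf, hf2 _ hgi, hgg]; simp
  have i2 : ∀ x, f g⁻¹ (f g x) = x := by
    intro x; rw [hf, hf2 _ hg, hgg']; simp
  let E : V0 ≃ₗ[F] V0 := LinearEquiv.ofLinearMap (f g) (f g⁻¹) (LinearMap.ext i1) (LinearMap.ext i2)
  have hE : ∀ x, E x = f g x := fun x => rfl
  refine ⟨⟨E, ?_⟩, ?_⟩
  · intro x y
    rw [hE, hE]
    have h1 := g.2 (e.symm (x, 0)) (e.symm (y, 0))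
    rw [← hf2 g hg, ← hf2 g hg, hω, hω] at h1
    simpa using h1
  · intro v
    change g.1 v = e.symm (E (e v).1, (e v).2)
    rw [hE]
    conv_lhs => rw [dec v]
    rw [map_add, map_smul, hg, ← hf2 g hg, ← map_smul, ← map_add]
    congr 1
    ext <;> simp

lemma J_emb (h0 : Herm σ ω0) (h : Herm σ ω) (i : V0 →ₗ[F] V) (hi : ∀ x y, ω (i x) (i y) = ω0 x y)
    {m : ℕ} {T0 : Submodule F V0} {T : Submodule F V} (hT : ∀ x ∈ prp h0 T0, i x ∈ prp h T)
    (hJ : J h0 m T0) : J h m T := by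
  induction m generalizing T0 T with
  | zero => trivial
  | succ m ih =>
    obtain ⟨x, x', hx, h1, h2, h3⟩ := hJ
    refine ⟨i x, i x', ⟨by rw [hi, hx.1], by rw [hi, hx.2.1], by rw [hi, hx.2.2]⟩, hT _ h1, hT _ h2,
      ih ?_ h3⟩
    intro y hy
    have hy2 := mem_prp_sp2.1 (prp_anti le_sup_right hy)
    refine sup_le_prp (hT _ (prp_anti le_sup_left hy)) (mem_prp_sp2.2 ⟨?_, ?_⟩)
    · rw [hi, hy2.1]
    · rw [hi, hy2.2]

lemma hyp_of (h : Herm σ ω) {u w : V} (hu : ω u u = 0) (hw : ω u w ≠ 0) :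
    ∃ x', Hyp ω u x' ∧ sp2 F u x' = sp2 F u w := by
  obtain ⟨c, hc⟩ : ∃ c, c = ω u w := ⟨_, rfl⟩
  have hc0 : c ≠ 0 := hc ▸ hw
  have h1 : ω u (c⁻¹ • w) = 1 := by rw [h.smulr, ← hc, inv_mul_cancel₀ hc0]
  have h2 : ω (c⁻¹ • w) u = 1 := by rw [← h.conj, h1, map_one]
  obtain ⟨l, hl⟩ := h.trace _ (h.nsym (c⁻¹ • w))
  refine ⟨c⁻¹ • w - l • u, ⟨hu, ?_, ?_⟩, ?_⟩
  · rw [h.subl, h.subr, h.subr, h.smull l, h.smull l, h.smulr _ l, h.smulr _ l, h1, h2, hu, ← hl]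
    ring
  · rw [h.subr, h1, h.smulr, hu]; ring
  · apply le_antisymm
    · refine sp2_le.2 ⟨mem_sp2l _ _, sub_mem (Submodule.smul_mem _ _ (mem_sp2r _ _))
        (Submodule.smul_mem _ _ (mem_sp2l _ _))⟩
    · refine sp2_le.2 ⟨mem_sp2l _ _, ?_⟩
      have e : w = c • ((c⁻¹ • w - l • u) + l • u) := by
        rw [sub_add_cancel, smul_smul, mul_inv_cancel₀ hc0, one_smul]
      have hm : c • ((c⁻¹ • w - l • u) + l • u) ∈ sp2 F u (c⁻¹ • w - l • u) :=
        Submodule.smul_mem _ _ (add_mem (mem_sp2r _ _) (Submodule.smul_mem _ _ (mem_sp2l _ _)))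
      rwa [← e] at hm

end Concrete

end UStab

namespace UStab

set_option linter.unusedSectionVars false
set_option linter.unusedVariables false
set_option linter.unusedSimpArgs false

section Euclid

open GroupHomologyBar

variable {F : Type} [Field F] {σ : F →+* F}

/-- the Euclidean Hermitian form -/
abbrev eu (σ : F →+* F) (n : ℕ) : (Fin n → F) → (Fin n → F) → F :=
  pairForm F (fun s t : F => σ s * t) n

/-- append a coordinate -/
def sn {n : ℕ} (x : Fin n → F) (s : F) : Fin (n + 1) → F := (lastSplit F n).symm (x, s)

lemma eu_sn {n : ℕ} (x y : Fin n → F) (s t : F) :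
    eu σ (n + 1) (sn x s) (sn y t) = eu σ n x y + σ s * t := pairForm_snoc F _ n x y s t

lemma eu_split {n : ℕ} (v w : Fin (n + 1) → F) : eu σ (n + 1) v w =
    eu σ n (lastSplit F n v).1 (lastSplit F n w).1
      + 1 * (σ (lastSplit F n v).2 * (lastSplit F n w).2) := by
  have := eu_sn (σ := σ) (lastSplit F n v).1 (lastSplit F n w).1 (lastSplit F n v).2
    (lastSplit F n w).2
  simp only [sn, Prod.mk.eta, LinearEquiv.symm_apply_apply] at this
  rw [this, one_mul]

lemma eu_herm (hinv : ∀ x, σ (σ x) = x) (hne : ∃ x, σ x ≠ x) (n : ℕ) : Herm σ (eu σ n) := by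
  induction n with
  | zero =>
    refine ⟨hinv, hne, ?_, ?_, ?_, ?_⟩
    · intro v w w'; simp [eu, pairForm]
    · intro v c w; simp [eu, pairForm]
    · intro v w; simp [eu, pairForm]
    · intro f; refine ⟨0, fun w => ?_⟩
      rw [Subsingleton.elim w 0, map_zero]; simp [eu, pairForm]
  | succ n ih =>
    exact Herm_add ih (lastSplit F n) 1 one_ne_zero (map_one σ) eu_split

/-- inclusion of the smaller space -/
def inc (n : ℕ) : (Fin n → F) →ₗ[F] (Fin (n + 1) → F) :=
  (lastSplit F n).symm.toLinearMap ∘ₗ LinearMap.inl F (Fin n → F) F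

lemma inc_apply {n : ℕ} (x : Fin n → F) : inc n x = sn x 0 := rfl

lemma sn_inj {n : ℕ} {x y : Fin n → F} {s t : F} (e : sn x s = sn y t) : x = y ∧ s = t := by
  have := (lastSplit F n).symm.injective e
  exact ⟨congrArg Prod.fst this, congrArg Prod.snd this⟩

lemma sn_zero {n : ℕ} : (sn 0 0 : Fin (n + 1) → F) = 0 := map_zero (lastSplit F n).symm

lemma sn_smul {n : ℕ} (c : F) (x : Fin n → F) (s : F) : c • sn x s = sn (c • x) (c * s) :=
  (map_smul (lastSplit F n).symm c (x, s)).symm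

variable (hh : ∀ n, Herm σ (eu σ n))

lemma step2 {a : F} (ha : σ a * a = -1) {n m : ℕ} (hJ : J (hh n) m ⊥) :
    J (hh (n + 2)) (m + 1) ⊥ := by
  have z1 := fun n v => (hh n).zerol v
  have z2 := fun n v => (hh n).zeror v
  refine D3 _ (u := sn (sn 0 1) a) ?_ ?_ (mem_prp.2 ?_) ?_
  · rw [Submodule.mem_bot, ← sn_zero, ← sn_zero]
    intro e
    exact one_ne_zero (sn_inj (sn_inj e).1).2
  · rw [eu_sn, eu_sn, z1, ha]; simp
  · intro t ht; rw [(Submodule.mem_bot F).1 ht, z1]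
  · refine J_emb (hh n) _ (inc (n + 1) ∘ₗ inc n) (fun x y => ?_) (fun x _ => ?_) hJ
    · simp only [LinearMap.comp_apply, inc_apply, eu_sn]; simp
    · rw [bot_sup_eq, mem_prp_sp1]
      simp only [LinearMap.comp_apply, inc_apply, eu_sn, z1]; simp

lemma step4 (hinv : ∀ x, σ (σ x) = x) {a b : F} (ha : σ a * a + σ b * b = -1) {n m : ℕ}
    (hJ : J (hh n) m ⊥) : J (hh (n + 4)) (m + 2) ⊥ := by
  have z1 := fun n v => (hh n).zerol v
  have z2 := fun n v => (hh n).zeror v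
  refine D3 _ (u := sn (sn (sn (sn 0 1) a) b) 0) ?_ ?_ (mem_prp.2 ?_)
    (D3 _ (u := sn (sn (sn (sn 0 0) (- σ b)) (σ a)) 1) ?_ ?_ ?_ ?_)
  · rw [Submodule.mem_bot, ← sn_zero, ← sn_zero, ← sn_zero, ← sn_zero]
    intro e
    exact one_ne_zero (sn_inj (sn_inj (sn_inj (sn_inj e).1).1).1).2
  · simp only [eu_sn, z1]
    simp only [map_one, map_zero]
    linear_combination ha
  · intro t ht; rw [(Submodule.mem_bot F).1 ht, z1]
  · rw [bot_sup_eq, sp1, Submodule.mem_span_singleton]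
    rintro ⟨c, e⟩
    simp only [sn_smul] at e
    have := (sn_inj e).2
    simp at this
  · simp only [eu_sn, z1, map_neg, hinv]
    simp only [map_one, map_zero]
    linear_combination ha
  · rw [bot_sup_eq, mem_prp_sp1]
    simp only [eu_sn, z1]
    simp only [map_one, map_zero]
    ring
  · refine J_emb (hh n) _ (inc (n + 3) ∘ₗ inc (n + 2) ∘ₗ inc (n + 1) ∘ₗ inc n) (fun x y => ?_)
      (fun x _ => ?_) hJ
    · simp only [LinearMap.comp_apply, inc_apply, eu_sn]; simp
    · rw [bot_sup_eq]
      refine sup_le_prp (mem_prp_sp1.2 ?_) (mem_prp_sp1.2 ?_) <;>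
      · simp only [LinearMap.comp_apply, inc_apply, eu_sn, z1]; simp

lemma J_norm {a : F} (ha : σ a * a = -1) {n m : ℕ} (hn : 2 * m ≤ n) : J (hh n) m ⊥ := by
  induction m generalizing n with
  | zero => trivial
  | succ m ih =>
    obtain ⟨n, rfl⟩ : ∃ k, n = k + 2 := ⟨n - 2, by omega⟩
    exact step2 hh ha (ih (by omega))

lemma J_gen (hinv : ∀ x, σ (σ x) = x) {a b : F} (ha : σ a * a + σ b * b = -1) {m : ℕ} :
    ∀ {n : ℕ}, 2 * m + 2 ≤ n → J (hh n) m ⊥ := by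
  induction m using Nat.strong_induction_on with
  | _ m ih =>
    intro n hn
    match m, ih, hn with
    | 0, _, _ => trivial
    | 1, _, hn =>
      obtain ⟨n, rfl⟩ : ∃ k, n = k + 4 := ⟨n - 4, by omega⟩
      exact J_succ _ (step4 hh hinv ha (m := 0) trivial)
    | m + 2, ih, hn =>
      obtain ⟨n, rfl⟩ : ∃ k, n = k + 4 := ⟨n - 4, by omega⟩
      exact step4 hh hinv ha (ih m (by omega) (by omega))

lemma stab_sn {n : ℕ} (g : bilinIsoms F (eu σ n)) (x : Fin n → F) (s : F) :
    (bilinStab F (fun s t : F => σ s * t) n g).1 (sn x s) = sn (g.1 x) s :=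
  stabAut_symm_apply F n g.1 x s

lemma stab_inj (n : ℕ) : Function.Injective (bilinStab F (fun s t : F => σ s * t) n) := by
  intro g g' e
  refine Subtype.ext (LinearEquiv.ext fun x => ?_)
  have := congrArg (fun k => k.1 (sn x 0)) e
  simp only [stab_sn] at this
  exact (sn_inj this).1

lemma stab_range {n : ℕ} (hn : Herm σ (eu σ n)) (g : bilinIsoms F (eu σ (n + 1)))
    (hg : g.1 (sn 0 1) = sn 0 1) : ∃ g', bilinStab F (fun s t : F => σ s * t) n g' = g := by
  obtain ⟨g0, h0⟩ := descend (lastSplit F n) 1 one_ne_zero hn.zerol eu_split g hg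
  refine ⟨g0, Subtype.ext (LinearEquiv.ext fun v => ?_)⟩
  rw [h0 v]
  have := stab_sn g0 (lastSplit F n v).1 (lastSplit F n v).2
  simpa only [sn, Prod.mk.eta, LinearEquiv.symm_apply_apply] using this

include hh in
lemma surj_main {n q : ℕ} (v : Fin n → F) (hv : eu σ n v v = -1) (hJ : J (hh (n + 1)) (q + 1) ⊥) :
    Function.Surjective (inducedMap ℤ (bilinStab F (fun s t : F => σ s * t) n) q) := by
  have hu : eu σ (n + 1) (sn v 1) (sn v 1) = 0 := by rw [eu_sn, hv]; simp
  have hw : eu σ (n + 1) (sn v 1) (sn 0 1) ≠ 0 := by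
    rw [eu_sn, (hh n).zeror]; simp
  obtain ⟨x', hx, e⟩ := hyp_of (hh (n + 1)) hu hw
  refine abs_surj (hh (n + 1)) hx _ (stab_inj n) (fun g hg => ?_) q hJ
  rw [e] at hg
  exact stab_range (hh n) g (mem_Fx.1 hg _ (mem_sp2r _ _))

/-- the form with an added negative coordinate -/
def ng (σ : F →+* F) (n : ℕ) (v w : (Fin n → F) × F) : F := eu σ n v.1 w.1 + -1 * (σ v.2 * w.2)

/-- extension of isometries to the form with a negative coordinate -/
def ngStab (σ : F →+* F) (n : ℕ) : bilinIsoms F (eu σ n) →* bilinIsoms F (ng σ n) where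
  toFun g := ⟨g.1.prodCongr (LinearEquiv.refl F F), by
    intro v w
    change eu σ n (g.1 v.1) (g.1 w.1) + _ = _
    rw [g.2]; rfl⟩
  map_one' := rfl
  map_mul' g h := rfl

lemma ngStab_apply {n : ℕ} (g : bilinIsoms F (eu σ n)) (v : (Fin n → F) × F) :
    (ngStab σ n g).1 v = (g.1 v.1, v.2) := rfl

lemma ng_herm {n : ℕ} (hn : Herm σ (eu σ n)) : Herm σ (ng σ n) :=
  Herm_add hn (LinearEquiv.refl F _) (-1) (neg_ne_zero.2 one_ne_zero) (by simp) (fun v w => rfl)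

lemma ng_descend {n : ℕ} (hn : Herm σ (eu σ n)) (g : bilinIsoms F (ng σ n))
    (hg : g.1 (0, 1) = (0, 1)) : ∃ g0 : bilinIsoms F (eu σ n), ∀ v, g.1 v = (g0.1 v.1, v.2) :=
  descend (LinearEquiv.refl F ((Fin n → F) × F)) (-1) (neg_ne_zero.2 one_ne_zero)
      hn.zerol (fun v w => rfl) g hg

include hh in
lemma inj_main {n q : ℕ} (hJ : J (hh n) (q + 1) ⊥) :
    Function.Injective (inducedMap ℤ (bilinStab F (fun s t : F => σ s * t) n) q) := by
  have z1 := fun n v => (hh n).zerol v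
  have z2 := fun n v => (hh n).zeror v
  have hN : Herm σ (ng σ (n + 1)) := ng_herm (hh (n + 1))
  have hu : ng σ (n + 1) (sn 0 1, 1) (sn 0 1, 1) = 0 := by
    simp only [ng, eu_sn, z1, map_one]; ring
  have hw : ng σ (n + 1) (sn 0 1, 1) (0, 1) ≠ 0 := by
    simp only [ng, z2, map_one]; simp
  obtain ⟨x', hx, e⟩ := hyp_of hN hu hw
  refine abs_inj hN hx (bilinStab F (fun s t : F => σ s * t) n) (ngStab σ (n + 1)) ?_ (stab_inj n)
    (fun g => ?_) (fun g hg => ?_) q ?_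
  · intro g g' e
    refine Subtype.ext (LinearEquiv.ext fun x => ?_)
    have := congrArg (fun k => k.1 (x, 0)) e
    simp only [ngStab_apply] at this
    exact congrArg Prod.fst this
  · rw [e]
    apply mem_Fx_span
    intro v hv
    rw [smul_def, ngStab_apply]
    rcases hv with rfl | hv
    · rw [stab_sn, map_zero]
    · rw [Set.mem_singleton_iff.1 hv, map_zero]
  · rw [e] at hg
    have f1 := mem_Fx.1 hg _ (mem_sp2l _ _)
    have f2 := mem_Fx.1 hg _ (mem_sp2r _ _)
    obtain ⟨g0, h0⟩ := ng_descend (hh (n + 1)) g f2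
    have h3 : g0.1 (sn 0 1) = sn 0 1 := by
      rw [smul_def, h0] at f1
      exact congrArg Prod.fst f1
    obtain ⟨g', hg'⟩ := stab_range (hh n) g0 h3
    refine ⟨g', Subtype.ext (LinearEquiv.ext fun v => ?_)⟩
    rw [hg', h0 v, ngStab_apply]
  · refine D3 hN (u := (sn 0 1, 1)) ?_ hu (mem_prp.2 ?_) ?_
    · rw [Submodule.mem_bot]
      intro e
      exact one_ne_zero (congrArg Prod.snd e)
    · intro t ht; rw [(Submodule.mem_bot F).1 ht, hN.zerol]
    · refine J_emb (hh n) _ (LinearMap.inl F _ F ∘ₗ inc n) (fun x y => ?_) (fun x _ => ?_) hJ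
      · simp only [LinearMap.comp_apply, inc_apply, LinearMap.inl_apply, ng, eu_sn]; simp
      · rw [bot_sup_eq, mem_prp_sp1]
        simp only [LinearMap.comp_apply, inc_apply, LinearMap.inl_apply, ng, eu_sn, z1]; simp

theorem final (F : Type) [Field F] (σ : F →+* F)
    (hinv : ∀ x, σ (σ x) = x) (hne : σ ≠ RingHom.id F) (hab : ∃ a b, σ a * a + σ b * b = -1)
    (n d : ℕ) :
    (2 * d + 4 ≤ n → Function.Bijective (inducedMap ℤ (bilinStab F (fun s t : F => σ s * t) n) d)) ∧
    (2 * d + 3 ≤ n → Function.Surjective (inducedMap ℤ (bilinStab F (fun s t : F => σ s * t) n) d)) ∧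
    ((∃ a, σ a * a = -1) →
      (2 * d + 2 ≤ n →
        Function.Bijective (inducedMap ℤ (bilinStab F (fun s t : F => σ s * t) n) d)) ∧
      (2 * d + 1 ≤ n →
        Function.Surjective (inducedMap ℤ (bilinStab F (fun s t : F => σ s * t) n) d))) := by
  have hne' : ∃ x, σ x ≠ x := by
    by_contra hc
    push Not at hc
    exact hne (RingHom.ext hc)
  have hh : ∀ n, Herm σ (eu σ n) := eu_herm hinv hne'
  obtain ⟨a, b, hab⟩ := hab
  have s1 : 2 * d + 3 ≤ n →
      Function.Surjective (inducedMap ℤ (bilinStab F (fun s t : F => σ s * t) n) d) := by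
    intro hn
    obtain ⟨k, rfl⟩ : ∃ k, n = k + 2 := ⟨n - 2, by omega⟩
    refine surj_main hh (sn (sn 0 a) b) ?_ (J_gen hh hinv hab (by omega))
    rw [eu_sn, eu_sn, (hh k).zerol, zero_add, hab]
  refine ⟨fun hn => ⟨inj_main hh (J_gen hh hinv hab (by omega)), s1 (by omega)⟩, s1, ?_⟩
  rintro ⟨c, hc⟩
  have s2 : 2 * d + 1 ≤ n →
      Function.Surjective (inducedMap ℤ (bilinStab F (fun s t : F => σ s * t) n) d) := by
    intro hn
    obtain ⟨k, rfl⟩ : ∃ k, n = k + 1 := ⟨n - 1, by omega⟩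
    refine surj_main hh (sn 0 c) ?_ (J_norm hh hc (by omega))
    rw [eu_sn, (hh k).zerol, zero_add, hc]
  exact ⟨fun hn => ⟨inj_main hh (J_norm hh hc (by omega)), s2 (by omega)⟩, s2⟩

end Euclid

end UStab

open GroupHomologyBar in
/-- Homological stability for the Euclidean unitary groups `U(n,F,σ)` over a field other
than `𝔽₂` with a nontrivial involution `σ` such that `-1 = σ(a)a + σ(b)b` for some
`a, b ∈ F`.  Here `U(n,F,σ)` is realized as the group
`bilinIsoms F (pairForm F (fun s t => σ s * t) n)` of linear automorphisms of `Fⁿ`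
preserving the Hermitian form `ω(v,w) = ∑ᵢ σ(vᵢ) wᵢ`, and the stabilization map
`U(n,F,σ) → U(n+1,F,σ)` extends an isometry by the identity on an added coordinate.  It
induces an isomorphism on integral group homology `H_d` whenever `2d ≤ n - 4` and a
surjection whenever `2d ≤ n - 3`; moreover, if `-1 = σ(a)a` for some `a ∈ F`, an
isomorphism whenever `2d ≤ n - 2` and a surjection whenever `2d ≤ n - 1`. -/
theorem U_euclidean_homology_stability (F : Type) [Field F] (hF : ∃ x : F, x ≠ 0 ∧ x ≠ 1)
    (σ : F →+* F) (hinv : ∀ x, σ (σ x) = x) (hne : σ ≠ RingHom.id F)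
    (hab : ∃ a b : F, σ a * a + σ b * b = -1) (n d : ℕ) :
    (2 * d + 4 ≤ n →
      Function.Bijective (inducedMap ℤ (bilinStab F (fun s t : F => σ s * t) n) d)) ∧
    (2 * d + 3 ≤ n →
      Function.Surjective (inducedMap ℤ (bilinStab F (fun s t : F => σ s * t) n) d)) ∧
    ((∃ a : F, σ a * a = -1) →
      (2 * d + 2 ≤ n →
        Function.Bijective (inducedMap ℤ (bilinStab F (fun s t : F => σ s * t) n) d)) ∧
      (2 * d + 1 ≤ n →
        Function.Surjective (inducedMap ℤ (bilinStab F (fun s t : F => σ s * t) n) d))) := by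
  exact UStab.final F σ hinv hne hab n d
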